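/- Suppose that 1 < c < 82/79 and set γ = 1/c. For a positive integer N put P = 10⁻⁹ N^γ, D = log N, and Γ₁ = Σ_{d ≤ D} μ(d) Σ_{P < p ≤ 2P} (log p) · #{m ∈ ℕ : d² ∣ m and [p^c] + [m^c] = N}, where p runs over primes. Then there exist a constant C > 0 and N₀ such that Γ₁ ≥ C · N^{2γ−1} for all integers N ≥ N₀. -/

import Mathlib

/-- `P = 10⁻⁹ N^γ` where `γ = 1/c`. -/
noncomputable def PP (c : ℝ) (N : ℕ) : ℝ := ((10 : ℝ) ^ 9)⁻¹ * (N : ℝ) ^ (1 / c)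

/-- The primes `P < p ≤ 2P`.  (Any such prime satisfies `p ≤ N`, so the
range `Finset.range (N+1)` captures all of them.) -/
noncomputable def primesIn (c : ℝ) (N : ℕ) : Finset ℕ :=
  (Finset.range (N + 1)).filter
    (fun p => p.Prime ∧ PP c N < (p : ℝ) ∧ (p : ℝ) ≤ 2 * PP c N)

/-- `#{m ∈ ℕ : d² ∣ m and [p^c] + [m^c] = N}`. -/
noncomputable def cnt (c : ℝ) (N d p : ℕ) : ℕ :=
  {m : ℕ | 0 < m ∧ d ^ 2 ∣ m ∧ ⌊(p : ℝ) ^ c⌋ + ⌊(m : ℝ) ^ c⌋ = (N : ℤ)}.ncard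

/-- `Γ₁ = Σ_{d ≤ D} μ(d) Σ_{P < p ≤ 2P} (log p) · #{m ∈ ℕ : d² ∣ m, [p^c]+[m^c]=N}`,
with `D = log N`. -/
noncomputable def Γ₁ (c : ℝ) (N : ℕ) : ℝ :=
  ∑ d ∈ Finset.Icc 1 ⌊Real.log N⌋₊,
    ((ArithmeticFunction.moebius d : ℤ) : ℝ) *
      ∑ p ∈ primesIn c N, Real.log p * (cnt c N d p : ℝ)

namespace SquarefreeSum

open Finset

/-- The additive character `e(x) = exp(2πix)`. -/
noncomputable def e (x : ℝ) : ℂ := Complex.exp ((2 * Real.pi * x : ℝ) * Complex.I)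

lemma norm_e (x : ℝ) : ‖e x‖ = 1 := Complex.norm_exp_ofReal_mul_I _

lemma e_add (x y : ℝ) : e (x + y) = e x * e y := by
  unfold e
  rw [← Complex.exp_add]
  push_cast
  ring_nf

lemma e_zero : e 0 = 1 := by simp [e]

lemma e_int (n : ℤ) : e n = 1 := by
  unfold e
  rw [Complex.exp_eq_one_iff]
  exact ⟨n, by push_cast; ring⟩

lemma e_sub_int (x : ℝ) (n : ℤ) : e (x - n) = e x := by
  have := e_add (x - n) n
  rw [e_int, mul_one, sub_add_cancel] at this
  exact this.symm

lemma conj_e (x : ℝ) : (starRingEnd ℂ) (e x) = e (-x) := by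
  unfold e
  rw [← Complex.exp_conj, map_mul, Complex.conj_ofReal, Complex.conj_I]
  push_cast
  ring_nf

lemma e_eq (x : ℝ) : e x = Real.cos (2 * Real.pi * x) + Real.sin (2 * Real.pi * x) * Complex.I := by
  unfold e
  rw [Complex.exp_mul_I]
  simp

/-- `1 / (e(x) - 1) = -1/2 - (i/2) cot(πx)`, in multiplied form. -/
lemma cot_mul_e_sub_one {x : ℝ} (hx : Real.sin (Real.pi * x) ≠ 0) :
    (-(1 / 2 : ℂ) - (Real.cos (Real.pi * x) / Real.sin (Real.pi * x) / 2 : ℝ) * Complex.I)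
      * (e x - 1) = 1 := by
  rw [e_eq, show 2 * Real.pi * x = 2 * (Real.pi * x) by ring, Real.cos_two_mul, Real.sin_two_mul]
  have h1 : (Real.sin (Real.pi * x) : ℂ) ^ 2 + (Real.cos (Real.pi * x) : ℂ) ^ 2 = 1 := by
    exact_mod_cast Real.sin_sq_add_cos_sq (Real.pi * x)
  have h2 : (Real.sin (Real.pi * x) : ℂ) ≠ 0 := by exact_mod_cast hx
  push_cast at h1 h2 ⊢
  set s := Complex.sin (Real.pi * x)
  set c := Complex.cos (Real.pi * x)
  have hI : Complex.I ^ 2 = -1 := Complex.I_sq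
  field_simp
  linear_combination (-c * Complex.I * 2) * h1 + (-2 * s * c ^ 2) * hI

lemma two_mul_le_sin {x δ : ℝ} (hδ : 0 < δ) (h1 : δ ≤ x) (h2 : x ≤ 1 - δ) :
    2 * δ ≤ Real.sin (Real.pi * x) := by
  have key : ∀ y : ℝ, δ ≤ y → y ≤ 1 / 2 → 2 * δ ≤ Real.sin (Real.pi * y) := by
    intro y hy1 hy2
    have := Real.mul_le_sin (x := Real.pi * y) (by nlinarith [Real.pi_pos])
      (by nlinarith [Real.pi_pos])
    have h3 : 2 / Real.pi * (Real.pi * y) = 2 * y := by field_simp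
    linarith
  rcases le_total x (1 / 2) with h | h
  · exact key x h1 h
  · have := key (1 - x) (by linarith) (by linarith)
    rwa [mul_sub, mul_one, Real.sin_pi_sub] at this

lemma cot_sub_nonneg {x y : ℝ} (hx : 0 < x) (hxy : x ≤ y) (hy : y < 1) :
    Real.cos (Real.pi * y) / Real.sin (Real.pi * y)
      ≤ Real.cos (Real.pi * x) / Real.sin (Real.pi * x) := by
  have hs : ∀ z : ℝ, 0 < z → z < 1 → 0 < Real.sin (Real.pi * z) := fun z h1 h2 ↦
    Real.sin_pos_of_pos_of_lt_pi (by positivity) (by nlinarith [Real.pi_pos])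
  rw [div_le_div_iff₀ (hs y (by linarith) hy) (hs x hx (by linarith))]
  have h := Real.sin_nonneg_of_nonneg_of_le_pi (x := Real.pi * y - Real.pi * x)
    (by nlinarith [Real.pi_pos]) (by nlinarith [Real.pi_pos])
  rw [Real.sin_sub] at h
  linarith

/-- The Kusmin–Landau inequality in discrete form, with differences in `[δ, 1 - δ]`. -/
lemma kusmin_landau_aux (f : ℕ → ℝ) {a b : ℕ} {δ : ℝ} (hδ : 0 < δ)
    (hmono : ∀ n, a ≤ n → n + 1 < b → f (n + 1) - f n ≤ f (n + 2) - f (n + 1))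
    (hlo : ∀ n, a ≤ n → n < b → δ ≤ f (n + 1) - f n)
    (hhi : ∀ n, a ≤ n → n < b → f (n + 1) - f n ≤ 1 - δ) :
    ‖∑ n ∈ Ico a b, e (f n)‖ ≤ 1 / δ := by
  rcases le_or_gt b a with hab | hab
  · rw [Ico_eq_empty_of_le hab, sum_empty, norm_zero]; positivity
  set c : ℕ → ℝ := fun n ↦ Real.cos (Real.pi * (f (n + 1) - f n))
    / Real.sin (Real.pi * (f (n + 1) - f n)) with hc
  set w : ℕ → ℂ := fun n ↦ -(1 / 2 : ℂ) - (c n / 2 : ℝ) * Complex.I with hw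
  have hsin : ∀ n, a ≤ n → n < b → 2 * δ ≤ Real.sin (Real.pi * (f (n + 1) - f n)) :=
    fun n h1 h2 ↦ two_mul_le_sin hδ (hlo n h1 h2) (hhi n h1 h2)
  have hwE : ∀ n, a ≤ n → n < b → w n * e (f (n + 1)) = w n * e (f n) + e (f n) := by
    intro n h1 h2
    have h3 := cot_mul_e_sub_one (x := f (n + 1) - f n) (by linarith [hsin n h1 h2])
    have h4 : e (f (n + 1)) = e (f n) * e (f (n + 1) - f n) := by rw [← e_add]; congr 1; ring
    rw [h4]
    have h5 : w n * (e (f (n + 1) - f n) - 1) = 1 := h3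
    linear_combination e (f n) * h5
  have hcb : ∀ n, a ≤ n → n < b → |c n| ≤ 1 / (2 * δ) := by
    intro n h1 h2
    have h3 := hsin n h1 h2
    simp only [hc]
    rw [abs_div, abs_of_pos (a := Real.sin _) (by linarith)]
    exact div_le_div₀ zero_le_one (Real.abs_cos_le_one _) (by positivity) h3
  have hwn : ∀ n, a ≤ n → n < b → ‖w n‖ ≤ 1 / (4 * δ) := by
    intro n h1 h2
    have h3 := cot_mul_e_sub_one (x := f (n + 1) - f n) (by linarith [hsin n h1 h2])
    have h4 : 4 * δ ≤ ‖e (f (n + 1) - f n) - 1‖ := by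
      have h5 : ‖e (f (n + 1) - f n) - 1‖ = 2 * |Real.sin (Real.pi * (f (n + 1) - f n))| := by
        unfold e
        rw [mul_comm _ Complex.I, Complex.norm_exp_I_mul_ofReal_sub_one, Real.norm_eq_abs, abs_mul]
        norm_num
        ring_nf
      rw [h5]
      linarith [hsin n h1 h2, le_abs_self (Real.sin (Real.pi * (f (n + 1) - f n)))]
    have h6 : ‖w n‖ * ‖e (f (n + 1) - f n) - 1‖ = 1 := by
      rw [← norm_mul]
      have : w n * (e (f (n + 1) - f n) - 1) = 1 := h3
      rw [this, norm_one]
    rw [le_div_iff₀ (by positivity)]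
    nlinarith [norm_nonneg (w n)]
  have key : ∀ m, a + 1 + m ≤ b → ‖∑ n ∈ Ico a (a + 1 + m), e (f n)
      - w (a + m) * e (f (a + 1 + m))‖ ≤ ‖w a‖ + (c a - c (a + m)) / 2 := by
    intro m
    induction m with
    | zero =>
      intro h
      simp only [add_zero, Nat.Ico_succ_singleton, sum_singleton, sub_self, zero_div]
      rw [hwE a le_rfl (by omega),
        show e (f a) - (w a * e (f a) + e (f a)) = -(w a * e (f a)) by ring,
        norm_neg, norm_mul, norm_e, mul_one]
    | succ m ih =>
      intro h
      have ih' := ih (by omega)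
      have hE := hwE (a + 1 + m) (by omega) (by omega)
      have e1 : a + 1 + (m + 1) = a + 1 + m + 1 := by ring
      have e2 : a + (m + 1) = a + 1 + m := by ring
      rw [e1, e2, sum_Ico_succ_top (by omega), hE]
      have h3 : (∑ n ∈ Ico a (a + 1 + m), e (f n)) + e (f (a + 1 + m))
          - (w (a + 1 + m) * e (f (a + 1 + m)) + e (f (a + 1 + m)))
          = ((∑ n ∈ Ico a (a + 1 + m), e (f n)) - w (a + m) * e (f (a + 1 + m)))
            + (w (a + m) - w (a + 1 + m)) * e (f (a + 1 + m)) := by ring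
      rw [h3]
      refine (norm_add_le _ _).trans ?_
      rw [norm_mul, norm_e, mul_one]
      have hcc : c (a + 1 + m) ≤ c (a + m) := by
        have h5 := hmono (a + m) (by omega) (by omega)
        have h6 := hlo (a + m) (by omega) (by omega)
        have h7 := hhi (a + 1 + m) (by omega) (by omega)
        rw [show a + m + 2 = a + 1 + m + 1 by ring, show a + m + 1 = a + 1 + m by ring] at h5
        simp only [hc]
        rw [show a + m + 1 = a + 1 + m by ring] at h6 ⊢
        exact cot_sub_nonneg (by linarith) h5 (by linarith)
      have h4 : ‖w (a + m) - w (a + 1 + m)‖ = (c (a + m) - c (a + 1 + m)) / 2 := by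
        simp only [hw]
        rw [show -(1 / 2 : ℂ) - (c (a + m) / 2 : ℝ) * Complex.I
            - (-(1 / 2 : ℂ) - (c (a + 1 + m) / 2 : ℝ) * Complex.I)
            = ((-((c (a + m) - c (a + 1 + m)) / 2) : ℝ) : ℂ) * Complex.I by push_cast; ring,
          norm_mul, Complex.norm_I, mul_one, Complex.norm_real, Real.norm_eq_abs, abs_neg,
          abs_of_nonneg (by linarith)]
      rw [h4]
      linarith
  obtain ⟨m, rfl⟩ : ∃ m, b = a + 1 + m := ⟨b - (a + 1), by omega⟩
  have h1 := key m le_rfl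
  have h2 := hwn a le_rfl (by omega)
  have h3 := hwn (a + m) (by omega) (by omega)
  have h4 := hcb a le_rfl (by omega)
  have h5 := hcb (a + m) (by omega) (by omega)
  have h6 : ‖∑ n ∈ Ico a (a + 1 + m), e (f n)‖ ≤ ‖∑ n ∈ Ico a (a + 1 + m), e (f n)
      - w (a + m) * e (f (a + 1 + m))‖ + ‖w (a + m)‖ := by
    have := norm_add_le (∑ n ∈ Ico a (a + 1 + m), e (f n)
      - w (a + m) * e (f (a + 1 + m))) (w (a + m) * e (f (a + 1 + m)))
    rwa [sub_add_cancel, norm_mul (w (a + m)), norm_e, mul_one] at this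
  have h7 : 1 / (2 * δ) = 1 / δ / 2 := by field_simp
  have h8 : 1 / (4 * δ) = 1 / δ / 4 := by field_simp
  rw [h7] at h4 h5
  rw [h8] at h2 h3
  linarith [abs_le.1 h4, abs_le.1 h5, (abs_le.1 h4).2, (abs_le.1 h5).1]

/-- The Kusmin–Landau inequality in discrete form. -/
lemma kusmin_landau (f : ℕ → ℝ) {a b : ℕ} {δ : ℝ} (hδ : 0 < δ) (ν : ℤ)
    (hmono : ∀ n, a ≤ n → n + 1 < b → f (n + 1) - f n ≤ f (n + 2) - f (n + 1))
    (hlo : ∀ n, a ≤ n → n < b → ν + δ ≤ f (n + 1) - f n)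
    (hhi : ∀ n, a ≤ n → n < b → f (n + 1) - f n ≤ ν + 1 - δ) :
    ‖∑ n ∈ Ico a b, e (f n)‖ ≤ 1 / δ := by
  have h := kusmin_landau_aux (fun n ↦ f n - ν * n) (a := a) (b := b) hδ
    (fun n h1 h2 ↦ by have := hmono n h1 h2; push_cast; linarith)
    (fun n h1 h2 ↦ by have := hlo n h1 h2; push_cast; linarith)
    (fun n h1 h2 ↦ by have := hhi n h1 h2; push_cast; linarith)
  refine le_of_eq_of_le ?_ h
  congr 1
  refine sum_congr rfl fun n _ ↦ ?_
  have := e_sub_int (f n) (ν * n)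
  push_cast at this
  exact this.symm

/-- A finite set of naturals without gaps is an interval. -/
lemma exists_eq_Ico_of_ordConnected {T : Finset ℕ} {a b : ℕ} (hT : T ⊆ Ico a b)
    (hc : ∀ x ∈ T, ∀ z ∈ T, ∀ y, x ≤ y → y ≤ z → y ∈ T) :
    ∃ a' b', T = Ico a' b' ∧ a ≤ a' ∧ b' ≤ b := by
  rcases T.eq_empty_or_nonempty with rfl | hne
  · exact ⟨a, 0, by simp, le_rfl, by omega⟩
  · have h1 := hT (T.min'_mem hne)
    have h2 := hT (T.max'_mem hne)
    rw [mem_Ico] at h1 h2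
    refine ⟨T.min' hne, T.max' hne + 1, ?_, h1.1, h2.2⟩
    ext x
    rw [mem_Ico]
    exact ⟨fun hx ↦ ⟨T.min'_le x hx, Nat.lt_succ_of_le (T.le_max' x hx)⟩,
      fun hx ↦ hc _ (T.min'_mem hne) _ (T.max'_mem hne) x hx.1 (Nat.le_of_lt_succ hx.2)⟩

lemma norm_sum_e_le_card (T : Finset ℕ) (f : ℕ → ℝ) : ‖∑ n ∈ T, e (f n)‖ ≤ T.card := by
  refine (norm_sum_le _ _).trans ?_
  simp [norm_e]

/-- The second difference test with positive second differences. -/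
lemma norm_sum_e_le_of_second_diff (f : ℕ → ℝ) {a b : ℕ} {l L : ℝ} (hl : 0 < l)
    (hlo : ∀ n, a ≤ n → n + 2 ≤ b → l ≤ (f (n + 2) - f (n + 1)) - (f (n + 1) - f n))
    (hhi : ∀ n, a ≤ n → n + 2 ≤ b → (f (n + 2) - f (n + 1)) - (f (n + 1) - f n) ≤ L) (hL : l ≤ L) :
    ‖∑ n ∈ Ico a b, e (f n)‖ ≤ 4 * (((b - a : ℕ) : ℝ) * L + 2) * (1 / √l + 1) := by
  have hba : (0 : ℝ) ≤ ((b - a : ℕ) : ℝ) := Nat.cast_nonneg _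
  have hsl : 0 < √l := Real.sqrt_pos.2 hl
  rcases le_or_gt b a with hab | hab
  · rw [Ico_eq_empty_of_le hab, sum_empty, norm_zero]
    have : 0 ≤ L := by linarith
    positivity
  rcases lt_or_ge 1 l with hl1 | hl1
  · refine (norm_sum_e_le_card _ _).trans ?_
    rw [Nat.card_Ico]
    have h1 : ((b - a : ℕ) : ℝ) ≤ ((b - a : ℕ) : ℝ) * L := le_mul_of_one_le_right hba (by linarith)
    have h2 : 0 < 1 / √l := by positivity
    nlinarith
  set δ := √l / 2 with hδ
  have hδ0 : 0 < δ := by positivity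
  have hδ1 : δ ≤ 1 / 2 := by
    have : √l ≤ 1 := Real.sqrt_le_one.2 hl1
    linarith
  set g : ℕ → ℝ := fun n ↦ f (n + 1) - f n with hg
  have hstep : ∀ n, a ≤ n → n + 2 ≤ b → g n + l ≤ g (n + 1) ∧ g (n + 1) ≤ g n + L := by
    intro n h1 h2
    have := hlo n h1 h2
    have := hhi n h1 h2
    simp only [hg]
    constructor <;> linarith
  have hdist : ∀ k n, a ≤ n → n + k < b → g n + k * l ≤ g (n + k) ∧ g (n + k) ≤ g n + k * L := by
    intro k
    induction k with
    | zero => intro n _ _; simp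
    | succ k ih =>
      intro n h1 h2
      have h3 := ih n h1 (by omega)
      have h4 := hstep (n + k) (by omega) (by omega)
      rw [← add_assoc]
      push_cast
      constructor <;> linarith [h3.1, h3.2, h4.1, h4.2]
  have hmono : ∀ x y, a ≤ x → x ≤ y → y < b → g x ≤ g y := by
    intro x y h1 h2 h3
    obtain ⟨k, rfl⟩ := Nat.exists_eq_add_of_le h2
    have := (hdist k x h1 h3).1
    have : 0 ≤ (k : ℝ) * l := by positivity
    linarith
  set F : ℕ → ℤ := fun n ↦ ⌊g n + δ⌋ with hF
  have hbound : ∀ ν : ℤ, ‖∑ n ∈ (Ico a b).filter (fun n ↦ F n = ν), e (f n)‖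
      ≤ (2 * δ / l + 1) + 1 / δ := by
    intro ν
    have hFν : ∀ n, F n = ν ↔ (ν : ℝ) - δ ≤ g n ∧ g n < ν + 1 - δ := by
      intro n
      simp only [hF]
      rw [Int.floor_eq_iff]
      constructor <;> rintro ⟨h1, h2⟩ <;> constructor <;> linarith
    rw [← sum_filter_add_sum_filter_not ((Ico a b).filter (fun n ↦ F n = ν)) (fun n ↦ g n < ν + δ),
      filter_filter, filter_filter]
    have hA : ∃ a' b', (Ico a b).filter (fun n ↦ F n = ν ∧ g n < ν + δ) = Ico a' b'
        ∧ a ≤ a' ∧ b' ≤ b := by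
      refine exists_eq_Ico_of_ordConnected (filter_subset _ _) ?_
      intro x hx z hz y hxy hyz
      simp only [mem_filter, mem_Ico, hFν] at hx hz ⊢
      have h1 := hmono x y hx.1.1 hxy (by omega)
      have h2 := hmono y z (by omega) hyz hz.1.2
      exact ⟨⟨by omega, by omega⟩, ⟨by linarith [hx.2.1.1], by linarith [hz.2.1.2]⟩, by
        linarith [hz.2.2]⟩
    have hB : ∃ a' b', (Ico a b).filter (fun n ↦ F n = ν ∧ ¬ g n < ν + δ) = Ico a' b'
        ∧ a ≤ a' ∧ b' ≤ b := by
      refine exists_eq_Ico_of_ordConnected (filter_subset _ _) ?_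
      intro x hx z hz y hxy hyz
      simp only [mem_filter, mem_Ico, hFν, not_lt] at hx hz ⊢
      have h1 := hmono x y hx.1.1 hxy (by omega)
      have h2 := hmono y z (by omega) hyz hz.1.2
      exact ⟨⟨by omega, by omega⟩, ⟨by linarith [hx.2.1.1], by linarith [hz.2.1.2]⟩, by
        linarith [hx.2.2]⟩
    refine (norm_add_le _ _).trans (add_le_add ?_ ?_)
    · obtain ⟨a', b', hE, h1, h2⟩ := hA
      refine (norm_sum_e_le_card _ _).trans ?_
      rw [hE, Nat.card_Ico]
      rcases le_or_gt b' a' with h | h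
      · rw [Nat.sub_eq_zero_of_le h]
        push_cast
        positivity
      · have m1 : a' ∈ Ico a' b' := by simp [h]
        have m2 : b' - 1 ∈ Ico a' b' := by simp; omega
        rw [← hE] at m1 m2
        simp only [mem_filter, mem_Ico, hFν] at m1 m2
        have h3 := (hdist (b' - 1 - a') a' h1 (by omega)).1
        rw [show a' + (b' - 1 - a') = b' - 1 by omega] at h3
        have h4 : ((b' - a' : ℕ) : ℝ) = ((b' - 1 - a' : ℕ) : ℝ) + 1 := by
          rw [← Nat.cast_succ]; congr 1; omega
        rw [h4]
        gcongr
        rw [le_div_iff₀ hl]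
        linarith [m1.2.1.1, m2.2.2]
    · obtain ⟨a', b', hE, h1, h2⟩ := hB
      rw [hE]
      have hmem : ∀ n, a' ≤ n → n < b' → (a ≤ n ∧ n < b) ∧
          ((ν : ℝ) - δ ≤ g n ∧ g n < ν + 1 - δ) ∧ (ν : ℝ) + δ ≤ g n := by
        intro n h3 h4
        have m : n ∈ Ico a' b' := by simp [h3, h4]
        rw [← hE] at m
        simpa only [mem_filter, mem_Ico, hFν, not_lt] using m
      refine kusmin_landau f hδ0 ν ?_ ?_ ?_
      · intro n h3 h4
        exact hmono n (n + 1) (by omega) (by omega) (by omega)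
      · intro n h3 h4
        exact (hmem n h3 h4).2.2
      · intro n h3 h4
        exact (hmem n h3 h4).2.1.2.le
  have hmaps : ∀ n ∈ Ico a b, F n ∈ Icc (F a) (F (b - 1)) := by
    intro n hn
    rw [mem_Ico] at hn
    rw [mem_Icc]
    exact ⟨Int.floor_le_floor (by linarith [hmono a n le_rfl hn.1 hn.2]),
      Int.floor_le_floor (by linarith [hmono n (b - 1) hn.1 (by omega) (by omega)])⟩
  rw [← sum_fiberwise_of_maps_to hmaps]
  refine (norm_sum_le _ _).trans ((sum_le_sum fun ν _ ↦ hbound ν).trans ?_)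
  rw [sum_const, nsmul_eq_mul, Int.card_Icc]
  have hcard : (((F (b - 1) + 1 - F a).toNat : ℕ) : ℝ) ≤ ((b - a : ℕ) : ℝ) * L + 2 := by
    have h1 : F a ≤ F (b - 1) + 1 := by
      have := mem_Icc.1 (hmaps a (by simp [hab])); omega
    have h2 : (((F (b - 1) + 1 - F a).toNat : ℕ) : ℝ) = ((F (b - 1) + 1 - F a : ℤ) : ℝ) := by
      rw [← Int.cast_natCast, Int.toNat_of_nonneg (by omega)]
    rw [h2]
    push_cast
    have h3 : (F (b - 1) : ℝ) ≤ g (b - 1) + δ := Int.floor_le _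
    have h4 : g a + δ < F a + 1 := Int.lt_floor_add_one _
    have h5 := (hdist (b - 1 - a) a le_rfl (by omega)).2
    rw [show a + (b - 1 - a) = b - 1 by omega] at h5
    have h6 : ((b - 1 - a : ℕ) : ℝ) * L ≤ ((b - a : ℕ) : ℝ) * L := by
      have : 0 ≤ L := by linarith
      gcongr
      omega
    linarith
  have h7 : 2 * δ / l + 1 + 1 / δ = 3 / √l + 1 := by
    rw [hδ]
    have := Real.mul_self_sqrt hl.le
    have e1 : 2 * (√l / 2) / l = 1 / √l := by
      rw [div_eq_div_iff hl.ne' hsl.ne']; linarith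
    rw [e1]
    field_simp
    ring
  rw [h7]
  have h8 : 3 / √l = 3 * (1 / √l) := by ring
  have h9 : 0 < 1 / √l := by positivity
  calc _ ≤ (((b - a : ℕ) : ℝ) * L + 2) * (3 / √l + 1) := by gcongr
    _ ≤ _ := by
      rw [h8]
      have : 0 ≤ ((b - a : ℕ) : ℝ) * L + 2 := by
        have : 0 ≤ L := by linarith
        positivity
      nlinarith

/-- The second difference test: second differences of constant sign and size in `[l, L]`. -/
lemma norm_sum_e_le_of_abs_second_diff (f : ℕ → ℝ) {a b : ℕ} {l L : ℝ} (hl : 0 < l) (hL : l ≤ L)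
    (h : (∀ n, a ≤ n → n + 2 ≤ b → l ≤ f (n + 2) - 2 * f (n + 1) + f n
        ∧ f (n + 2) - 2 * f (n + 1) + f n ≤ L) ∨
      (∀ n, a ≤ n → n + 2 ≤ b → l ≤ -(f (n + 2) - 2 * f (n + 1) + f n)
        ∧ -(f (n + 2) - 2 * f (n + 1) + f n) ≤ L)) :
    ‖∑ n ∈ Ico a b, e (f n)‖ ≤ 4 * (((b - a : ℕ) : ℝ) * L + 2) * (1 / √l + 1) := by
  rcases h with h | h
  · exact norm_sum_e_le_of_second_diff f hl (fun n h1 h2 ↦ by linarith [(h n h1 h2).1])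
      (fun n h1 h2 ↦ by linarith [(h n h1 h2).2]) hL
  · have := norm_sum_e_le_of_second_diff (fun n ↦ -f n) (a := a) (b := b) hl
      (fun n h1 h2 ↦ by linarith [(h n h1 h2).1]) (fun n h1 h2 ↦ by linarith [(h n h1 h2).2]) hL
    refine le_of_eq_of_le ?_ this
    rw [← RCLike.norm_conj, map_sum]
    congr 1
    exact sum_congr rfl fun n _ ↦ conj_e _

section

/-- A second difference is a value of the second derivative. -/
lemma exists_second_diff_eq {f f₁ f₂ : ℝ → ℝ} {x : ℝ}
    (h1 : ∀ t ∈ Set.Icc x (x + 2), HasDerivAt f (f₁ t) t)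
    (h2 : ∀ t ∈ Set.Icc x (x + 2), HasDerivAt f₁ (f₂ t) t) :
    ∃ t ∈ Set.Icc x (x + 2), f (x + 2) - 2 * f (x + 1) + f x = f₂ t := by
  have hd : ∀ t ∈ Set.Icc x (x + 1),
      HasDerivAt (fun t ↦ f (t + 1) - f t) (f₁ (t + 1) - f₁ t) t := by
    intro t ht
    refine HasDerivAt.sub ?_ (h1 t ⟨ht.1, by linarith [ht.2]⟩)
    exact (h1 (t + 1) ⟨by linarith [ht.1], by linarith [ht.2]⟩).comp_add_const t 1
  obtain ⟨y, hy, hy'⟩ := exists_hasDerivAt_eq_slope (fun t ↦ f (t + 1) - f t)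
    (fun t ↦ f₁ (t + 1) - f₁ t) (show x < x + 1 by linarith)
    (fun t ht ↦ (hd t ht).continuousAt.continuousWithinAt)
    (fun t ht ↦ hd t (Set.Ioo_subset_Icc_self ht))
  have hsub : Set.Icc y (y + 1) ⊆ Set.Icc x (x + 2) :=
    Set.Icc_subset_Icc hy.1.le (by linarith [hy.2])
  obtain ⟨z, hz, hz'⟩ := exists_hasDerivAt_eq_slope f₁ f₂ (show y < y + 1 by linarith)
    (fun t ht ↦ (h2 t (hsub ht)).continuousAt.continuousWithinAt)
    (fun t ht ↦ h2 t (hsub (Set.Ioo_subset_Icc_self ht)))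
  refine ⟨z, hsub (Set.Ioo_subset_Icc_self hz), ?_⟩
  rw [hz', add_sub_cancel_left, div_one, hy', add_sub_cancel_left, div_one]
  ring_nf

/-- A phase function on `[A, B]` with derivatives `φ₁` and `φ₂` such that, up to sign, `φ₂` takes
values in `[l, L]` and the derivative `κ` of `x ^ 2 * φ₂ x` takes values in `[g, G]`. -/
structure Phase (φ φ₁ φ₂ κ : ℝ → ℝ) (A B l L g G : ℝ) : Prop where
  deriv₁ : ∀ x ∈ Set.Icc A B, HasDerivAt φ (φ₁ x) x
  deriv₂ : ∀ x ∈ Set.Icc A B, HasDerivAt φ₁ (φ₂ x) x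
  deriv₃ : ∀ x ∈ Set.Icc A B, HasDerivAt (fun x ↦ x ^ 2 * φ₂ x) (κ x) x
  bound₂ : (∀ x ∈ Set.Icc A B, l ≤ φ₂ x ∧ φ₂ x ≤ L) ∨ (∀ x ∈ Set.Icc A B, l ≤ -φ₂ x ∧ -φ₂ x ≤ L)
  bound₃ : (∀ x ∈ Set.Icc A B, g ≤ κ x ∧ κ x ≤ G) ∨ (∀ x ∈ Set.Icc A B, g ≤ -κ x ∧ -κ x ≤ G)
  pos₂ : 0 < l
  le₂ : l ≤ L
  pos₃ : 0 < g
  le₃ : g ≤ G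

variable {φ φ₁ φ₂ κ : ℝ → ℝ} {A B l L g G : ℝ}

lemma Phase.second_diff (h : Phase φ φ₁ φ₂ κ A B l L g G) {k : ℝ} (hk : 0 < k) :
    (∀ x : ℝ, A ≤ k * x → k * (x + 2) ≤ B →
      k ^ 2 * l ≤ φ (k * (x + 2)) - 2 * φ (k * (x + 1)) + φ (k * x) ∧
      φ (k * (x + 2)) - 2 * φ (k * (x + 1)) + φ (k * x) ≤ k ^ 2 * L) ∨
    (∀ x : ℝ, A ≤ k * x → k * (x + 2) ≤ B →
      k ^ 2 * l ≤ -(φ (k * (x + 2)) - 2 * φ (k * (x + 1)) + φ (k * x)) ∧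
      -(φ (k * (x + 2)) - 2 * φ (k * (x + 1)) + φ (k * x)) ≤ k ^ 2 * L) := by
  have key : ∀ x : ℝ, A ≤ k * x → k * (x + 2) ≤ B → ∃ y ∈ Set.Icc A B,
      φ (k * (x + 2)) - 2 * φ (k * (x + 1)) + φ (k * x) = k ^ 2 * φ₂ y := by
    intro x h1 h2
    have hm : ∀ t ∈ Set.Icc x (x + 2), k * t ∈ Set.Icc A B := fun t ht ↦
      ⟨by nlinarith [ht.1], by nlinarith [ht.2]⟩
    have hl : ∀ t, HasDerivAt (fun t : ℝ ↦ k * t) k t := fun t ↦ by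
      simpa using (hasDerivAt_id t).const_mul k
    obtain ⟨t, ht, he⟩ := exists_second_diff_eq (f := fun t ↦ φ (k * t))
      (f₁ := fun t ↦ k * φ₁ (k * t)) (f₂ := fun t ↦ k ^ 2 * φ₂ (k * t)) (x := x)
      (fun t ht ↦ ((h.deriv₁ _ (hm t ht)).comp t (hl t)).congr_deriv (by ring))
      (fun t ht ↦ (((h.deriv₂ _ (hm t ht)).comp t (hl t)).const_mul k).congr_deriv (by ring))
    exact ⟨k * t, hm t ht, he⟩
  refine h.bound₂.imp (fun hb x h1 h2 ↦ ?_) (fun hb x h1 h2 ↦ ?_) <;>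
  · obtain ⟨y, hy, he⟩ := key x h1 h2
    rw [he]
    have := hb y hy
    constructor <;> nlinarith [sq_nonneg k]

/-- The second differences of the difference of the phase along two multiples. -/
lemma Phase.second_diff_sub (h : Phase φ φ₁ φ₂ κ A B l L g G) {n n' u v : ℝ}
    (hn : 0 < n) (hnn : n < n') (hu : 0 < u) :
    (∀ x : ℝ, u ≤ x → x + 2 ≤ v → A ≤ n * x → n' * (x + 2) ≤ B →
      (n' - n) * g / v ≤ (φ (n' * (x + 2)) - φ (n * (x + 2)))
        - 2 * (φ (n' * (x + 1)) - φ (n * (x + 1))) + (φ (n' * x) - φ (n * x)) ∧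
      (φ (n' * (x + 2)) - φ (n * (x + 2)))
        - 2 * (φ (n' * (x + 1)) - φ (n * (x + 1))) + (φ (n' * x) - φ (n * x))
        ≤ (n' - n) * G / u) ∨
    (∀ x : ℝ, u ≤ x → x + 2 ≤ v → A ≤ n * x → n' * (x + 2) ≤ B →
      (n' - n) * g / v ≤ -((φ (n' * (x + 2)) - φ (n * (x + 2)))
        - 2 * (φ (n' * (x + 1)) - φ (n * (x + 1))) + (φ (n' * x) - φ (n * x))) ∧
      -((φ (n' * (x + 2)) - φ (n * (x + 2)))
        - 2 * (φ (n' * (x + 1)) - φ (n * (x + 1))) + (φ (n' * x) - φ (n * x)))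
        ≤ (n' - n) * G / u) := by
  have key : ∀ x : ℝ, u ≤ x → x + 2 ≤ v → A ≤ n * x → n' * (x + 2) ≤ B → ∃ t ∈ Set.Icc u v,
      ∃ y ∈ Set.Icc A B, (φ (n' * (x + 2)) - φ (n * (x + 2)))
        - 2 * (φ (n' * (x + 1)) - φ (n * (x + 1))) + (φ (n' * x) - φ (n * x))
        = (n' - n) * κ y / t := by
    intro x hux hxv h1 h2
    have hx : 0 < x := by linarith
    have hm : ∀ t ∈ Set.Icc x (x + 2), ∀ s ∈ Set.Icc n n', s * t ∈ Set.Icc A B := by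
      intro t ht s hs
      have ht0 : 0 < t := by linarith [ht.1]
      have hs0 : 0 < s := by linarith [hs.1]
      constructor
      · calc A ≤ n * x := h1
          _ ≤ s * t := mul_le_mul hs.1 ht.1 hx.le hs0.le
      · calc s * t ≤ n' * (x + 2) := mul_le_mul hs.2 ht.2 ht0.le (by linarith)
          _ ≤ B := h2
    have hmn : ∀ t ∈ Set.Icc x (x + 2), n * t ∈ Set.Icc A B := fun t ht ↦
      hm t ht n ⟨le_rfl, hnn.le⟩
    have hmn' : ∀ t ∈ Set.Icc x (x + 2), n' * t ∈ Set.Icc A B := fun t ht ↦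
      hm t ht n' ⟨hnn.le, le_rfl⟩
    have hl : ∀ k t, HasDerivAt (fun t : ℝ ↦ k * t) k t := fun k t ↦ by
      simpa using (hasDerivAt_id t).const_mul k
    obtain ⟨t, ht, he⟩ := exists_second_diff_eq (f := fun t ↦ φ (n' * t) - φ (n * t))
      (f₁ := fun t ↦ n' * φ₁ (n' * t) - n * φ₁ (n * t))
      (f₂ := fun t ↦ n' ^ 2 * φ₂ (n' * t) - n ^ 2 * φ₂ (n * t)) (x := x)
      (fun t ht ↦ (((h.deriv₁ _ (hmn' t ht)).comp t (hl _ t)).sub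
        ((h.deriv₁ _ (hmn t ht)).comp t (hl _ t))).congr_deriv (by ring))
      (fun t ht ↦ ((((h.deriv₂ _ (hmn' t ht)).comp t (hl _ t)).const_mul n').sub
        (((h.deriv₂ _ (hmn t ht)).comp t (hl _ t)).const_mul n)).congr_deriv (by ring))
    have ht0 : 0 < t := by linarith [ht.1]
    have hsub : Set.Icc (n * t) (n' * t) ⊆ Set.Icc A B :=
      Set.Icc_subset_Icc (hmn t ht).1 (hmn' t ht).2
    obtain ⟨y, hy, hy'⟩ := exists_hasDerivAt_eq_slope (fun x ↦ x ^ 2 * φ₂ x) κ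
      (show n * t < n' * t by nlinarith)
      (fun z hz ↦ (h.deriv₃ z (hsub hz)).continuousAt.continuousWithinAt)
      (fun z hz ↦ h.deriv₃ z (hsub (Set.Ioo_subset_Icc_self hz)))
    refine ⟨t, ⟨by linarith [ht.1], by linarith [ht.2]⟩, y, hsub (Set.Ioo_subset_Icc_self hy), ?_⟩
    rw [he, hy', eq_div_iff ht0.ne']
    have : n' * t - n * t ≠ 0 := by nlinarith
    have h3 : n' - n ≠ 0 := by linarith
    rw [show n' * t - n * t = (n' - n) * t by ring]
    field_simp
  have hfin : ∀ t ∈ Set.Icc u v, ∀ z, g ≤ z → z ≤ G →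
      (n' - n) * g / v ≤ (n' - n) * z / t ∧ (n' - n) * z / t ≤ (n' - n) * G / u := by
    intro t ht z h1 h2
    have ht0 : 0 < t := by linarith [ht.1]
    have hg := h.pos₃
    have h3 : 0 < n' - n := by linarith
    have hz : 0 < z := by linarith
    have hG : 0 < G := by linarith
    constructor
    · exact div_le_div₀ (by positivity) (by gcongr) ht0 ht.2
    · exact div_le_div₀ (by positivity) (by gcongr) hu ht.1
  refine h.bound₃.imp (fun hb x h1 h2 h3 h4 ↦ ?_) (fun hb x h1 h2 h3 h4 ↦ ?_)
  · obtain ⟨t, ht, y, hy, he⟩ := key x h1 h2 h3 h4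
    rw [he]
    exact hfin t ht _ (hb y hy).1 (hb y hy).2
  · obtain ⟨t, ht, y, hy, he⟩ := key x h1 h2 h3 h4
    rw [he, show -((n' - n) * κ y / t) = (n' - n) * (-κ y) / t by ring]
    exact hfin t ht _ (hb y hy).1 (hb y hy).2

lemma norm_sum_Ioc_e_le (f : ℕ → ℝ) {a b : ℕ} {l L : ℝ} (hl : 0 < l) (hL : l ≤ L)
    (h : (∀ n : ℕ, a + 1 ≤ n → n + 2 ≤ b →
        l ≤ f (n + 2) - 2 * f (n + 1) + f n ∧ f (n + 2) - 2 * f (n + 1) + f n ≤ L) ∨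
      (∀ n : ℕ, a + 1 ≤ n → n + 2 ≤ b →
        l ≤ -(f (n + 2) - 2 * f (n + 1) + f n) ∧ -(f (n + 2) - 2 * f (n + 1) + f n) ≤ L)) :
    ‖∑ n ∈ Ioc a b, e (f n)‖ ≤ 5 * (((b - a : ℕ) : ℝ) * L + 2) * (1 / √l + 1) := by
  have hL0 : 0 < L := by linarith
  have hp : 0 < 1 / √l := by have := Real.sqrt_pos.2 hl; positivity
  rcases le_or_gt b a with hab | hab
  · rw [Ioc_eq_empty_of_le hab, sum_empty, norm_zero]
    positivity
  have hIoc : Ioc a b = insert b (Ico (a + 1) b) := by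
    ext x; simp only [mem_Ioc, mem_insert, mem_Ico]; omega
  rw [hIoc, sum_insert (by simp)]
  have main := norm_sum_e_le_of_abs_second_diff f hl hL h
  have hcard : ((b - (a + 1) : ℕ) : ℝ) ≤ ((b - a : ℕ) : ℝ) := by gcongr; omega
  refine (norm_add_le _ _).trans ?_
  rw [norm_e]
  have h2 : 4 * (((b - (a + 1) : ℕ) : ℝ) * L + 2) * (1 / √l + 1)
      ≤ 4 * (((b - a : ℕ) : ℝ) * L + 2) * (1 / √l + 1) := by gcongr
  have h3 : 0 ≤ ((b - a : ℕ) : ℝ) * L := by positivity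
  nlinarith

/-- Sums of a smooth phase over a progression of multiples of `k`. -/
lemma Phase.norm_sum_mul_le (h : Phase φ φ₁ φ₂ κ A B l L g G) {k a b : ℕ} (hk : 0 < k)
    (ha : A ≤ k * ((a + 1 : ℕ) : ℝ)) (hb : (k : ℝ) * b ≤ B) :
    ‖∑ n ∈ Ioc a b, e (φ (k * n))‖ ≤
      5 * (((b - a : ℕ) : ℝ) * (k ^ 2 * L) + 2) * (1 / (k * √l) + 1) := by
  have hkR : (0 : ℝ) < k := by exact_mod_cast hk
  have hl := h.pos₂
  have hs : √((k : ℝ) ^ 2 * l) = k * √l := by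
    rw [Real.sqrt_mul (by positivity), Real.sqrt_sq hkR.le]
  have hkb : ∀ n : ℕ, a + 1 ≤ n → A ≤ k * (n : ℝ) := fun n hn ↦
    ha.trans (by gcongr)
  have hkb' : ∀ n : ℕ, n + 2 ≤ b → k * ((n : ℝ) + 2) ≤ B := fun n hn ↦
    le_trans (by gcongr; exact_mod_cast hn) hb
  rw [← hs]
  refine norm_sum_Ioc_e_le (fun n : ℕ ↦ φ (k * n)) (by positivity) (by gcongr; exact h.le₂) ?_
  refine (h.second_diff hkR).imp (fun hh n h1 h2 ↦ ?_) (fun hh n h1 h2 ↦ ?_) <;>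
  · have := hh n (hkb n h1) (hkb' n h2)
    push_cast
    exact this

end

section

variable {φ φ₁ φ₂ κ : ℝ → ℝ} {A B : ℕ} {X l L g G : ℝ}

/-- Correlation of the phase along two different multiples. -/
lemma Phase.norm_sum_sub_le (h : Phase φ φ₁ φ₂ κ A B l L g G) (hX : 0 < X) (hA : X ≤ A)
    (hB : B ≤ 2 * X) {n₀ Q n n' : ℕ} (hn₀ : 0 < n₀) (hQ : Q ≤ n₀) (hn : n₀ < n) (hnn : n < n')
    (hn' : n' ≤ n₀ + Q) :
    ‖∑ m ∈ Ioc (A / n) (B / n'), e (φ (n' * m) - φ (n * m))‖ ≤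
      5 * ((4 * √Q * G + 2) * √(2 * (X / n₀) / g) + (4 * Q * G + 2)) := by
  have hnR : (0 : ℝ) < n := by exact_mod_cast (by omega : 0 < n)
  have hn0R : (0 : ℝ) < n₀ := by exact_mod_cast hn₀
  have hnnR : (n : ℝ) < n' := by exact_mod_cast hnn
  have hn0n : (n₀ : ℝ) < n := by exact_mod_cast hn
  have hg := h.pos₃
  have hG : 0 < G := by linarith [h.le₃]
  set q : ℝ := n' - n with hq
  have hq1 : 1 ≤ q := by
    have : (n : ℝ) + 1 ≤ n' := by exact_mod_cast hnn
    linarith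
  have hqQ : q ≤ Q := by
    have h1 : (n' : ℝ) ≤ n₀ + Q := by exact_mod_cast hn'
    linarith
  have hQn : (Q : ℝ) ≤ n₀ := by exact_mod_cast hQ
  set M : ℝ := X / n₀ with hM
  have hM0 : 0 < M := by positivity
  have hXM : X = M * n₀ := by rw [hM]; field_simp
  have hn2 : (n : ℝ) ≤ 2 * n₀ := by exact_mod_cast (by omega : n ≤ 2 * n₀)
  have hu : 0 < X / n := by positivity
  have hsub := h.second_diff_sub hnR hnnR (v := 2 * M) hu
  have hll : q * g / (2 * M) ≤ q * (2 * G) / M := by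
    rw [div_le_div_iff₀ (by positivity) hM0]
    have := h.le₃
    have : q * g * M ≤ q * G * M := by gcongr
    have : 0 ≤ q * G * M := by positivity
    nlinarith
  have main := norm_sum_Ioc_e_le (fun m : ℕ ↦ φ (n' * m) - φ (n * m)) (a := A / n) (b := B / n')
    (l := q * g / (2 * M)) (L := q * (2 * G) / M) (by positivity) hll (by
      have e1 : q * G / (X / n) ≤ q * (2 * G) / M := by
        rw [div_le_div_iff₀ hu hM0, div_eq_mul_inv, hXM]
        have : M * n₀ * (n : ℝ)⁻¹ = M * (n₀ / n) := by ring
        rw [this]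
        have h2 : 1 / 2 ≤ (n₀ : ℝ) / n := by rw [div_le_div_iff₀ (by norm_num) hnR]; linarith
        have : q * (2 * G) * (M * (1 / 2)) ≤ q * (2 * G) * (M * (n₀ / n)) := by gcongr
        linarith
      have c1 : ∀ m : ℕ, A / n + 1 ≤ m → (A : ℝ) ≤ n * m := by
        intro m hm
        have : A < n * m := by
          rw [mul_comm]; exact (Nat.div_lt_iff_lt_mul (by omega)).1 (by omega)
        exact_mod_cast this.le
      have c2 : ∀ m : ℕ, m + 2 ≤ B / n' → (n' : ℝ) * (m + 2) ≤ B := by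
        intro m hm
        have : (m + 2) * n' ≤ B := (Nat.le_div_iff_mul_le (by omega)).1 hm
        rw [mul_comm]
        exact_mod_cast this
      have c3 : ∀ m : ℕ, A / n + 1 ≤ m → X / n ≤ m := by
        intro m hm
        rw [div_le_iff₀ hnR, mul_comm]
        exact hA.trans (c1 m hm)
      have c4 : ∀ m : ℕ, m + 2 ≤ B / n' → (m : ℝ) + 2 ≤ 2 * M := by
        intro m hm
        have h1 := c2 m hm
        have h2 : (n₀ : ℝ) * (m + 2) ≤ n' * (m + 2) := by gcongr; linarith
        rw [hXM] at hB
        have : (n₀ : ℝ) * (m + 2) ≤ n₀ * (2 * M) := by linarith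
        exact le_of_mul_le_mul_left this hn0R
      refine hsub.imp (fun hh m h1 h2 ↦ ?_) (fun hh m h1 h2 ↦ ?_) <;>
      · have := hh m (c3 m h1) (c4 m h2) (c1 m h1) (c2 m h2)
        push_cast
        exact ⟨this.1, this.2.trans e1⟩)
  refine main.trans ?_
  have hlen : ((B / n' - A / n : ℕ) : ℝ) ≤ 2 * M := by
    have h1 : ((B / n' - A / n : ℕ) : ℝ) ≤ ((B / n' : ℕ) : ℝ) := by
      exact_mod_cast Nat.sub_le _ _
    have h2 : ((B / n' : ℕ) : ℝ) ≤ B / n' := Nat.cast_div_le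
    have h3 : (B : ℝ) / n' ≤ 2 * X / n₀ := by gcongr; linarith
    rw [hM]
    calc _ ≤ _ := h1.trans (h2.trans h3)
      _ = _ := by ring
  have hs : √(q * g / (2 * M)) = √q / √(2 * M / g) := by
    rw [← Real.sqrt_div' _ (by positivity)]
    congr 1
    field_simp
  have hW : 0 < √(2 * M / g) := Real.sqrt_pos.2 (by positivity)
  set W := √(2 * M / g)
  have hsq : 1 ≤ √q := Real.one_le_sqrt.2 hq1
  have hqq : √q * √q = q := Real.mul_self_sqrt (by linarith)
  have hsQ : √q ≤ √Q := Real.sqrt_le_sqrt hqQ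
  rw [hs, mul_assoc]
  have h4 : ((B / n' - A / n : ℕ) : ℝ) * (q * (2 * G) / M) + 2 ≤ 4 * q * G + 2 := by
    have : ((B / n' - A / n : ℕ) : ℝ) * (q * (2 * G) / M) ≤ 2 * M * (q * (2 * G) / M) := by gcongr
    have h5 : 2 * M * (q * (2 * G) / M) = 4 * q * G := by field_simp; ring
    linarith
  have h6 : 0 ≤ 1 / (√q / W) + 1 := by positivity
  calc 5 * ((((B / n' - A / n : ℕ) : ℝ) * (q * (2 * G) / M) + 2) * (1 / (√q / W) + 1))
      ≤ 5 * ((4 * q * G + 2) * (1 / (√q / W) + 1)) := by gcongr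
    _ = 5 * ((4 * √q * G + 2 / √q) * W + (4 * q * G + 2)) := by
        rw [one_div_div]
        have : q / √q = √q := by rw [div_eq_iff (by positivity)]; exact hqq.symm
        have : (4 * q * G + 2) * (W / √q) = (4 * (q / √q) * G + 2 / √q) * W := by ring
        rw [mul_add, this, mul_one, ‹q / √q = √q›]
    _ ≤ _ := by
        have : 2 / √q ≤ 2 := div_le_self (by norm_num) hsq
        gcongr

lemma norm_sum_e_sub_comm (s : Finset ℕ) (f g : ℕ → ℝ) :
    ‖∑ m ∈ s, e (f m - g m)‖ = ‖∑ m ∈ s, e (g m - f m)‖ := by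
  rw [← RCLike.norm_conj, map_sum]
  simp only [conj_e, neg_sub]

/-- Bilinear sums with one variable in a short block. -/
lemma Phase.norm_bilinear_block_sq_le (h : Phase φ φ₁ φ₂ κ A B l L g G) (hX : 0 < X) (hA : X ≤ A)
    (hB : B ≤ 2 * X) {n₀ Q : ℕ} (hn₀ : 0 < n₀) (hQ : Q ≤ n₀) {u v : ℕ → ℂ} (hu : ∀ n, ‖u n‖ ≤ 1)
    (hv : ∀ n, ‖v n‖ ≤ 1) :
    ‖∑ n ∈ Ioc n₀ (n₀ + Q), ∑ m ∈ Ioc (A / n) (B / n), u n * v m * e (φ (n * m))‖ ^ 2 ≤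
      2 * (X / n₀) * (Q * (2 * (X / n₀)) +
        Q ^ 2 * (5 * ((4 * √Q * G + 2) * √(2 * (X / n₀) / g) + (4 * Q * G + 2)))) := by
  set E : ℝ := 5 * ((4 * √Q * G + 2) * √(2 * (X / n₀) / g) + (4 * Q * G + 2)) with hE
  have hG : 0 < G := h.pos₃.trans_le h.le₃
  have hE0 : 0 ≤ E := by positivity
  set R := Ioc 0 (B / n₀) with hR
  set F : ℕ → ℕ → ℂ := fun n m ↦ if m ∈ Ioc (A / n) (B / n) then u n * e (φ (n * m)) else 0 with hF
  have hFn : ∀ n m, ‖F n m‖ ≤ 1 := by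
    intro n m
    simp only [hF]
    split_ifs
    · rw [norm_mul, norm_e, mul_one]; exact hu n
    · simp
  have hRc : (R.card : ℝ) ≤ 2 * (X / n₀) := by
    rw [hR, Nat.card_Ioc, Nat.sub_zero]
    calc ((B / n₀ : ℕ) : ℝ) ≤ B / n₀ := Nat.cast_div_le
      _ ≤ 2 * X / n₀ := by gcongr
      _ = _ := by ring
  have hT : ∑ n ∈ Ioc n₀ (n₀ + Q), ∑ m ∈ Ioc (A / n) (B / n), u n * v m * e (φ (n * m))
      = ∑ m ∈ R, v m * ∑ n ∈ Ioc n₀ (n₀ + Q), F n m := by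
    simp only [mul_sum]
    rw [sum_comm]
    refine sum_congr rfl fun n hn ↦ ?_
    rw [mem_Ioc] at hn
    have hsub : Ioc (A / n) (B / n) ⊆ R := by
      intro m hm
      rw [mem_Ioc] at hm
      rw [hR, mem_Ioc]
      exact ⟨Nat.zero_lt_of_lt hm.1, hm.2.trans (Nat.div_le_div_left hn.1.le hn₀)⟩
    rw [← sum_subset hsub (fun m _ hm ↦ by simp only [hF, if_neg hm, mul_zero])]
    refine sum_congr rfl fun m hm ↦ ?_
    simp only [hF, if_pos hm]
    ring
  have hpair : ∀ n ∈ Ioc n₀ (n₀ + Q), ∀ n' ∈ Ioc n₀ (n₀ + Q), n < n' →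
      ‖∑ m ∈ R, F n m * (starRingEnd ℂ) (F n' m)‖ ≤ E := by
    intro n hn n' hn' hnn
    rw [mem_Ioc] at hn hn'
    have hsub : Ioc (A / n) (B / n') ⊆ R := by
      intro m hm
      rw [mem_Ioc] at hm
      rw [hR, mem_Ioc]
      exact ⟨Nat.zero_lt_of_lt hm.1, hm.2.trans (Nat.div_le_div_left hn'.1.le hn₀)⟩
    rw [← sum_subset hsub]
    · have : ∀ m ∈ Ioc (A / n) (B / n'), F n m * (starRingEnd ℂ) (F n' m)
          = u n * (starRingEnd ℂ) (u n') * e (φ (n * m) - φ (n' * m)) := by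
        intro m hm
        rw [mem_Ioc] at hm
        have h1 : A / n' ≤ A / n := Nat.div_le_div_left hnn.le (by omega)
        have h2 : B / n' ≤ B / n := Nat.div_le_div_left hnn.le (by omega)
        simp only [hF]
        rw [if_pos (mem_Ioc.2 ⟨hm.1, by omega⟩), if_pos (mem_Ioc.2 ⟨by omega, hm.2⟩), map_mul,
          conj_e, sub_eq_add_neg, e_add]
        ring
      rw [sum_congr rfl this, ← mul_sum, norm_mul, norm_mul, RCLike.norm_conj]
      have h3 := h.norm_sum_sub_le hX hA hB hn₀ hQ hn.1 hnn hn'.2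
      rw [norm_sum_e_sub_comm, ← hE] at h3
      calc _ ≤ 1 * 1 * E := by gcongr <;> apply hu
        _ = E := by ring
    · intro m hm hm'
      rw [mem_Ioc] at hm'
      by_cases h1 : m ∈ Ioc (A / n) (B / n)
      · by_cases h2 : m ∈ Ioc (A / n') (B / n')
        · rw [mem_Ioc] at h1 h2
          exact absurd ⟨h1.1, h2.2⟩ hm'
        · simp only [hF, if_neg h2, map_zero, mul_zero]
      · simp only [hF, if_neg h1, zero_mul]
  have hall : ∀ n ∈ Ioc n₀ (n₀ + Q), ∀ n' ∈ Ioc n₀ (n₀ + Q),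
      ‖∑ m ∈ R, F n m * (starRingEnd ℂ) (F n' m)‖ ≤ (if n = n' then (R.card : ℝ) else 0) + E := by
    intro n hn n' hn'
    rcases lt_trichotomy n n' with h1 | h1 | h1
    · rw [if_neg h1.ne, zero_add]
      exact hpair n hn n' hn' h1
    · rw [if_pos h1]
      refine (norm_sum_le _ _).trans ?_
      have : ∑ m ∈ R, ‖F n m * (starRingEnd ℂ) (F n' m)‖ ≤ ∑ m ∈ R, (1 : ℝ) := by
        refine sum_le_sum fun m _ ↦ ?_
        rw [norm_mul, RCLike.norm_conj]
        exact mul_le_one₀ (hFn _ _) (norm_nonneg _) (hFn _ _)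
      rw [sum_const, nsmul_eq_mul, mul_one] at this
      linarith
    · rw [if_neg h1.ne', zero_add, ← RCLike.norm_conj, map_sum]
      refine le_of_eq_of_le ?_ (hpair n' hn' n hn h1)
      congr 1
      refine sum_congr rfl fun m _ ↦ ?_
      rw [map_mul, RCLike.conj_conj, mul_comm]
  have hsq : ∑ m ∈ R, ‖∑ n ∈ Ioc n₀ (n₀ + Q), F n m‖ ^ 2 ≤ Q * R.card + Q ^ 2 * E := by
    have h1 : ((∑ m ∈ R, ‖∑ n ∈ Ioc n₀ (n₀ + Q), F n m‖ ^ 2 : ℝ) : ℂ)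
        = ∑ n ∈ Ioc n₀ (n₀ + Q), ∑ n' ∈ Ioc n₀ (n₀ + Q),
          ∑ m ∈ R, F n m * (starRingEnd ℂ) (F n' m) := by
      push_cast
      have : ∀ m ∈ R, (‖∑ n ∈ Ioc n₀ (n₀ + Q), F n m‖ : ℂ) ^ 2 = ∑ n ∈ Ioc n₀ (n₀ + Q),
          ∑ n' ∈ Ioc n₀ (n₀ + Q), F n m * (starRingEnd ℂ) (F n' m) := by
        intro m _
        rw [← Complex.mul_conj', map_sum, sum_mul_sum]
      rw [sum_congr rfl this, sum_comm]
      refine sum_congr rfl fun n _ ↦ ?_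
      rw [sum_comm]
    have h2 : ∑ m ∈ R, ‖∑ n ∈ Ioc n₀ (n₀ + Q), F n m‖ ^ 2
        = ‖((∑ m ∈ R, ‖∑ n ∈ Ioc n₀ (n₀ + Q), F n m‖ ^ 2 : ℝ) : ℂ)‖ := by
      rw [Complex.norm_real, Real.norm_of_nonneg (by positivity)]
    rw [h2, h1]
    calc _ ≤ ∑ n ∈ Ioc n₀ (n₀ + Q), ∑ n' ∈ Ioc n₀ (n₀ + Q),
          ((if n = n' then (R.card : ℝ) else 0) + E) :=
          (norm_sum_le _ _).trans <| sum_le_sum fun n hn ↦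
            (norm_sum_le _ _).trans <| sum_le_sum fun n' hn' ↦ hall n hn n' hn'
      _ = _ := by
          simp only [sum_add_distrib, sum_ite_eq, sum_const, Nat.card_Ioc, nsmul_eq_mul]
          rw [sum_congr rfl (fun n hn ↦ if_pos hn), sum_const, Nat.card_Ioc, nsmul_eq_mul,
            Nat.add_sub_cancel_left]
          ring
  rw [hT]
  have hle : ‖∑ m ∈ R, v m * ∑ n ∈ Ioc n₀ (n₀ + Q), F n m‖
      ≤ ∑ m ∈ R, ‖∑ n ∈ Ioc n₀ (n₀ + Q), F n m‖ := by
    refine (norm_sum_le _ _).trans (sum_le_sum fun m _ ↦ ?_)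
    rw [norm_mul]
    exact mul_le_of_le_one_left (norm_nonneg _) (hv m)
  calc _ ≤ (∑ m ∈ R, ‖∑ n ∈ Ioc n₀ (n₀ + Q), F n m‖) ^ 2 := by gcongr
    _ ≤ R.card * ∑ m ∈ R, ‖∑ n ∈ Ioc n₀ (n₀ + Q), F n m‖ ^ 2 := sq_sum_le_card_mul_sum_sq
    _ ≤ R.card * (Q * R.card + Q ^ 2 * E) := by gcongr
    _ ≤ _ := by gcongr

/-- Numerical condition ensuring square root cancellation over blocks of length `Q`, for the
long variable at least `M₀`. -/
def BlockCondition (g G : ℝ) (Q : ℕ) (M₀ : ℝ) : Prop :=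
  Q * (5 * ((4 * √Q * G + 2) * √(2 / (g * M₀)) + (4 * Q * G + 2) / M₀)) ≤ 1

lemma Phase.norm_bilinear_block_le (h : Phase φ φ₁ φ₂ κ A B l L g G) (hX : 0 < X) (hA : X ≤ A)
    (hB : B ≤ 2 * X) {n₀ Q : ℕ} (hn₀ : 0 < n₀) (hQ : Q ≤ n₀) {u v : ℕ → ℂ} (hu : ∀ n, ‖u n‖ ≤ 1)
    (hv : ∀ n, ‖v n‖ ≤ 1) {M₀ : ℝ} (hM₀ : 0 < M₀) (hM : M₀ * n₀ ≤ X)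
    (hc : BlockCondition g G Q M₀) :
    ‖∑ n ∈ Ioc n₀ (n₀ + Q), ∑ m ∈ Ioc (A / n) (B / n), u n * v m * e (φ (n * m))‖ ≤
      3 * X * √Q / n₀ := by
  have hn0R : (0 : ℝ) < n₀ := by exact_mod_cast hn₀
  have hG : 0 < G := h.pos₃.trans_le h.le₃
  have hg := h.pos₃
  set M : ℝ := X / n₀ with hM'
  have hMM : M₀ ≤ M := by rw [hM', le_div_iff₀ hn0R]; exact hM
  have hMp : 0 < M := hM₀.trans_le hMM
  have main := h.norm_bilinear_block_sq_le hX hA hB hn₀ hQ hu hv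
  have h1 : (Q : ℝ) * (5 * ((4 * √Q * G + 2) * √(2 * M / g) + (4 * Q * G + 2))) ≤ M := by
    have h2 : √(2 * M / g) = M * √(2 / (g * M)) := by
      rw [← Real.sqrt_sq hMp.le, ← Real.sqrt_mul (by positivity), Real.sqrt_sq hMp.le]
      congr 1
      field_simp
    have h3 : (4 * Q * G + 2) = M * ((4 * Q * G + 2) / M) := by field_simp
    calc _ = M * (Q * (5 * ((4 * √Q * G + 2) * √(2 / (g * M)) + (4 * Q * G + 2) / M))) := by
          rw [h2]
          linear_combination (Q * 5 : ℝ) * h3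
      _ ≤ M * (Q * (5 * ((4 * √Q * G + 2) * √(2 / (g * M₀)) + (4 * Q * G + 2) / M₀))) := by
          gcongr
      _ ≤ M * 1 := by gcongr; exact hc
      _ = M := mul_one M
  refine le_of_sq_le_sq ?_ (by positivity)
  calc _ ≤ _ := main
    _ = 2 * M * (2 * Q * M + Q *
        (Q * (5 * ((4 * √Q * G + 2) * √(2 * M / g) + (4 * Q * G + 2))))) := by ring
    _ ≤ 2 * M * (2 * Q * M + Q * M) := by gcongr
    _ ≤ 9 * M ^ 2 * Q := by nlinarith [mul_nonneg (sq_nonneg M) (Nat.cast_nonneg (α := ℝ) Q)]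
    _ = (3 * X * √Q / n₀) ^ 2 := by
        rw [hM', show 3 * X * √Q / n₀ = 3 * (X / n₀) * √Q by ring, mul_pow,
          Real.sq_sqrt (Nat.cast_nonneg Q)]
        ring

end

section

variable {φ φ₁ φ₂ κ : ℝ → ℝ} {A B : ℕ} {X l L g G : ℝ}

lemma sum_Ioc_blocks {E : Type*} [AddCommMonoid E] (f : ℕ → E) (U Q K : ℕ) :
    ∑ n ∈ Ioc U (U + Q * K), f n = ∑ i ∈ range K, ∑ n ∈ Ioc (U + Q * i) (U + Q * i + Q), f n := by
  induction K with
  | zero => simp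
  | succ K ih =>
    rw [sum_range_succ, ← ih, show U + Q * (K + 1) = U + Q * K + Q by ring,
      sum_Ioc_consecutive f (by omega) (by omega)]

/-- Bilinear sums in which the variable that is split into blocks is at most `X / M₀`. -/
lemma Phase.norm_bilinear_le (h : Phase φ φ₁ φ₂ κ A B l L g G) (hX : 0 < X) (hA : X ≤ A)
    (hB : B ≤ 2 * X) {U R Q : ℕ} (hQ : 0 < Q) (hQU : Q ≤ U) {u v : ℕ → ℂ} (hu : ∀ n, ‖u n‖ ≤ 1)
    (hv : ∀ n, ‖v n‖ ≤ 1) {M₀ : ℝ} (hM₀ : 0 < M₀) (hR : 0 < R) (hM : M₀ * R ≤ X)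
    (hc : BlockCondition g G Q M₀) :
    ‖∑ n ∈ Ioc U R, ∑ m ∈ Ioc (A / n) (B / n), u n * v m * e (φ (n * m))‖ ≤
      3 * X / √Q * (1 + Real.log R) := by
  have hQR : (0 : ℝ) < Q := by exact_mod_cast hQ
  have hlogR : 0 ≤ Real.log R := Real.log_nonneg (by exact_mod_cast hR)
  rcases le_or_gt R U with hRU | hRU
  · rw [Ioc_eq_empty_of_le hRU, sum_empty, norm_zero]
    positivity
  set K := (R - U) / Q + 1 with hK
  have hKR : K ≤ R := by
    have := Nat.div_le_self (R - U) Q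
    omega
  have hRK : R ≤ U + Q * K := by
    have := Nat.lt_mul_div_succ (R - U) hQ
    rw [← hK] at this
    omega
  set u' : ℕ → ℂ := fun n ↦ if n ≤ R then u n else 0 with hu'
  have hu'1 : ∀ n, ‖u' n‖ ≤ 1 := by
    intro n
    simp only [hu']
    split_ifs
    · exact hu n
    · simp
  have hsum : ∑ n ∈ Ioc U R, ∑ m ∈ Ioc (A / n) (B / n), u n * v m * e (φ (n * m))
      = ∑ n ∈ Ioc U (U + Q * K), ∑ m ∈ Ioc (A / n) (B / n), u' n * v m * e (φ (n * m)) := by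
    rw [← sum_subset (Ioc_subset_Ioc_right hRK)]
    · refine sum_congr rfl fun n hn ↦ ?_
      simp only [hu', if_pos (mem_Ioc.1 hn).2]
    · intro n hn hn'
      have : ¬ n ≤ R := fun h' ↦ hn' (mem_Ioc.2 ⟨(mem_Ioc.1 hn).1, h'⟩)
      simp only [hu', if_neg this, zero_mul, sum_const_zero]
  rw [hsum, sum_Ioc_blocks]
  have hblock : ∀ i ∈ range K, ‖∑ n ∈ Ioc (U + Q * i) (U + Q * i + Q),
      ∑ m ∈ Ioc (A / n) (B / n), u' n * v m * e (φ (n * m))‖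
      ≤ 3 * X / √Q * ((i : ℝ) + 1)⁻¹ := by
    intro i hi
    have hiK : Q * i ≤ R - U := by
      have h1 : i ≤ (R - U) / Q := by have := mem_range.1 hi; omega
      rw [mul_comm]
      exact (Nat.le_div_iff_mul_le hQ).1 h1
    have hle : U + Q * i ≤ R := by omega
    have hleR : ((U + Q * i : ℕ) : ℝ) ≤ R := by exact_mod_cast hle
    refine (h.norm_bilinear_block_le hX hA hB (by omega) (by omega) hu'1 hv hM₀
      ((by gcongr : M₀ * ((U + Q * i : ℕ) : ℝ) ≤ M₀ * R).trans hM) hc).trans ?_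
    have h1 : (Q : ℝ) * (i + 1) ≤ ((U + Q * i : ℕ) : ℝ) := by
      have : Q * (i + 1) ≤ U + Q * i := by rw [mul_add]; omega
      exact_mod_cast this
    calc 3 * X * √Q / ((U + Q * i : ℕ) : ℝ) ≤ 3 * X * √Q / (Q * (i + 1)) := by gcongr
      _ = 3 * X / √Q * ((i : ℝ) + 1)⁻¹ := by
        have : (Q : ℝ) = √Q * √Q := (Real.mul_self_sqrt hQR.le).symm
        rw [div_eq_mul_inv, mul_inv]
        nth_rewrite 2 [this]
        have := Real.sqrt_pos.2 hQR
        field_simp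
  refine (norm_sum_le _ _).trans ((sum_le_sum hblock).trans ?_)
  rw [← mul_sum]
  have hH : ∑ i ∈ range K, ((i : ℝ) + 1)⁻¹ ≤ 1 + Real.log K := by
    have := harmonic_le_one_add_log K
    simpa [harmonic] using this
  have hlog : Real.log K ≤ Real.log R :=
    Real.log_le_log (by rw [hK]; positivity) (by exact_mod_cast hKR)
  gcongr
  linarith

/-- Partial summation with nonnegative monotone weights. -/
lemma norm_sum_Ioc_mul_le_of_monotone {b : ℕ} {z : ℕ → ℂ} {S : ℝ} :
    ∀ (k : ℕ) {a : ℕ} {w : ℕ → ℝ}, b - a = k → (∀ n, a < n → n ≤ b → 0 ≤ w n) →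
      (∀ m n, a < m → m ≤ n → n ≤ b → w m ≤ w n) → a < b →
      (∀ j, a ≤ j → ‖∑ n ∈ Ioc j b, z n‖ ≤ S) →
      ‖∑ n ∈ Ioc a b, (w n : ℂ) * z n‖ ≤ w b * S
  | 0, a, w, hk, _, _, hab, _ => by omega
  | k + 1, a, w, hk, hw, hmono, hab, hS => by
    have hw1 := hw (a + 1) (by omega) (by omega)
    have hsplit : ∑ n ∈ Ioc a b, (w n : ℂ) * z n = (w (a + 1) : ℂ) * ∑ n ∈ Ioc a b, z n
        + ∑ n ∈ Ioc (a + 1) b, ((w n - w (a + 1) : ℝ) : ℂ) * z n := by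
      rw [mul_sum, ← sum_Ioc_consecutive _ (Nat.le_succ a) (by omega : a + 1 ≤ b),
        ← sum_Ioc_consecutive _ (Nat.le_succ a) (by omega : a + 1 ≤ b), add_assoc,
        ← sum_add_distrib]
      have : Ioc a (a + 1) = {a + 1} := by ext; simp
      rw [Nat.succ_eq_add_one, this, sum_singleton, sum_singleton]
      congr 1
      refine sum_congr rfl fun n _ ↦ ?_
      push_cast
      ring
    have h1 : ‖(w (a + 1) : ℂ) * ∑ n ∈ Ioc a b, z n‖ ≤ w (a + 1) * S := by
      rw [norm_mul, Complex.norm_real, Real.norm_of_nonneg hw1]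
      gcongr
      exact hS a le_rfl
    have h2 : ‖∑ n ∈ Ioc (a + 1) b, ((w n - w (a + 1) : ℝ) : ℂ) * z n‖
        ≤ (w b - w (a + 1)) * S := by
      rcases (by omega : a + 1 < b ∨ a + 1 = b) with hlt | heq
      · exact norm_sum_Ioc_mul_le_of_monotone k (w := fun n ↦ w n - w (a + 1)) (by omega)
          (fun n h1 h2 ↦ sub_nonneg.2 (hmono _ _ (by omega) (by omega) h2))
          (fun m n h1 h2 h3 ↦ sub_le_sub_right (hmono _ _ (by omega) h2 h3) _) hlt
          (fun j hj ↦ hS j (by omega))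
      · rw [heq]; simp
    rw [hsplit]
    refine (norm_add_le _ _).trans ?_
    linarith

/-- Bilinear sums with one short variable and a smooth weight on the other one. -/
lemma Phase.norm_sum_smooth_le (h : Phase φ φ₁ φ₂ κ A B l L g G) (hX : 0 < X)
    (hB : B ≤ 2 * X) {K : ℕ} {c : ℕ → ℂ} (hc : ∀ k ∈ Ioc 0 K, ‖c k‖ ≤ 1) {w : ℕ → ℝ} {W : ℝ}
    (hw0 : ∀ n, 0 ≤ w n) (hw : Monotone w) (hW : w B ≤ W) :
    ‖∑ k ∈ Ioc 0 K, ∑ m ∈ Ioc (A / k) (B / k), c k * w m * e (φ (k * m))‖ ≤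
      5 * W * K * (2 * X * L / √l + 2 * X * K * L + 2 / √l + 2) := by
  have hl := h.pos₂
  have hL : 0 < L := by linarith [h.le₂]
  have hsl := Real.sqrt_pos.2 hl
  have hW0 : 0 ≤ W := (hw0 B).trans hW
  set S := 5 * (2 * X * L / √l + 2 * X * K * L + 2 / √l + 2) with hS
  have hS0 : 0 ≤ S := by positivity
  have key : ∀ k ∈ Ioc 0 K, ‖∑ m ∈ Ioc (A / k) (B / k), c k * w m * e (φ (k * m))‖ ≤ W * S := by
    intro k hk
    have hck := hc k hk
    rw [mem_Ioc] at hk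
    have hkR : (1 : ℝ) ≤ k := by exact_mod_cast hk.1
    have hkK : (k : ℝ) ≤ K := by exact_mod_cast hk.2
    rcases le_or_gt (B / k) (A / k) with hab | hab
    · rw [Ioc_eq_empty_of_le hab, sum_empty, norm_zero]
      positivity
    have hin : ∀ j, A / k ≤ j → ‖∑ m ∈ Ioc j (B / k), e (φ (k * m))‖ ≤ S := by
      intro j hj
      have hb : (k : ℝ) * ((B / k : ℕ) : ℝ) ≤ B := by exact_mod_cast Nat.mul_div_le B k
      refine (h.norm_sum_mul_le hk.1 ?_ hb).trans ?_
      · have : A < k * (j + 1) := by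
          rw [mul_comm]; exact (Nat.div_lt_iff_lt_mul hk.1).1 (by omega)
        exact_mod_cast this.le
      · have hlen : ((B / k - j : ℕ) : ℝ) ≤ 2 * X / k := by
          have h1 : ((B / k - j : ℕ) : ℝ) ≤ ((B / k : ℕ) : ℝ) := by exact_mod_cast Nat.sub_le _ _
          have h2 : ((B / k : ℕ) : ℝ) ≤ B / k := Nat.cast_div_le
          exact h1.trans (h2.trans (by gcongr))
        calc 5 * (((B / k - j : ℕ) : ℝ) * (k ^ 2 * L) + 2) * (1 / (k * √l) + 1)
            ≤ 5 * (2 * X / k * (k ^ 2 * L) + 2) * (1 / (k * √l) + 1) := by gcongr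
          _ = 5 * (2 * X * L / √l + 2 * X * k * L + 2 / √l / k + 2) := by field_simp; ring
          _ ≤ S := by
            have : 2 / √l / k ≤ 2 / √l := div_le_self (by positivity) hkR
            rw [hS]
            gcongr
    have habel := norm_sum_Ioc_mul_le_of_monotone (z := fun m : ℕ ↦ e (φ (k * m))) (w := w) _ rfl
      (fun n _ _ ↦ hw0 n) (fun m n _ h2 _ ↦ hw h2) hab hin
    simp only [mul_assoc] at habel ⊢
    rw [← mul_sum, norm_mul]
    calc _ ≤ 1 * (w (B / k) * S) := by gcongr
      _ ≤ W * S := by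
        rw [one_mul]
        gcongr
        exact (hw (Nat.div_le_self B k)).trans hW
  refine (norm_sum_le _ _).trans ((sum_le_sum key).trans (le_of_eq ?_))
  rw [sum_const, Nat.card_Ioc, nsmul_eq_mul, hS, Nat.sub_zero]
  ring

end

section

open ArithmeticFunction
open scoped ArithmeticFunction.Moebius ArithmeticFunction.zeta

/-- Restriction of an arithmetic function to `n ≤ U`. -/
noncomputable def trunc (f : ArithmeticFunction ℝ) (U : ℕ) : ArithmeticFunction ℝ :=
  ⟨fun n ↦ if n ≤ U then f n else 0, by simp⟩

lemma trunc_of_le {f : ArithmeticFunction ℝ} {U n : ℕ} (h : n ≤ U) : trunc f U n = f n :=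
  if_pos h

lemma trunc_of_lt {f : ArithmeticFunction ℝ} {U n : ℕ} (h : U < n) : trunc f U n = 0 :=
  if_neg (by omega)

lemma sum_Ioc_mul_mul_eq (f g : ArithmeticFunction ℝ) (z : ℕ → ℂ) (A B : ℕ) :
    ∑ n ∈ Ioc A B, ((f * g) n : ℂ) * z n =
      ∑ k ∈ Ioc 0 B, ∑ m ∈ Ioc (A / k) (B / k), (f k : ℂ) * (g m : ℂ) * z (k * m) := by
  have h1 : ∀ n ∈ Ioc A B, ((f * g) n : ℂ) * z n = ∑ x ∈ Ioc 0 B ×ˢ Ioc 0 B,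
      if x.1 * x.2 = n then (f x.1 : ℂ) * (g x.2 : ℂ) * z (x.1 * x.2) else 0 := by
    intro n hn
    rw [mem_Ioc] at hn
    rw [ArithmeticFunction.mul_apply, Nat.divisorsAntidiagonal_eq_prod_filter_of_le (by omega) hn.2,
      ← sum_filter]
    push_cast
    rw [sum_mul]
    exact sum_congr rfl fun x hx ↦ by rw [(mem_filter.1 hx).2]
  rw [sum_congr rfl h1, sum_comm, sum_product]
  refine sum_congr rfl fun k hk ↦ ?_
  have hk0 := (mem_Ioc.1 hk).1
  have hsub : Ioc (A / k) (B / k) ⊆ Ioc 0 B := fun m hm ↦ by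
    rw [mem_Ioc] at hm ⊢
    exact ⟨Nat.zero_lt_of_lt hm.1, hm.2.trans (Nat.div_le_self _ _)⟩
  have hiff : ∀ m, m ∈ Ioc (A / k) (B / k) ↔ k * m ∈ Ioc A B := fun m ↦ by
    rw [mem_Ioc, mem_Ioc, Nat.div_lt_iff_lt_mul hk0, Nat.le_div_iff_mul_le hk0, mul_comm]
  symm
  rw [← sum_subset hsub]
  · refine sum_congr rfl fun m hm ↦ ?_
    rw [sum_ite_eq, if_pos ((hiff m).1 hm)]
  · intro m _ hm
    rw [sum_ite_eq, if_neg (fun h ↦ hm ((hiff m).2 h))]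

/-- Vaughan's identity. -/
lemma vonMangoldt_eq_vaughan (U : ℕ) :
    Λ = trunc Λ U + (trunc (μ : ArithmeticFunction ℝ) U * log
      - trunc Λ U * trunc (μ : ArithmeticFunction ℝ) U * (ζ : ArithmeticFunction ℝ)
      + (Λ - trunc Λ U) * ((ζ : ArithmeticFunction ℝ) * ((μ : ArithmeticFunction ℝ)
        - trunc (μ : ArithmeticFunction ℝ) U))) := by
  have h1 : (ζ : ArithmeticFunction ℝ) * (μ : ArithmeticFunction ℝ) = 1 :=
    coe_zeta_mul_coe_moebius
  have h2 : Λ * (ζ : ArithmeticFunction ℝ) = log := vonMangoldt_mul_zeta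
  linear_combination (trunc Λ U - Λ) * h1 + trunc (μ : ArithmeticFunction ℝ) U * h2

lemma abs_moebius_real_le_one (n : ℕ) : |(μ : ArithmeticFunction ℝ) n| ≤ 1 := by
  rw [intCoe_apply, ← Int.cast_abs]
  exact_mod_cast abs_moebius_le_one

lemma abs_trunc_le (f : ArithmeticFunction ℝ) (U n : ℕ) : |trunc f U n| ≤ |f n| := by
  rcases le_or_gt n U with h | h
  · rw [trunc_of_le h]
  · rw [trunc_of_lt h, abs_zero]; exact abs_nonneg _

lemma abs_sub_trunc_le (f : ArithmeticFunction ℝ) (U n : ℕ) : |(f - trunc f U) n| ≤ |f n| := by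
  have : (f - trunc f U) n = f n - trunc f U n := by
    rw [sub_eq_add_neg, sub_eq_add_neg]; rfl
  rw [this]
  rcases le_or_gt n U with h | h
  · rw [trunc_of_le h, sub_self, abs_zero]; exact abs_nonneg _
  · rw [trunc_of_lt h, sub_zero]

lemma sub_trunc_of_le {f : ArithmeticFunction ℝ} {U n : ℕ} (h : n ≤ U) :
    (f - trunc f U) n = 0 := by
  have : (f - trunc f U) n = f n - trunc f U n := by
    rw [sub_eq_add_neg, sub_eq_add_neg]; rfl
  rw [this, trunc_of_le h, sub_self]

lemma abs_trunc_mul_trunc_le (U n : ℕ) :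
    |(trunc Λ U * trunc (μ : ArithmeticFunction ℝ) U) n| ≤ Real.log n := by
  rw [ArithmeticFunction.mul_apply, ← vonMangoldt_sum,
    ← Nat.sum_divisorsAntidiagonal (fun i _ ↦ Λ i)]
  refine (abs_sum_le_sum_abs _ _).trans (sum_le_sum fun x _ ↦ ?_)
  rw [abs_mul]
  have h1 := (abs_trunc_le Λ U x.1).trans_eq (abs_of_nonneg vonMangoldt_nonneg)
  have h2 := (abs_trunc_le (μ : ArithmeticFunction ℝ) U x.2).trans (abs_moebius_real_le_one _)
  calc _ ≤ Λ x.1 * 1 := mul_le_mul h1 h2 (abs_nonneg _) vonMangoldt_nonneg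
    _ = _ := mul_one _

lemma trunc_mul_trunc_of_lt {U n : ℕ} (h : U ^ 2 < n) :
    (trunc Λ U * trunc (μ : ArithmeticFunction ℝ) U) n = 0 := by
  rw [ArithmeticFunction.mul_apply]
  refine sum_eq_zero fun x hx ↦ ?_
  have hx := (Nat.mem_divisorsAntidiagonal.1 hx).1
  rcases le_or_gt x.1 U with h1 | h1
  · rcases le_or_gt x.2 U with h2 | h2
    · have := Nat.mul_le_mul h1 h2
      nlinarith
    · rw [trunc_of_lt h2, mul_zero]
  · rw [trunc_of_lt h1, zero_mul]

lemma abs_zeta_mul_sub_trunc_le (U n : ℕ) :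
    |((ζ : ArithmeticFunction ℝ) * ((μ : ArithmeticFunction ℝ)
        - trunc (μ : ArithmeticFunction ℝ) U)) n| ≤ n.divisors.card := by
  rw [coe_zeta_mul_apply]
  refine (abs_sum_le_sum_abs _ _).trans ?_
  rw [card_eq_sum_ones]
  push_cast
  exact sum_le_sum fun x _ ↦ (abs_sub_trunc_le _ _ _).trans (abs_moebius_real_le_one _)

lemma zeta_mul_sub_trunc_of_le {U n : ℕ} (h : n ≤ U) :
    ((ζ : ArithmeticFunction ℝ) * ((μ : ArithmeticFunction ℝ)
        - trunc (μ : ArithmeticFunction ℝ) U)) n = 0 := by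
  rw [coe_zeta_mul_apply]
  exact sum_eq_zero fun x hx ↦ sub_trunc_of_le ((Nat.divisor_le hx).trans h)

variable {φ φ₁ φ₂ κ : ℝ → ℝ} {A B : ℕ} {X l L g G : ℝ}

lemma Phase.norm_bilinear_le' (h : Phase φ φ₁ φ₂ κ A B l L g G) (hX : 0 < X) (hA : X ≤ A)
    (hB : B ≤ 2 * X) {U R Q : ℕ} (hQ : 0 < Q) (hQU : Q ≤ U) (hRB : R ≤ B) {u v : ℕ → ℝ} {a b : ℝ}
    (ha : 0 < a) (hb : 0 < b) (hu : ∀ n ≤ B, |u n| ≤ a)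
    (hv : ∀ n ≤ B, |v n| ≤ b) {M₀ : ℝ} (hM₀ : 0 < M₀) (hR : 0 < R) (hM : M₀ * R ≤ X)
    (hc : BlockCondition g G Q M₀) :
    ‖∑ n ∈ Ioc U R, ∑ m ∈ Ioc (A / n) (B / n), (u n : ℂ) * v m * e (φ (n * m))‖ ≤
      a * b * (3 * X / √Q * (1 + Real.log R)) := by
  have key : ∀ (w : ℕ → ℝ) (c : ℝ), 0 < c → (∀ n ≤ B, |w n| ≤ c) →
      ∀ n, ‖(if n ≤ B then ((w n / c : ℝ) : ℂ) else 0)‖ ≤ 1 := by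
    intro w c hc hw n
    split_ifs with hn
    · rw [Complex.norm_real, Real.norm_eq_abs, abs_div, abs_of_pos hc]
      exact (div_le_one hc).2 (hw n hn)
    · simp
  have main := h.norm_bilinear_le hX hA hB hQ hQU (key u a ha hu) (key v b hb hv) hM₀ hR hM hc
  have heq : ∑ n ∈ Ioc U R, ∑ m ∈ Ioc (A / n) (B / n), (u n : ℂ) * v m * e (φ (n * m))
      = (a * b : ℝ) * ∑ n ∈ Ioc U R, ∑ m ∈ Ioc (A / n) (B / n),
        (if n ≤ B then ((u n / a : ℝ) : ℂ) else 0) * (if m ≤ B then ((v m / b : ℝ) : ℂ) else 0)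
          * e (φ (n * m)) := by
    rw [mul_sum]
    refine sum_congr rfl fun n hn ↦ ?_
    rw [mul_sum]
    refine sum_congr rfl fun m hm ↦ ?_
    rw [if_pos ((mem_Ioc.1 hn).2.trans hRB),
      if_pos ((mem_Ioc.1 hm).2.trans (Nat.div_le_self _ _))]
    have : (a : ℂ) ≠ 0 := by exact_mod_cast ha.ne'
    have : (b : ℂ) ≠ 0 := by exact_mod_cast hb.ne'
    push_cast
    field_simp
  rw [heq, norm_mul, Complex.norm_real, Real.norm_of_nonneg (by positivity)]
  gcongr

/-- A smooth exponential sum over `Λ`. -/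
lemma Phase.norm_sum_vonMangoldt_le (h : Phase φ φ₁ φ₂ κ A B l L g G) (hX : 1 ≤ X) (hA : X ≤ A)
    (hB : B ≤ 2 * X) {U Q : ℕ} (hQ : 0 < Q) (hQU : Q ≤ U) (hUX : U ≤ X) {T : ℝ} (hT : 0 < T)
    (hdiv : ∀ n ≤ B, (n.divisors.card : ℝ) ≤ T)
    (hc : BlockCondition g G Q √(X / 2)) :
    ‖∑ n ∈ Ioc A B, (Λ n : ℂ) * e (φ n)‖ ≤
      10 * Real.log (2 * X) * U ^ 2 * (2 * X * L / √l + 2 * X * U ^ 2 * L + 2 / √l + 2)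
        + 6 * Real.log (2 * X) * T * (X / √Q) * (1 + Real.log (2 * X)) := by
  have hX0 : 0 < X := by linarith
  have hU1 : 1 ≤ U := by omega
  have hl := h.pos₂
  have hL : 0 < L := by linarith [h.le₂]
  have hsl := Real.sqrt_pos.2 hl
  set W := Real.log (2 * X) with hW
  have hW0 : 0 < W := Real.log_pos (by linarith)
  set z : ℕ → ℂ := fun n ↦ e (φ n) with hz
  rcases le_or_gt B A with hAB | hAB
  · rw [Ioc_eq_empty_of_le hAB, sum_empty, norm_zero]
    positivity
  have hB0 : 0 < B := by omega
  have hlogB : ∀ n ≤ B, Real.log n ≤ W := by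
    intro n hn
    rcases Nat.eq_zero_or_pos n with rfl | hn0
    · simpa using hW0.le
    · refine Real.log_le_log (by exact_mod_cast hn0) (le_trans ?_ hB)
      exact_mod_cast hn
  have hUA : U ≤ A := by exact_mod_cast hUX.trans hA
  set mU := trunc (μ : ArithmeticFunction ℝ) U with hmU
  set LU := trunc Λ U with hLU
  set F := Λ - LU with hF
  set H := (ζ : ArithmeticFunction ℝ) * ((μ : ArithmeticFunction ℝ) - mU) with hH
  have hFle : ∀ n ≤ B, |F n| ≤ W := fun n hn ↦
    ((abs_sub_trunc_le _ _ _).trans_eq (abs_of_nonneg vonMangoldt_nonneg)).trans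
      (vonMangoldt_le_log.trans (hlogB n hn))
  have hHle : ∀ n ≤ B, |H n| ≤ T := fun n hn ↦ (abs_zeta_mul_sub_trunc_le _ _).trans (hdiv n hn)
  set R := Nat.sqrt B with hR
  have hR0 : 0 < R := Nat.sqrt_pos.2 hB0
  have hRB : R ≤ B := Nat.sqrt_le_self B
  have hRX : √(X / 2) * R ≤ X := by
    have h1 : (R : ℝ) ≤ √(2 * X) := by
      refine Real.le_sqrt_of_sq_le (le_trans ?_ hB)
      exact_mod_cast Nat.sqrt_le' B
    calc √(X / 2) * R ≤ √(X / 2) * √(2 * X) := by gcongr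
      _ = √(X ^ 2) := by
        rw [← Real.sqrt_mul (by positivity)]
        congr 1
        ring
      _ = X := Real.sqrt_sq hX0.le
  have hM₀ : 0 < √(X / 2) := Real.sqrt_pos.2 (by positivity)
  have hlogR : 1 + Real.log R ≤ 1 + W := by linarith [hlogB R hRB]
  set D := W * T * (3 * X / √Q * (1 + W)) with hD
  -- the smooth sums
  have hI₁ : ‖∑ n ∈ Ioc A B, ((mU * log) n : ℂ) * z n‖ ≤
      5 * W * U ^ 2 * (2 * X * L / √l + 2 * X * U ^ 2 * L + 2 / √l + 2) := by
    have hUU : (U : ℝ) ≤ (U : ℝ) ^ 2 := by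
      have : (1 : ℝ) ≤ U := by exact_mod_cast hU1
      nlinarith
    have hmono : Monotone fun n : ℕ ↦ Real.log n := by
      intro m n hmn
      rcases Nat.eq_zero_or_pos m with rfl | hm0
      · simpa using Real.log_natCast_nonneg n
      · exact Real.log_le_log (by exact_mod_cast hm0) (by exact_mod_cast hmn)
    have := h.norm_sum_smooth_le hX0 hB (K := U) (c := fun k ↦ (mU k : ℂ)) (fun k _ ↦ by
      rw [Complex.norm_real]
      exact (abs_trunc_le _ _ _).trans (abs_moebius_real_le_one _))
      (fun n ↦ Real.log_natCast_nonneg n) hmono (hlogB B le_rfl)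
    rw [sum_Ioc_mul_mul_eq, ← sum_subset (Ioc_subset_Ioc_right (hUA.trans hAB.le))]
    · simp only [log_apply, hz, Nat.cast_mul]
      refine this.trans ?_
      gcongr
    · intro k hk hk'
      have : U < k := by rw [mem_Ioc] at hk hk'; omega
      simp only [hmU, trunc_of_lt this, Complex.ofReal_zero, zero_mul, sum_const_zero]
  have hI₂ : ‖∑ n ∈ Ioc A B, ((LU * mU * (ζ : ArithmeticFunction ℝ)) n : ℂ) * z n‖ ≤
      5 * W * U ^ 2 * (2 * X * L / √l + 2 * X * U ^ 2 * L + 2 / √l + 2) := by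
    have := h.norm_sum_smooth_le hX0 hB (K := U ^ 2)
      (c := fun k ↦ if k ≤ B then (((LU * mU) k / W : ℝ) : ℂ) else 0) (fun k _ ↦ by
        split_ifs with hk
        · rw [Complex.norm_real, Real.norm_eq_abs, abs_div, abs_of_pos hW0]
          exact (div_le_one hW0).2 ((abs_trunc_mul_trunc_le U k).trans (hlogB k hk))
        · simp) (w := fun _ ↦ W) (fun n ↦ hW0.le) monotone_const (le_refl W)
    rw [sum_Ioc_mul_mul_eq]
    push_cast at this
    refine le_of_eq_of_le ?_ this
    congr 1
    have h1 : ∀ k ∈ Ioc 0 B, ∑ m ∈ Ioc (A / k) (B / k), ((LU * mU) k : ℂ)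
        * (((ζ : ArithmeticFunction ℝ) m : ℝ) : ℂ) * z (k * m) =
        ∑ m ∈ Ioc (A / k) (B / k), (if k ≤ B then (((LU * mU) k : ℂ) / W) else 0) * (W : ℂ)
          * e (φ (k * m)) := by
      intro k hk
      refine sum_congr rfl fun m hm ↦ ?_
      have hm0 : m ≠ 0 := (Nat.zero_lt_of_lt (mem_Ioc.1 hm).1).ne'
      have hW' : (W : ℂ) ≠ 0 := by exact_mod_cast hW0.ne'
      rw [if_pos (mem_Ioc.1 hk).2, natCoe_apply, zeta_apply_ne hm0, div_mul_cancel₀ _ hW']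
      simp [hz]
    rw [sum_congr rfl h1]
    rcases le_total B (U ^ 2) with hBU | hBU
    · refine sum_subset (Ioc_subset_Ioc_right hBU) fun k hk hk' ↦ ?_
      have : ¬ k ≤ B := by rw [mem_Ioc] at hk hk'; omega
      simp only [if_neg this, zero_mul, sum_const_zero]
    · refine (sum_subset (Ioc_subset_Ioc_right hBU) fun k hk hk' ↦ ?_).symm
      have : U ^ 2 < k := by rw [mem_Ioc] at hk hk'; omega
      simp only [hLU, hmU, trunc_mul_trunc_of_lt this, Complex.ofReal_zero, zero_div, ite_self,
        zero_mul, sum_const_zero]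
  -- the bilinear sums
  have hII₁ : ‖∑ n ∈ Ioc A B, ((trunc F R * H) n : ℂ) * z n‖ ≤ D := by
    have := h.norm_bilinear_le' hX0 hA hB hQ hQU hRB (u := trunc F R) hW0 hT
      (fun n hn ↦ (abs_trunc_le _ _ _).trans (hFle n hn)) hHle hM₀ hR0 hRX hc
    rw [sum_Ioc_mul_mul_eq, ← sum_subset (s₁ := Ioc U R)]
    · simp only [hz, Nat.cast_mul]
      refine this.trans ?_
      rw [hD]
      gcongr
    · intro k hk
      rw [mem_Ioc] at hk ⊢
      omega
    · intro k hk hk'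
      refine sum_eq_zero fun m _ ↦ ?_
      suffices trunc F R k = 0 by rw [this, Complex.ofReal_zero, zero_mul, zero_mul]
      rcases le_or_gt k R with h1 | h1
      · rw [trunc_of_le h1]
        exact sub_trunc_of_le (by rw [mem_Ioc] at hk hk'; omega)
      · exact trunc_of_lt h1
  have hII₂ : ‖∑ n ∈ Ioc A B, ((H * (F - trunc F R)) n : ℂ) * z n‖ ≤ D := by
    have := h.norm_bilinear_le' hX0 hA hB hQ hQU hRB (v := F - trunc F R) hT hW0 hHle
      (fun n hn ↦ (abs_sub_trunc_le _ _ _).trans (hFle n hn)) hM₀ hR0 hRX hc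
    rw [sum_Ioc_mul_mul_eq, ← sum_subset (s₁ := Ioc U R)]
    · simp only [hz, Nat.cast_mul]
      refine this.trans ?_
      rw [hD, mul_comm W T]
      gcongr
    · intro k hk
      rw [mem_Ioc] at hk ⊢
      omega
    · intro k hk hk'
      refine sum_eq_zero fun m hm ↦ ?_
      rcases le_or_gt k U with h1 | h1
      · rw [hH, hmU, zeta_mul_sub_trunc_of_le h1, Complex.ofReal_zero, zero_mul, zero_mul]
      · have hkR : R < k := by rw [mem_Ioc] at hk hk'; omega
        have hmR : m ≤ R := by
          by_contra hcon
          have h2 : B < (R + 1) ^ 2 := Nat.lt_succ_sqrt' B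
          have h3 : m * k ≤ B :=
            (Nat.le_div_iff_mul_le (mem_Ioc.1 hk).1).1 (mem_Ioc.1 hm).2
          have : (R + 1) * (R + 1) ≤ m * k := Nat.mul_le_mul (by omega) (by omega)
          nlinarith
        rw [sub_trunc_of_le hmR, Complex.ofReal_zero, mul_zero, zero_mul]
  have hsplit : ∑ n ∈ Ioc A B, (Λ n : ℂ) * e (φ n) =
      ∑ n ∈ Ioc A B, ((mU * log) n : ℂ) * z n
      - ∑ n ∈ Ioc A B, ((LU * mU * (ζ : ArithmeticFunction ℝ)) n : ℂ) * z n
      + (∑ n ∈ Ioc A B, ((trunc F R * H) n : ℂ) * z n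
        + ∑ n ∈ Ioc A B, ((H * (F - trunc F R)) n : ℂ) * z n) := by
    rw [← sum_sub_distrib, ← sum_add_distrib, ← sum_add_distrib]
    refine sum_congr rfl fun n hn ↦ ?_
    have hnU : U < n := lt_of_le_of_lt hUA (mem_Ioc.1 hn).1
    have hid : Λ = LU + (mU * log - LU * mU * (ζ : ArithmeticFunction ℝ)
        + (trunc F R * H + H * (F - trunc F R))) := by
      have := vonMangoldt_eq_vaughan U
      rw [← hmU, ← hLU, ← hF, ← hH] at this
      linear_combination this
    have hn' : Λ n = LU n + ((mU * log) n - (LU * mU * (ζ : ArithmeticFunction ℝ)) n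
        + ((trunc F R * H) n + (H * (F - trunc F R)) n)) := by
      conv_lhs => rw [hid]
      rw [sub_eq_add_neg (mU * log), sub_eq_add_neg ((mU * log) n)]
      rfl
    rw [hn', hLU, trunc_of_lt hnU]
    push_cast
    ring
  rw [hsplit]
  refine (norm_add_le _ _).trans ?_
  have h1 := (norm_sub_le _ _).trans (add_le_add hI₁ hI₂)
  have h2 := (norm_add_le _ _).trans (add_le_add hII₁ hII₂)
  refine (add_le_add h1 h2).trans (le_of_eq ?_)
  rw [hD]
  ring

end

/-- The divisor bound. -/
lemma exists_card_divisors_le {ε : ℝ} (hε : 0 < ε) :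
    ∃ C : ℝ, 1 ≤ C ∧ ∀ n : ℕ, 0 < n → (n.divisors.card : ℝ) ≤ C * (n : ℝ) ^ ε := by
  obtain ⟨p₀, hp₀⟩ := exists_nat_ge ((2 : ℝ) ^ (1 / ε))
  have hlog := Real.log_pos (by norm_num : (1 : ℝ) < 2)
  set C₁ : ℝ := max 1 (1 / (ε * Real.log 2)) with hC₁
  have hC1 : 1 ≤ C₁ := le_max_left _ _
  have hC2 : 1 ≤ C₁ * (ε * Real.log 2) := by
    have : 1 / (ε * Real.log 2) ≤ C₁ := le_max_right _ _
    rwa [div_le_iff₀ (by positivity)] at this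
  have hlocal : ∀ p : ℕ, p.Prime → ∀ a : ℕ,
      ((a : ℝ) + 1) ≤ (if p < p₀ then C₁ else 1) * ((p : ℝ) ^ a) ^ ε := by
    intro p hp a
    have hp2 : (2 : ℝ) ≤ p := by exact_mod_cast hp.two_le
    rw [← Real.rpow_natCast, ← Real.rpow_mul (by positivity), mul_comm (a : ℝ) ε,
      Real.rpow_mul (by positivity), Real.rpow_natCast]
    split_ifs with h
    · have h1 : ((2 : ℝ) ^ ε) ^ a ≤ ((p : ℝ) ^ ε) ^ a := by gcongr
      have h2 : 1 + a * (ε * Real.log 2) ≤ ((2 : ℝ) ^ ε) ^ a := by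
        rw [Real.rpow_def_of_pos (by norm_num), ← Real.exp_nat_mul]
        have := Real.add_one_le_exp (a * (Real.log 2 * ε))
        linarith
      have h3 : 1 + a * (ε * Real.log 2) ≤ ((p : ℝ) ^ ε) ^ a := h2.trans h1
      have ha : (0 : ℝ) ≤ a := Nat.cast_nonneg a
      calc (a : ℝ) + 1 ≤ C₁ * (1 + a * (ε * Real.log 2)) := by nlinarith
        _ ≤ _ := by gcongr
    · rw [one_mul]
      have h1 : (2 : ℝ) ≤ (p : ℝ) ^ ε := by
        have : (2 : ℝ) ^ (1 / ε) ≤ p := hp₀.trans (by exact_mod_cast not_lt.1 h)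
        calc (2 : ℝ) = ((2 : ℝ) ^ (1 / ε)) ^ ε := by
              rw [← Real.rpow_mul (by norm_num), one_div_mul_cancel hε.ne', Real.rpow_one]
          _ ≤ _ := by gcongr
      calc (a : ℝ) + 1 ≤ (2 : ℝ) ^ a := by exact_mod_cast Nat.lt_two_pow_self
        _ ≤ _ := by gcongr
  refine ⟨C₁ ^ p₀, one_le_pow₀ hC1, fun n hn ↦ ?_⟩
  rw [Nat.card_divisors hn.ne']
  push_cast
  have hn' : (n : ℝ) ^ ε = ∏ p ∈ n.primeFactors, ((p : ℝ) ^ n.factorization p) ^ ε := by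
    rw [Real.finsetProd_rpow _ _ (fun _ _ ↦ by positivity)]
    congr 1
    have := Nat.prod_factorization_pow_eq_self hn.ne'
    rw [Finsupp.prod, Nat.support_factorization] at this
    exact_mod_cast this.symm
  calc ∏ p ∈ n.primeFactors, ((n.factorization p : ℝ) + 1)
      ≤ ∏ p ∈ n.primeFactors,
          (if p < p₀ then C₁ else 1) * ((p : ℝ) ^ n.factorization p) ^ ε := by
        refine prod_le_prod (fun _ _ ↦ by positivity) fun p hp ↦ ?_
        exact hlocal p (Nat.prime_of_mem_primeFactors hp) _
    _ = (∏ p ∈ n.primeFactors, if p < p₀ then C₁ else 1) * (n : ℝ) ^ ε := by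
        rw [prod_mul_distrib, hn']
    _ ≤ _ := by
        gcongr
        rw [prod_ite, prod_const_one, mul_one, prod_const]
        refine pow_le_pow_right₀ hC1 ?_
        calc _ ≤ (range p₀).card := card_le_card fun p hp ↦ mem_range.2 (mem_filter.1 hp).2
          _ = p₀ := card_range p₀

/-- A Chebyshev lower bound for the primes in `(n, 2n]`. -/
lemma le_sum_log_primes_Ioc {n : ℕ} (hn : 4 ≤ n) :
    n * Real.log 4 / 3 - Real.log n - √(2 * n) * Real.log (2 * n) ≤
      ∑ p ∈ Ioc n (2 * n) with p.Prime, Real.log p := by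
  have hn0 : 0 < n := by omega
  have hnR : (4 : ℝ) ≤ n := by exact_mod_cast hn
  set v := fun p ↦ (n.centralBinom).factorization p with hv
  have hlogC : Real.log n.centralBinom = ∑ p ∈ range (2 * n + 1), Real.log ((p : ℝ) ^ v p) := by
    rw [← Real.log_prod]
    · rw [← n.prod_pow_factorization_centralBinom]
      push_cast
      rfl
    · intro p _
      rcases Nat.eq_zero_or_pos p with rfl | hp
      · simp [hv]
      · positivity
  have hpow : (n : ℝ) * Real.log 4 ≤ Real.log n + Real.log n.centralBinom := by
    have h1 : (4 : ℝ) ^ n ≤ n * n.centralBinom := by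
      exact_mod_cast (Nat.four_pow_lt_mul_centralBinom n hn).le
    have h2 := Real.log_le_log (by positivity) h1
    rwa [Real.log_pow, Real.log_mul (by positivity)
      (by exact_mod_cast n.centralBinom_ne_zero)] at h2
  have hterm : ∀ p ∈ range (2 * n + 1), Real.log ((p : ℝ) ^ v p) ≤
      (if p ∈ Icc 1 (Nat.sqrt (2 * n)) then Real.log (2 * n) else 0)
      + ((if p ∈ {p ∈ Ioc 0 (2 * n / 3) | p.Prime} then Real.log p else 0)
        + (if p ∈ {p ∈ Ioc n (2 * n) | p.Prime} then Real.log p else 0)) := by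
    intro p hp
    have hp2 : p ≤ 2 * n := by have := mem_range.1 hp; omega
    have hlog2n : 0 ≤ Real.log (2 * n) := Real.log_nonneg (by linarith)
    have hlogp : 0 ≤ Real.log p := Real.log_natCast_nonneg p
    have n1 : 0 ≤ if p ∈ Icc 1 (Nat.sqrt (2 * n)) then Real.log (2 * n) else 0 := by
      split_ifs <;> simp [hlog2n]
    have n2 : 0 ≤ if p ∈ {p ∈ Ioc 0 (2 * n / 3) | p.Prime} then Real.log p else 0 := by
      split_ifs <;> simp [hlogp]
    have n3 : 0 ≤ if p ∈ {p ∈ Ioc n (2 * n) | p.Prime} then Real.log p else 0 := by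
      split_ifs <;> simp [hlogp]
    by_cases hprime : p.Prime
    swap
    · have : v p = 0 := Nat.factorization_eq_zero_of_not_prime _ hprime
      rw [this, pow_zero, Real.log_one]
      linarith
    rcases le_or_gt p (Nat.sqrt (2 * n)) with h1 | h1
    · rw [if_pos (mem_Icc.2 ⟨hprime.one_lt.le, h1⟩)]
      have h3 : p ^ v p ≤ 2 * n := Nat.pow_factorization_choose_le (by omega)
      have h4 : Real.log ((p : ℝ) ^ v p) ≤ Real.log (2 * n) :=
        Real.log_le_log (by have := hprime.pos; positivity) (by exact_mod_cast h3)
      linarith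
    have hv1 : v p ≤ 1 := Nat.factorization_choose_le_one (Nat.sqrt_lt'.1 h1)
    have h5 : Real.log ((p : ℝ) ^ v p) ≤ Real.log p := by
      rw [Real.log_pow]
      have : (v p : ℝ) ≤ 1 := by exact_mod_cast hv1
      nlinarith
    rcases le_or_gt p (2 * n / 3) with h2 | h2
    · rw [if_pos (mem_filter.2 ⟨mem_Ioc.2 ⟨hprime.pos, h2⟩, hprime⟩)] at n2 ⊢
      linarith
    rcases le_or_gt p n with h3 | h3
    · have : v p = 0 :=
        Nat.factorization_centralBinom_of_two_mul_self_lt_three_mul (by omega) h3 (by omega)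
      rw [this, pow_zero, Real.log_one]
      linarith
    · rw [if_pos (mem_filter.2 ⟨mem_Ioc.2 ⟨h3, hp2⟩, hprime⟩)] at n3 ⊢
      linarith
  have hsum := sum_le_sum hterm
  rw [← hlogC, sum_add_distrib, sum_add_distrib] at hsum
  have hsub : ∀ (s : Finset ℕ) (f : ℕ → ℝ), s ⊆ range (2 * n + 1) →
      ∑ p ∈ range (2 * n + 1), (if p ∈ s then f p else 0) = ∑ p ∈ s, f p := by
    intro s f hs
    rw [← sum_filter]
    congr 1
    ext p
    rw [mem_filter]
    exact ⟨fun h ↦ h.2, fun h ↦ ⟨hs h, h⟩⟩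
  rw [hsub (Icc 1 (Nat.sqrt (2 * n))) (fun _ ↦ Real.log (2 * n)), hsub _ (fun p ↦ Real.log p),
    hsub _ (fun p ↦ Real.log p)] at hsum
  · rw [sum_const, Nat.card_Icc, nsmul_eq_mul, Nat.add_sub_cancel] at hsum
    have hθ : ∑ p ∈ Ioc 0 (2 * n / 3) with p.Prime, Real.log p ≤ Real.log 4 * (2 * n / 3) := by
      have h1 := Chebyshev.theta_le_log4_mul_x (x := ((2 * n / 3 : ℕ) : ℝ)) (Nat.cast_nonneg _)
      rw [Chebyshev.theta, Nat.floor_natCast] at h1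
      refine h1.trans ?_
      have h2 : ((2 * n / 3 : ℕ) : ℝ) ≤ 2 * n / 3 := by
        have := Nat.cast_div_le (α := ℝ) (m := 2 * n) (n := 3)
        push_cast at this
        exact this
      have := Real.log_nonneg (by norm_num : (1 : ℝ) ≤ 4)
      gcongr
    have hsq : ((Nat.sqrt (2 * n) : ℕ) : ℝ) ≤ √(2 * n) := by
      have := Real.nat_sqrt_le_real_sqrt (a := 2 * n)
      push_cast at this
      exact this
    have hlog2n : 0 ≤ Real.log (2 * n) := Real.log_nonneg (by linarith)
    have := mul_le_mul_of_nonneg_right hsq hlog2n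
    linarith
  all_goals
    intro p hp
    simp only [mem_filter, mem_Ioc, mem_Icc] at hp
    rw [mem_range]
    first
    | omega
    | have := Nat.sqrt_le_self (2 * n)
      omega

/-- The `1`-periodic triangle function of height `1` and half-width `w`. -/
noncomputable def hat (w x : ℝ) : ℝ := max 0 (1 - |x - round x| / w)

lemma hat_nonneg (w x : ℝ) : 0 ≤ hat w x := le_max_left _ _

lemma hat_le_one {w : ℝ} (hw : 0 < w) (x : ℝ) : hat w x ≤ 1 :=
  max_le zero_le_one (sub_le_self _ (by positivity))

/-- The `1`-periodic extension of the second Bernoulli polynomial. -/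
noncomputable def bernoulliTwo (x : ℝ) : ℝ := Int.fract x ^ 2 - Int.fract x + 1 / 6

lemma bernoulliTwo_eq {x : ℝ} {n : ℤ} (h1 : (n : ℝ) ≤ x) (h2 : x ≤ n + 1) :
    bernoulliTwo x = (x - n) ^ 2 - (x - n) + 1 / 6 := by
  rcases h2.lt_or_eq with h | h
  · have : Int.fract x = x - n := by
      rw [Int.fract, Int.floor_eq_iff.2 ⟨h1, h⟩]
    rw [bernoulliTwo, this]
  · have : Int.fract x = 0 := by
      rw [h]
      exact_mod_cast Int.fract_intCast (n + 1)
    rw [bernoulliTwo, this, h]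
    ring

lemma hat_eq_bernoulliTwo {w : ℝ} (hw : 0 < w) (hw2 : w ≤ 1 / 2) (x : ℝ) :
    hat w x = w - (bernoulliTwo (x + w) - 2 * bernoulliTwo x + bernoulliTwo (x - w)) / (2 * w) := by
  set n := ⌊x⌋ with hn
  have h0 : (n : ℝ) ≤ x := Int.floor_le x
  have h1 : x < n + 1 := Int.lt_floor_add_one x
  have hb : bernoulliTwo x = (x - n) ^ 2 - (x - n) + 1 / 6 := bernoulliTwo_eq h0 h1.le
  rw [hat, abs_sub_round_eq_min, hb]
  have hf : Int.fract x = x - n := rfl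
  rw [hf]
  rcases lt_or_ge (x - n) w with h | h
  · have hp : bernoulliTwo (x + w) = (x + w - n) ^ 2 - (x + w - n) + 1 / 6 :=
      bernoulliTwo_eq (by linarith) (by linarith)
    have hm : bernoulliTwo (x - w) = (x - w - (n - 1 : ℤ)) ^ 2 - (x - w - (n - 1 : ℤ)) + 1 / 6 :=
      bernoulliTwo_eq (by push_cast; linarith) (by push_cast; linarith)
    rw [hp, hm, min_eq_left (by linarith), max_eq_right]
    · push_cast
      field_simp
      ring
    · rw [sub_nonneg, div_le_one hw]
      exact h.le
  rcases le_or_gt (x - n) (1 - w) with h' | h'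
  · have hp : bernoulliTwo (x + w) = (x + w - n) ^ 2 - (x + w - n) + 1 / 6 :=
      bernoulliTwo_eq (by linarith) (by linarith)
    have hm : bernoulliTwo (x - w) = (x - w - n) ^ 2 - (x - w - n) + 1 / 6 :=
      bernoulliTwo_eq (by linarith) (by linarith)
    rw [hp, hm, max_eq_left]
    · field_simp
      ring
    · rw [sub_nonpos, le_div_iff₀ hw, one_mul]
      exact le_min h (by linarith)
  · have hp : bernoulliTwo (x + w) = (x + w - (n + 1 : ℤ)) ^ 2 - (x + w - (n + 1 : ℤ)) + 1 / 6 :=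
      bernoulliTwo_eq (by push_cast; linarith) (by push_cast; linarith)
    have hm : bernoulliTwo (x - w) = (x - w - n) ^ 2 - (x - w - n) + 1 / 6 :=
      bernoulliTwo_eq (by linarith) (by linarith)
    rw [hp, hm, min_eq_right (by linarith), max_eq_right]
    · push_cast
      field_simp
      ring
    · rw [sub_nonneg, div_le_one hw]
      linarith

lemma hasSum_cos_bernoulliTwo (x : ℝ) :
    HasSum (fun n : ℕ ↦ 1 / (n : ℝ) ^ 2 * Real.cos (2 * Real.pi * n * x))
      (Real.pi ^ 2 * bernoulliTwo x) := by
  have h := hasSum_one_div_nat_pow_mul_cos (k := 1) one_ne_zero (x := Int.fract x)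
    ⟨Int.fract_nonneg x, (Int.fract_lt_one x).le⟩
  convert h using 1
  · funext n
    rw [mul_one]
    congr 1
    have : 2 * Real.pi * n * x = 2 * Real.pi * n * Int.fract x + (n * ⌊x⌋ : ℤ) * (2 * Real.pi) := by
      rw [Int.fract]; push_cast; ring
    rw [this, Real.cos_add_int_mul_two_pi]
  · have : (Polynomial.map (algebraMap ℚ ℝ) (Polynomial.bernoulli (2 * 1))).eval (Int.fract x)
        = bernoulliTwo x := by
      simp [Polynomial.bernoulli, sum_range_succ, bernoulli_two,
        bernoulliTwo, Nat.choose]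
      ring
    rw [this, show Nat.factorial (2 * 1) = 2 from rfl]
    push_cast
    ring

/-- The Fourier coefficients of the triangle function. -/
noncomputable def hatCoeff (w : ℝ) (n : ℕ) : ℝ :=
  Real.sin (Real.pi * n * w) ^ 2 / (Real.pi ^ 2 * n ^ 2 * w)

lemma hatCoeff_nonneg {w : ℝ} (hw : 0 < w) (n : ℕ) : 0 ≤ hatCoeff w n := by
  unfold hatCoeff; positivity

lemma hatCoeff_le {w : ℝ} (hw : 0 < w) (n : ℕ) : hatCoeff w n ≤ 1 / w * (1 / (n : ℝ) ^ 2) := by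
  rcases Nat.eq_zero_or_pos n with rfl | hn
  · simp [hatCoeff]
  have hnR : (0 : ℝ) < n := by exact_mod_cast hn
  have h1 : Real.sin (Real.pi * n * w) ^ 2 ≤ 1 := Real.sin_sq_le_one _
  have h2 : 1 ≤ Real.pi ^ 2 := by nlinarith [Real.pi_gt_three]
  rw [hatCoeff, one_div_mul_one_div, div_le_div_iff₀ (by positivity) (by positivity)]
  have h3 : 0 < w * (n : ℝ) ^ 2 := by positivity
  nlinarith

lemma hasSum_hat {w : ℝ} (hw : 0 < w) (hw2 : w ≤ 1 / 2) (x : ℝ) :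
    HasSum (fun n : ℕ ↦ 2 * hatCoeff w n * Real.cos (2 * Real.pi * n * x)) (hat w x - w) := by
  have h := (((hasSum_cos_bernoulliTwo (x + w)).sub ((hasSum_cos_bernoulliTwo x).mul_left 2)).add
    (hasSum_cos_bernoulliTwo (x - w))).mul_left (-(1 / (2 * w * Real.pi ^ 2)))
  have hf : (fun n : ℕ ↦ 2 * hatCoeff w n * Real.cos (2 * Real.pi * n * x)) =
      fun n : ℕ ↦ -(1 / (2 * w * Real.pi ^ 2)) *
        (1 / (n : ℝ) ^ 2 * Real.cos (2 * Real.pi * n * (x + w)) -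
          2 * (1 / (n : ℝ) ^ 2 * Real.cos (2 * Real.pi * n * x)) +
          1 / (n : ℝ) ^ 2 * Real.cos (2 * Real.pi * n * (x - w))) := by
    funext n
    rw [hatCoeff, mul_add (2 * Real.pi * n), mul_sub (2 * Real.pi * n), Real.cos_add, Real.cos_sub,
      show 2 * Real.pi * n * w = 2 * (Real.pi * n * w) by ring, Real.cos_two_mul, Real.cos_sq']
    rcases Nat.eq_zero_or_pos n with rfl | hn
    · simp
    have hnR : (n : ℝ) ≠ 0 := by exact_mod_cast hn.ne'
    have := Real.pi_ne_zero
    field_simp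
    ring
  have hv : hat w x - w = -(1 / (2 * w * Real.pi ^ 2)) * (Real.pi ^ 2 * bernoulliTwo (x + w) -
      2 * (Real.pi ^ 2 * bernoulliTwo x) + Real.pi ^ 2 * bernoulliTwo (x - w)) := by
    rw [hat_eq_bernoulliTwo hw hw2]
    have := Real.pi_ne_zero
    field_simp
    ring
  rw [hf, hv]
  exact h

lemma sum_Icc_neg_natCast {M : Type*} [AddCommMonoid M] (f : ℤ → M) (H : ℕ) :
    ∑ h ∈ Icc (-(H : ℤ)) H, f h = f 0 + ∑ n ∈ Icc 1 H, (f n + f (-n)) := by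
  induction H with
  | zero => simp
  | succ H ih =>
    have h1 : Icc (-((H + 1 : ℕ) : ℤ)) (H + 1 : ℕ) =
        insert ((H + 1 : ℕ) : ℤ) (insert (-((H + 1 : ℕ) : ℤ)) (Icc (-(H : ℤ)) H)) := by
      ext x
      simp only [mem_Icc, mem_insert]
      push_cast
      omega
    rw [h1, sum_insert (by simp only [mem_insert, mem_Icc]; push_cast; omega),
      sum_insert (by simp only [mem_Icc]; push_cast; omega), ih,
      sum_Icc_succ_top (by omega)]
    abel

/-- The complex Fourier coefficients of the triangle function. -/
noncomputable def hatFourier (w : ℝ) (h : ℤ) : ℝ := if h = 0 then w else hatCoeff w h.natAbs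

lemma hatFourier_nonneg {w : ℝ} (hw : 0 < w) (h : ℤ) : 0 ≤ hatFourier w h := by
  rw [hatFourier]
  split_ifs
  exacts [hw.le, hatCoeff_nonneg hw _]

lemma sum_hatFourier_mul_e (w x : ℝ) (H : ℕ) :
    ∑ h ∈ Icc (-(H : ℤ)) H, (hatFourier w h : ℂ) * e (h * x) =
      ((w + ∑ n ∈ range (H + 1), 2 * hatCoeff w n * Real.cos (2 * Real.pi * n * x) : ℝ) : ℂ) := by
  have h0 : hatCoeff w 0 = 0 := by simp [hatCoeff]
  have h1 : ∑ n ∈ range (H + 1), 2 * hatCoeff w n * Real.cos (2 * Real.pi * n * x) =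
      ∑ n ∈ Icc 1 H, 2 * hatCoeff w n * Real.cos (2 * Real.pi * n * x) := by
    symm
    refine sum_subset (fun n hn ↦ by rw [mem_Icc] at hn; rw [mem_range]; omega) fun n hn hn' ↦ ?_
    rw [mem_range] at hn
    rw [mem_Icc] at hn'
    rw [show n = 0 by omega, h0]
    simp
  rw [sum_Icc_neg_natCast, h1]
  push_cast
  congr 1
  · simp [hatFourier, e_zero]
  · refine sum_congr rfl fun n hn ↦ ?_
    have hn0 : (n : ℤ) ≠ 0 := by rw [mem_Icc] at hn; omega
    rw [hatFourier, if_neg hn0, hatFourier, if_neg (neg_ne_zero.2 hn0), Int.natAbs_neg,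
      Int.natAbs_natCast, e_eq, e_eq,
      show 2 * Real.pi * (-(n : ℝ) * x) = -(2 * Real.pi * (n * x)) by ring, Real.cos_neg,
      Real.sin_neg, show 2 * (Real.pi : ℂ) * n * x = 2 * Real.pi * (n * x) by ring]
    push_cast
    ring

lemma norm_hat_sub_le {w : ℝ} (hw : 0 < w) (hw2 : w ≤ 1 / 2) {H : ℕ} (hH : 0 < H) (x : ℝ) :
    ‖(hat w x : ℂ) - ∑ h ∈ Icc (-(H : ℤ)) H, (hatFourier w h : ℂ) * e (h * x)‖ ≤
      2 / (w * H) := by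
  rw [sum_hatFourier_mul_e, ← Complex.ofReal_sub, Complex.norm_real, Real.norm_eq_abs]
  have h := (hasSum_hat hw hw2 x).tendsto_sum_nat
  set f : ℕ → ℝ := fun n ↦ 2 * hatCoeff w n * Real.cos (2 * Real.pi * n * x) with hf
  have hlim := (h.sub_const (∑ n ∈ range (H + 1), f n)).abs
  rw [← sub_sub]
  refine le_of_tendsto hlim ?_
  filter_upwards [Filter.eventually_ge_atTop (H + 1)] with M hM
  rw [← sum_Ico_eq_sub _ hM]
  have hfn : ∀ n, |f n| ≤ 2 / w * ((n : ℝ) ^ 2)⁻¹ := by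
    intro n
    rw [hf, abs_mul, abs_of_nonneg (by have := hatCoeff_nonneg hw n; positivity)]
    calc 2 * hatCoeff w n * |Real.cos (2 * Real.pi * n * x)|
        ≤ 2 * (1 / w * (1 / (n : ℝ) ^ 2)) * 1 :=
          mul_le_mul (by have := hatCoeff_le hw n; linarith) (Real.abs_cos_le_one _)
            (abs_nonneg _) (by positivity)
      _ = 2 / w * ((n : ℝ) ^ 2)⁻¹ := by ring
  calc |∑ n ∈ Ico (H + 1) M, f n| ≤ ∑ n ∈ Ico (H + 1) M, 2 / w * ((n : ℝ) ^ 2)⁻¹ :=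
        (abs_sum_le_sum_abs _ _).trans (sum_le_sum fun n _ ↦ hfn n)
    _ ≤ ∑ n ∈ Ioc H M, 2 / w * ((n : ℝ) ^ 2)⁻¹ := by
        refine sum_le_sum_of_subset_of_nonneg (fun n hn ↦ ?_) fun n _ _ ↦ by positivity
        rw [mem_Ico] at hn
        rw [mem_Ioc]
        omega
    _ ≤ 2 / w * ((H : ℝ)⁻¹ - (M : ℝ)⁻¹) := by
        rw [← mul_sum]
        exact mul_le_mul_of_nonneg_left (sum_Ioc_inv_sq_le_sub hH.ne' (by omega)) (by positivity)
    _ ≤ 2 / w * (H : ℝ)⁻¹ := by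
        gcongr
        exact sub_le_self _ (by positivity)
    _ = 2 / (w * H) := by
        field_simp

lemma sum_hatFourier_le_one {w : ℝ} (hw : 0 < w) (hw2 : w ≤ 1 / 2) (H : ℕ) :
    ∑ h ∈ Icc (-(H : ℤ)) H, hatFourier w h ≤ 1 := by
  have h1 := sum_hatFourier_mul_e w 0 H
  simp only [mul_zero, e_zero, mul_one, Real.cos_zero] at h1
  have h2 : ∑ h ∈ Icc (-(H : ℤ)) H, hatFourier w h = w + ∑ n ∈ range (H + 1), 2 * hatCoeff w n := by
    exact_mod_cast h1
  have h3 := hasSum_hat hw hw2 0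
  simp only [mul_zero, mul_one, Real.cos_zero] at h3
  have h4 := sum_le_hasSum (range (H + 1))
    (fun n _ ↦ by have := hatCoeff_nonneg hw n; positivity) h3
  have h5 := hat_le_one hw 0
  linarith

lemma norm_sum_hatFourier_le {w : ℝ} (hw : 0 < w) (hw2 : w ≤ 1 / 2) (H : ℕ) (x : ℝ) :
    ‖∑ h ∈ Icc (-(H : ℤ)) H, (hatFourier w h : ℂ) * e (h * x)‖ ≤ 1 := by
  refine (norm_sum_le _ _).trans (le_trans (sum_le_sum fun h _ ↦ ?_)
    (sum_hatFourier_le_one hw hw2 H))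
  rw [norm_mul, norm_e, mul_one, Complex.norm_real, Real.norm_eq_abs,
    abs_of_nonneg (hatFourier_nonneg hw h)]

/-- Equidistribution of weighted points in the plane modulo one, tested against products of
triangle functions, in terms of exponential sums. -/
lemma abs_sum_hat_mul_hat_sub_le {ι : Type*} (s : Finset ι) (ω x y : ι → ℝ)
    (hω : ∀ i ∈ s, 0 ≤ ω i) {w₁ w₂ : ℝ} (hw₁ : 0 < w₁) (hw₁' : w₁ ≤ 1 / 2) (hw₂ : 0 < w₂)
    (hw₂' : w₂ ≤ 1 / 2) {H₁ H₂ : ℕ} (hH₁ : 0 < H₁) (hH₂ : 0 < H₂) (a b : ℝ) {E : ℝ} (hE : 0 ≤ E)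
    (hsum : ∀ j ∈ Icc (-(H₁ : ℤ)) H₁, ∀ h ∈ Icc (-(H₂ : ℤ)) H₂, (j ≠ 0 ∨ h ≠ 0) →
      ‖∑ i ∈ s, (ω i : ℂ) * e (j * x i + h * y i)‖ ≤ E) :
    |∑ i ∈ s, ω i * (hat w₁ (x i + a) * hat w₂ (y i + b)) - w₁ * w₂ * ∑ i ∈ s, ω i| ≤
      E + (2 / (w₁ * H₁) + 2 / (w₂ * H₂)) * ∑ i ∈ s, ω i := by
  set T₁ : ℝ → ℂ := fun t ↦ ∑ h ∈ Icc (-(H₁ : ℤ)) H₁, (hatFourier w₁ h : ℂ) * e (h * t) with hT₁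
  set T₂ : ℝ → ℂ := fun t ↦ ∑ h ∈ Icc (-(H₂ : ℤ)) H₂, (hatFourier w₂ h : ℂ) * e (h * t) with hT₂
  have h1 : ‖∑ i ∈ s, (ω i : ℂ) * (hat w₁ (x i + a) * hat w₂ (y i + b) -
      T₁ (x i + a) * T₂ (y i + b))‖ ≤ (2 / (w₁ * H₁) + 2 / (w₂ * H₂)) * ∑ i ∈ s, ω i := by
    rw [mul_sum]
    refine norm_sum_le_of_le _ fun i hi ↦ ?_
    rw [norm_mul, Complex.norm_real, Real.norm_eq_abs, abs_of_nonneg (hω i hi), mul_comm]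
    refine mul_le_mul_of_nonneg_right ?_ (hω i hi)
    have e1 : (hat w₁ (x i + a) * hat w₂ (y i + b) - T₁ (x i + a) * T₂ (y i + b) : ℂ) =
        (hat w₁ (x i + a) - T₁ (x i + a)) * hat w₂ (y i + b) +
        T₁ (x i + a) * (hat w₂ (y i + b) - T₂ (y i + b)) := by ring
    rw [e1]
    refine (norm_add_le _ _).trans (add_le_add ?_ ?_)
    · rw [norm_mul, Complex.norm_real, Real.norm_eq_abs, abs_of_nonneg (hat_nonneg _ _)]
      calc _ ≤ 2 / (w₁ * H₁) * 1 := mul_le_mul (norm_hat_sub_le hw₁ hw₁' hH₁ _)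
            (hat_le_one hw₂ _) (hat_nonneg _ _) (by positivity)
        _ = _ := mul_one _
    · rw [norm_mul]
      calc _ ≤ 1 * (2 / (w₂ * H₂)) := mul_le_mul (norm_sum_hatFourier_le hw₁ hw₁' _ _)
            (norm_hat_sub_le hw₂ hw₂' hH₂ _) (norm_nonneg _) zero_le_one
        _ = _ := one_mul _
  have h2 : ∑ i ∈ s, (ω i : ℂ) * (T₁ (x i + a) * T₂ (y i + b)) =
      ∑ j ∈ Icc (-(H₁ : ℤ)) H₁, ∑ h ∈ Icc (-(H₂ : ℤ)) H₂,
        (hatFourier w₁ j * hatFourier w₂ h) * (e (j * a + h * b) *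
          ∑ i ∈ s, (ω i : ℂ) * e (j * x i + h * y i)) := by
    have h0 : ∀ i, (ω i : ℂ) * (T₁ (x i + a) * T₂ (y i + b)) =
        ∑ j ∈ Icc (-(H₁ : ℤ)) H₁, ∑ h ∈ Icc (-(H₂ : ℤ)) H₂,
          (hatFourier w₁ j * hatFourier w₂ h) * (e (j * a + h * b) *
            ((ω i : ℂ) * e (j * x i + h * y i))) := by
      intro i
      simp only [hT₁, hT₂]
      rw [sum_mul_sum, mul_sum]
      refine sum_congr rfl fun j _ ↦ ?_
      rw [mul_sum]
      refine sum_congr rfl fun h _ ↦ ?_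
      rw [mul_add, mul_add, e_add, e_add, e_add, e_add]
      ring
    simp only [h0]
    rw [sum_comm]
    refine sum_congr rfl fun j _ ↦ ?_
    rw [sum_comm]
    refine sum_congr rfl fun h _ ↦ ?_
    rw [mul_sum, mul_sum]
  have h3 : ‖∑ i ∈ s, (ω i : ℂ) * (T₁ (x i + a) * T₂ (y i + b)) -
      (w₁ * w₂ * ∑ i ∈ s, ω i : ℝ)‖ ≤ E := by
    have h4 : ∑ j ∈ Icc (-(H₁ : ℤ)) H₁, ∑ h ∈ Icc (-(H₂ : ℤ)) H₂,
        (if j = 0 ∧ h = 0 then ((w₁ * w₂ * ∑ i ∈ s, ω i : ℝ) : ℂ) else 0) =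
        (w₁ * w₂ * ∑ i ∈ s, ω i : ℝ) := by
      rw [sum_eq_single_of_mem 0 (by simp), sum_eq_single_of_mem 0 (by simp)]
      · simp
      · intro h _ hh
        simp [hh]
      · intro j _ hj
        simp [hj]
    rw [h2, ← h4, ← sum_sub_distrib]
    simp only [← sum_sub_distrib]
    calc _ ≤ ∑ j ∈ Icc (-(H₁ : ℤ)) H₁, ∑ h ∈ Icc (-(H₂ : ℤ)) H₂,
          hatFourier w₁ j * hatFourier w₂ h * E := by
          refine norm_sum_le_of_le _ fun j hj ↦ norm_sum_le_of_le _ fun h hh ↦ ?_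
          have hp := mul_nonneg (hatFourier_nonneg hw₁ j) (hatFourier_nonneg hw₂ h)
          split_ifs with h0
          · obtain ⟨rfl, rfl⟩ := h0
            simp [hatFourier, e_zero]
            positivity
          · rw [sub_zero, ← Complex.ofReal_mul, norm_mul, norm_mul, norm_e, one_mul,
              Complex.norm_real, Real.norm_eq_abs, abs_of_nonneg hp]
            exact mul_le_mul_of_nonneg_left (hsum j hj h hh (by tauto)) hp
      _ = (∑ j ∈ Icc (-(H₁ : ℤ)) H₁, hatFourier w₁ j) *
          (∑ h ∈ Icc (-(H₂ : ℤ)) H₂, hatFourier w₂ h) * E := by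
          rw [sum_mul_sum, sum_mul]
          simp only [sum_mul]
      _ ≤ 1 * 1 * E := by
          refine mul_le_mul_of_nonneg_right (mul_le_mul (sum_hatFourier_le_one hw₁ hw₁' _)
            (sum_hatFourier_le_one hw₂ hw₂' _) ?_ zero_le_one) hE
          exact sum_nonneg fun h _ ↦ hatFourier_nonneg hw₂ h
      _ = E := by ring
  rw [← Real.norm_eq_abs, ← Complex.norm_real]
  have h5 : ((∑ i ∈ s, ω i * (hat w₁ (x i + a) * hat w₂ (y i + b)) -
      w₁ * w₂ * ∑ i ∈ s, ω i : ℝ) : ℂ) =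
      (∑ i ∈ s, (ω i : ℂ) * (T₁ (x i + a) * T₂ (y i + b)) - (w₁ * w₂ * ∑ i ∈ s, ω i : ℝ)) +
      ∑ i ∈ s, (ω i : ℂ) * (hat w₁ (x i + a) * hat w₂ (y i + b) -
        T₁ (x i + a) * T₂ (y i + b)) := by
    simp only [mul_sub, sum_sub_distrib]
    push_cast
    ring
  rw [h5]
  exact (norm_add_le _ _).trans (add_le_add h3 h1)

section PhaseFunction

variable {c V X x j θ : ℝ}

/-- The phase `j x ^ c + θ (V - x ^ c) ^ (1 / c)`. -/
noncomputable def powPhase (c V j θ x : ℝ) : ℝ := j * x ^ c + θ * (V - x ^ c) ^ (1 / c)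

/-- The derivative of `powPhase`. -/
noncomputable def powPhase₁ (c V j θ x : ℝ) : ℝ :=
  x ^ (c - 1) * (j * c - θ * (V - x ^ c) ^ (1 / c - 1))

/-- The factor of `powPhase₂` whose zero has to be avoided. -/
noncomputable def factor₂ (c V x : ℝ) : ℝ := V * (V - x ^ c) ^ (1 / c - 2)

/-- The factor of `powPhase₃` whose zero has to be avoided. -/
noncomputable def factor₃ (c V x : ℝ) : ℝ :=
  V * ((V - x ^ c) ^ (1 / c - 3) * (V + (1 - 1 / c) * x ^ c))

/-- The derivative of `powPhase₁`. -/
noncomputable def powPhase₂ (c V j θ x : ℝ) : ℝ :=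
  (c - 1) * x ^ (c - 2) * (j * c - θ * factor₂ c V x)

/-- The derivative of `x ^ 2 * powPhase₂ c V j θ x`. -/
noncomputable def powPhase₃ (c V j θ x : ℝ) : ℝ :=
  c * (c - 1) * x ^ (c - 1) * (j * c - θ * factor₃ c V x)

lemma hasDerivAt_sub_rpow (hx : 0 < x) (hw : 0 < V - x ^ c) (a : ℝ) :
    HasDerivAt (fun x ↦ (V - x ^ c) ^ a)
      (-(a * c * x ^ (c - 1) * (V - x ^ c) ^ (a - 1))) x := by
  have h1 : HasDerivAt (fun x ↦ V - x ^ c) (-(c * x ^ (c - 1))) x :=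
    (Real.hasDerivAt_rpow_const (Or.inl hx.ne')).const_sub V
  have h2 := h1.rpow_const (p := a) (Or.inl hw.ne')
  convert h2 using 1
  ring

lemma hasDerivAt_powPhase (hc : 0 < c) (hx : 0 < x) (hw : 0 < V - x ^ c) :
    HasDerivAt (powPhase c V j θ) (powPhase₁ c V j θ x) x := by
  have h1 : HasDerivAt (fun x : ℝ ↦ x ^ c) (c * x ^ (c - 1)) x :=
    Real.hasDerivAt_rpow_const (Or.inl hx.ne')
  have h2 := (h1.const_mul j).add ((hasDerivAt_sub_rpow hx hw (1 / c)).const_mul θ)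
  refine HasDerivAt.congr_deriv (f := powPhase c V j θ) h2 ?_
  rw [powPhase₁]
  field_simp
  ring

lemma rpow_sub_two (hx : 0 < x) : x ^ (c - 1) = x * x ^ (c - 2) := by
  rw [mul_comm, ← Real.rpow_add_one hx.ne']; congr 1; ring

lemma hasDerivAt_powPhase₁ (hc : 0 < c) (hx : 0 < x) (hw : 0 < V - x ^ c) :
    HasDerivAt (powPhase₁ c V j θ) (powPhase₂ c V j θ x) x := by
  have h1 : HasDerivAt (fun x : ℝ ↦ x ^ (c - 1)) ((c - 1) * x ^ (c - 1 - 1)) x :=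
    Real.hasDerivAt_rpow_const (Or.inl hx.ne')
  have h2 := h1.mul (((hasDerivAt_sub_rpow hx hw (1 / c - 1)).const_mul θ).const_sub (j * c))
  refine HasDerivAt.congr_deriv (f := powPhase₁ c V j θ) h2 ?_
  rw [powPhase₂, factor₂]
  have e1 : (V - x ^ c) ^ (1 / c - 1) = (V - x ^ c) * (V - x ^ c) ^ (1 / c - 2) := by
    rw [mul_comm, ← Real.rpow_add_one hw.ne']; congr 1; ring
  have e2 : x ^ c = x ^ 2 * x ^ (c - 2) := by
    rw [mul_comm, ← Real.rpow_natCast x 2, ← Real.rpow_add hx]; congr 1; push_cast; ring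
  rw [show c - 1 - 1 = c - 2 by ring, show 1 / c - 1 - 1 = 1 / c - 2 by ring, e1,
    rpow_sub_two hx]
  generalize (V - x ^ c) ^ (1 / c - 2) = W
  rw [e2]
  generalize x ^ (c - 2) = Z
  field_simp
  ring

lemma hasDerivAt_sq_mul_powPhase₂ (hc : 0 < c) (hx : 0 < x) (hw : 0 < V - x ^ c) :
    HasDerivAt (fun x ↦ x ^ 2 * powPhase₂ c V j θ x) (powPhase₃ c V j θ x) x := by
  have h1 : HasDerivAt (fun x : ℝ ↦ x ^ c) (c * x ^ (c - 1)) x :=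
    Real.hasDerivAt_rpow_const (Or.inl hx.ne')
  have h2 := (h1.const_mul (c - 1)).mul
    ((((hasDerivAt_sub_rpow hx hw (1 / c - 2)).const_mul V).const_mul θ).const_sub (j * c))
  have h3 : (fun x ↦ x ^ 2 * powPhase₂ c V j θ x) =ᶠ[nhds x]
      fun x ↦ ((c - 1) * x ^ c) * (j * c - θ * (V * (V - x ^ c) ^ (1 / c - 2))) := by
    filter_upwards [lt_mem_nhds hx] with y hy
    rw [powPhase₂, factor₂]
    have e2 : y ^ c = y ^ 2 * y ^ (c - 2) := by
      rw [mul_comm, ← Real.rpow_natCast y 2, ← Real.rpow_add hy]; congr 1; push_cast; ring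
    generalize (V - y ^ c) ^ (1 / c - 2) = W
    rw [e2]
    ring
  refine HasDerivAt.congr_of_eventuallyEq (HasDerivAt.congr_deriv (f := fun x ↦
    ((c - 1) * x ^ c) * (j * c - θ * (V * (V - x ^ c) ^ (1 / c - 2)))) h2 ?_) h3
  rw [powPhase₃, factor₃]
  have e1 : (V - x ^ c) ^ (1 / c - 2) = (V - x ^ c) * (V - x ^ c) ^ (1 / c - 3) := by
    rw [mul_comm, ← Real.rpow_add_one hw.ne']; congr 1; ring
  rw [show 1 / c - 2 - 1 = 1 / c - 3 by ring, e1]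
  generalize (V - x ^ c) ^ (1 / c - 3) = W
  generalize x ^ c = Y
  field_simp
  ring

lemma hasDerivAt_factor₂ (hx : 0 < x) (hw : 0 < V - x ^ c) :
    HasDerivAt (factor₂ c V)
      (V * ((2 - 1 / c) * c * x ^ (c - 1) * (V - x ^ c) ^ (1 / c - 3))) x := by
  refine HasDerivAt.congr_deriv (f := factor₂ c V)
    ((hasDerivAt_sub_rpow hx hw (1 / c - 2)).const_mul V) ?_
  rw [show 1 / c - 2 - 1 = 1 / c - 3 by ring]
  ring

lemma hasDerivAt_factor₃ (hx : 0 < x) (hw : 0 < V - x ^ c) :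
    HasDerivAt (factor₃ c V)
      (V * ((3 - 1 / c) * c * x ^ (c - 1) * (V - x ^ c) ^ (1 / c - 4) *
        (V + (1 - 1 / c) * x ^ c) +
        (V - x ^ c) ^ (1 / c - 3) * ((1 - 1 / c) * (c * x ^ (c - 1))))) x := by
  have h1 : HasDerivAt (fun x : ℝ ↦ x ^ c) (c * x ^ (c - 1)) x :=
    Real.hasDerivAt_rpow_const (Or.inl hx.ne')
  refine HasDerivAt.congr_deriv (f := factor₃ c V)
    (((hasDerivAt_sub_rpow hx hw (1 / c - 3)).mul
      ((h1.const_mul (1 - 1 / c)).const_add V)).const_mul V) ?_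
  rw [show 1 / c - 3 - 1 = 1 / c - 4 by ring]
  ring

lemma mul_sub_le_sub_of_hasDerivAt {f f' : ℝ → ℝ} {C y : ℝ} (hxy : x ≤ y)
    (hf : ∀ z ∈ Set.Icc x y, HasDerivAt f (f' z) z) (hC : ∀ z ∈ Set.Icc x y, C ≤ f' z) :
    C * (y - x) ≤ f y - f x := by
  refine (convex_Icc x y).mul_sub_le_image_sub_of_le_deriv
    (fun z hz ↦ (hf z hz).continuousAt.continuousWithinAt)
    (fun z hz ↦ (hf z (interior_subset hz)).differentiableAt.differentiableWithinAt)
    (fun z hz ↦ ?_) x ⟨le_rfl, hxy⟩ y ⟨hxy, le_rfl⟩ hxy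
  rw [(hf z (interior_subset hz)).deriv]
  exact hC z (interior_subset hz)

lemma mul_sub_le_factor₂_sub (hc : 1 ≤ c) (hX : 0 < X) {y : ℝ} (hx : X ≤ x) (hxy : x ≤ y)
    (hy : y ^ c < V) :
    V ^ (1 / c - 2) * X ^ (c - 1) * (y - x) ≤ factor₂ c V y - factor₂ c V x := by
  have hw : ∀ z ∈ Set.Icc x y, 0 < V - z ^ c := fun z hz ↦
    sub_pos.2 ((Real.rpow_le_rpow (by linarith [hz.1]) hz.2 (by linarith)).trans_lt hy)
  refine mul_sub_le_sub_of_hasDerivAt hxy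
    (fun z hz ↦ hasDerivAt_factor₂ (by linarith [hz.1]) (hw z hz)) fun z hz ↦ ?_
  have hz0 : 0 < z := by linarith [hz.1]
  have hV : 0 < V := by have := hw z hz; have := Real.rpow_nonneg hz0.le c; linarith
  have hc1 : 1 / c ≤ 1 := by rw [div_le_one (by linarith)]; exact hc
  have h1 : X ^ (c - 1) ≤ z ^ (c - 1) :=
    Real.rpow_le_rpow hX.le (by linarith [hz.1]) (by linarith)
  have h2 : V ^ (1 / c - 3) ≤ (V - z ^ c) ^ (1 / c - 3) :=
    Real.rpow_le_rpow_of_nonpos (hw z hz) (by have := Real.rpow_nonneg hz0.le c; linarith)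
      (by linarith)
  have h3 : V ^ (1 / c - 2) = V * V ^ (1 / c - 3) := by
    rw [mul_comm, ← Real.rpow_add_one hV.ne']; congr 1; ring
  have h4 : 1 ≤ (2 - 1 / c) * c := by
    have : (2 - 1 / c) * c = 2 * c - 1 := by field_simp
    linarith
  have h5 : 0 < V ^ (1 / c - 3) := Real.rpow_pos_of_pos hV _
  have h6 : 0 < X ^ (c - 1) := Real.rpow_pos_of_pos hX _
  calc V ^ (1 / c - 2) * X ^ (c - 1) = V * (1 * X ^ (c - 1) * V ^ (1 / c - 3)) := by rw [h3]; ring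
    _ ≤ _ := by gcongr

lemma mul_sub_le_factor₃_sub (hc : 1 ≤ c) (hX : 0 < X) {y : ℝ} (hx : X ≤ x) (hxy : x ≤ y)
    (hy : y ^ c < V) :
    V ^ (1 / c - 2) * X ^ (c - 1) * (y - x) ≤ factor₃ c V y - factor₃ c V x := by
  have hw : ∀ z ∈ Set.Icc x y, 0 < V - z ^ c := fun z hz ↦
    sub_pos.2 ((Real.rpow_le_rpow (by linarith [hz.1]) hz.2 (by linarith)).trans_lt hy)
  refine mul_sub_le_sub_of_hasDerivAt hxy
    (fun z hz ↦ hasDerivAt_factor₃ (by linarith [hz.1]) (hw z hz)) fun z hz ↦ ?_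
  have hz0 : 0 < z := by linarith [hz.1]
  have hzc := Real.rpow_nonneg hz0.le c
  have hV : 0 < V := by have := hw z hz; linarith
  have hc1 : 1 / c ≤ 1 := by rw [div_le_one (by linarith)]; exact hc
  have h1 : X ^ (c - 1) ≤ z ^ (c - 1) :=
    Real.rpow_le_rpow hX.le (by linarith [hz.1]) (by linarith)
  have h2 : V ^ (1 / c - 4) ≤ (V - z ^ c) ^ (1 / c - 4) :=
    Real.rpow_le_rpow_of_nonpos (hw z hz) (by linarith) (by linarith)
  have h3 : V ^ (1 / c - 2) = V * (V ^ (1 / c - 4) * V) := by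
    rw [← Real.rpow_add_one hV.ne', mul_comm, ← Real.rpow_add_one hV.ne']; congr 1; ring
  have h4 : 1 ≤ (3 - 1 / c) * c := by
    have : (3 - 1 / c) * c = 3 * c - 1 := by field_simp
    linarith
  have h5 : 0 < V ^ (1 / c - 4) := Real.rpow_pos_of_pos hV _
  have h6 : 0 < X ^ (c - 1) := Real.rpow_pos_of_pos hX _
  have h7 : V ≤ V + (1 - 1 / c) * z ^ c := le_add_of_nonneg_right (mul_nonneg (by linarith) hzc)
  have h8 : 0 ≤ (V - z ^ c) ^ (1 / c - 3) * ((1 - 1 / c) * (c * z ^ (c - 1))) :=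
    mul_nonneg (Real.rpow_nonneg (hw z hz).le _) (mul_nonneg (by linarith)
      (mul_nonneg (by linarith) (Real.rpow_nonneg hz0.le _)))
  calc V ^ (1 / c - 2) * X ^ (c - 1) = V * (1 * X ^ (c - 1) * V ^ (1 / c - 4) * V + 0) := by
        rw [h3]; ring
    _ ≤ _ := by
        gcongr
        exact mul_nonneg (mul_nonneg (by linarith) (h6.le.trans h1))
          (Real.rpow_nonneg (hw z hz).le _)

end PhaseFunction

section Zones

variable {f G : ℝ → ℝ} {A B : ℕ} {r β : ℝ}

lemma exists_zone (hAB : A ≤ B) (hr : 0 < r) (hβ : 0 < β)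
    (hf : ∀ x y : ℝ, A ≤ x → x ≤ y → y ≤ B → r * (y - x) ≤ f y - f x) :
    ∃ A' B' : ℕ, A ≤ A' ∧ A' ≤ B' ∧ B' ≤ B ∧ (B' : ℝ) - A' ≤ 2 * β / r + 2 ∧
      (A < A' → ∀ x ∈ Set.Icc (A : ℝ) A', β ≤ -f x) ∧
      (B' < B → ∀ x ∈ Set.Icc (B' : ℝ) B, β ≤ f x) := by
  have hmono : ∀ x y : ℝ, A ≤ x → x ≤ y → y ≤ B → f x ≤ f y := fun x y h1 h2 h3 ↦ by
    have := hf x y h1 h2 h3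
    have := mul_nonneg hr.le (sub_nonneg.2 h2)
    linarith
  obtain ⟨A', hA1, hA2, hA3, hA4⟩ : ∃ A' : ℕ, A ≤ A' ∧ A' ≤ B ∧ (A < A' → f A' ≤ -β) ∧
      ∀ n : ℕ, A' < n → n ≤ B → -β < f n := by
    rcases ((Icc A B).filter fun n : ℕ ↦ f n ≤ -β).eq_empty_or_nonempty with h | h
    · refine ⟨A, le_rfl, hAB, fun h ↦ absurd h (lt_irrefl _), fun n h1 h2 ↦ ?_⟩
      by_contra! h3
      exact notMem_empty n (h ▸ mem_filter.2 ⟨mem_Icc.2 ⟨h1.le, h2⟩, h3⟩)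
    · have h1 := mem_filter.1 (max'_mem _ h)
      rw [mem_Icc] at h1
      refine ⟨_, h1.1.1, h1.1.2, fun _ ↦ h1.2, fun n h3 h4 ↦ ?_⟩
      by_contra! h5
      have := le_max' ((Icc A B).filter fun n : ℕ ↦ f n ≤ -β) n
        (mem_filter.2 ⟨mem_Icc.2 ⟨h1.1.1.trans h3.le, h4⟩, h5⟩)
      omega
  obtain ⟨B', hB1, hB2, hB3, hB4⟩ : ∃ B' : ℕ, A' ≤ B' ∧ B' ≤ B ∧ (B' < B → β ≤ f B') ∧
      ∀ n : ℕ, A' ≤ n → n < B' → f n < β := by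
    rcases ((Icc A' B).filter fun n : ℕ ↦ β ≤ f n).eq_empty_or_nonempty with h | h
    · refine ⟨B, hA2, le_rfl, fun h ↦ absurd h (lt_irrefl _), fun n h1 h2 ↦ ?_⟩
      by_contra! h3
      exact notMem_empty n (h ▸ mem_filter.2 ⟨mem_Icc.2 ⟨h1, h2.le⟩, h3⟩)
    · have h1 := mem_filter.1 (min'_mem _ h)
      rw [mem_Icc] at h1
      refine ⟨_, h1.1.1, h1.1.2, fun _ ↦ h1.2, fun n h3 h4 ↦ ?_⟩
      by_contra! h5
      have := min'_le ((Icc A' B).filter fun n : ℕ ↦ β ≤ f n) n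
        (mem_filter.2 ⟨mem_Icc.2 ⟨h3, h4.le.trans h1.1.2⟩, h5⟩)
      omega
  refine ⟨A', B', hA1, hB1, hB2, ?_, fun h x hx ↦ ?_, fun h x hx ↦ ?_⟩
  · rcases le_or_gt B' (A' + 1) with h | h
    · have : (B' : ℝ) ≤ A' + 1 := by exact_mod_cast h
      have : 0 < 2 * β / r := by positivity
      linarith
    · have h1 := hA4 (A' + 1) (by omega) (by omega)
      have h2 := hB4 (B' - 1) (by omega) (by omega)
      have h3 := hf ((A' + 1 : ℕ) : ℝ) ((B' - 1 : ℕ) : ℝ) (by exact_mod_cast (by omega))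
        (by exact_mod_cast (by omega)) (by exact_mod_cast (by omega))
      have h4 : r * (((B' - 1 : ℕ) : ℝ) - ((A' + 1 : ℕ) : ℝ)) ≤ 2 * β := by linarith
      rw [Nat.cast_sub (by omega)] at h4
      push_cast at h4
      rw [← sub_le_iff_le_add, le_div_iff₀ hr]
      linarith
  · have := hmono x A' hx.1 hx.2 (by exact_mod_cast hA2)
    have := hA3 h
    linarith
  · have := hmono B' x (by exact_mod_cast hA1.trans hB1) hx.1 hx.2
    have := hB3 h
    linarith

/-- The function stays away from zero on the set, with constant sign. -/
def AwayFromZero (f : ℝ → ℝ) (β : ℝ) (s : Set ℝ) : Prop :=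
  (∀ x ∈ s, β ≤ f x) ∨ ∀ x ∈ s, β ≤ -f x

lemma AwayFromZero.mono {s t : Set ℝ} (h : AwayFromZero f β s) (hts : t ⊆ s) :
    AwayFromZero f β t :=
  h.imp (fun h x hx ↦ h x (hts hx)) fun h x hx ↦ h x (hts hx)

lemma norm_sum_le_of_zone_aux {a : ℕ → ℂ} {M R : ℝ} (hAB : A ≤ B) (hr : 0 < r) (hβ : 0 < β)
    (hf : ∀ x y : ℝ, A ≤ x → x ≤ y → y ≤ B → r * (y - x) ≤ f y - f x) (hM : 0 ≤ M)
    (ha : ∀ n ≤ B, ‖a n‖ ≤ M) (hR : 0 ≤ R)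
    (hgood : ∀ A₁ B₁ : ℕ, A ≤ A₁ → A₁ ≤ B₁ → B₁ ≤ B → AwayFromZero f β (Set.Icc A₁ B₁) →
      ‖∑ n ∈ Ioc A₁ B₁, a n‖ ≤ R) :
    ‖∑ n ∈ Ioc A B, a n‖ ≤ 2 * R + M * (2 * β / r + 2) := by
  obtain ⟨A', B', h1, h2, h3, h4, h5, h6⟩ := exists_zone hAB hr hβ hf
  have e1 : ∑ n ∈ Ioc A B, a n =
      ∑ n ∈ Ioc A A', a n + ∑ n ∈ Ioc A' B', a n + ∑ n ∈ Ioc B' B, a n := by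
    rw [sum_Ioc_consecutive a h1 h2, sum_Ioc_consecutive a (h1.trans h2) h3]
  have b1 : ‖∑ n ∈ Ioc A A', a n‖ ≤ R := by
    rcases h1.eq_or_lt with h | h
    · simpa [h] using hR
    · exact hgood _ _ le_rfl h1 (h2.trans h3) (Or.inr (h5 h))
  have b2 : ‖∑ n ∈ Ioc B' B, a n‖ ≤ R := by
    rcases h3.eq_or_lt with h | h
    · simpa [h] using hR
    · exact hgood _ _ (h1.trans h2) h3 le_rfl (Or.inl (h6 h))
  have b3 : ‖∑ n ∈ Ioc A' B', a n‖ ≤ M * (2 * β / r + 2) := by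
    calc _ ≤ ∑ n ∈ Ioc A' B', M := norm_sum_le_of_le _ fun n hn ↦ ha n (by
          rw [mem_Ioc] at hn; omega)
      _ = M * (B' - A') := by
          rw [sum_const, Nat.card_Ioc, nsmul_eq_mul, Nat.cast_sub h2, mul_comm]
      _ ≤ _ := by gcongr
  rw [e1]
  refine (norm_add₃_le).trans ?_
  linarith

/-- Removing the neighbourhood of the zero of `a₀ - θ G` from a range of summation. -/
lemma norm_sum_le_of_zone {a : ℕ → ℂ} {M R a₀ θ ρ : ℝ} (hAB : A ≤ B) (hθ : θ ≠ 0) (hρ : 0 < ρ)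
    (hβ : 0 < β) (hG : ∀ x y : ℝ, A ≤ x → x ≤ y → y ≤ B → ρ * (y - x) ≤ G y - G x) (hM : 0 ≤ M)
    (ha : ∀ n ≤ B, ‖a n‖ ≤ M) (hR : 0 ≤ R)
    (hgood : ∀ A₁ B₁ : ℕ, A ≤ A₁ → A₁ ≤ B₁ → B₁ ≤ B →
      AwayFromZero (fun x ↦ a₀ - θ * G x) β (Set.Icc A₁ B₁) → ‖∑ n ∈ Ioc A₁ B₁, a n‖ ≤ R) :
    ‖∑ n ∈ Ioc A B, a n‖ ≤ 2 * R + M * (2 * β / (|θ| * ρ) + 2) := by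
  rcases hθ.lt_or_gt with h | h
  · refine norm_sum_le_of_zone_aux (f := fun x ↦ a₀ - θ * G x) hAB
      (mul_pos (abs_pos.2 hθ) hρ) hβ (fun x y h1 h2 h3 ↦ ?_) hM ha hR hgood
    rw [abs_of_neg h]
    have := mul_le_mul_of_nonneg_left (hG x y h1 h2 h3) (neg_pos.2 h).le
    linarith
  · refine norm_sum_le_of_zone_aux (f := fun x ↦ -(a₀ - θ * G x)) hAB
      (mul_pos (abs_pos.2 hθ) hρ) hβ (fun x y h1 h2 h3 ↦ ?_) hM ha hR
      fun A₁ B₁ h1 h2 h3 h4 ↦ hgood A₁ B₁ h1 h2 h3 ?_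
    · rw [abs_of_pos h]
      have := mul_le_mul_of_nonneg_left (hG x y h1 h2 h3) h.le
      linarith
    · exact h4.symm.imp (fun h x hx ↦ by simpa using h x hx) fun h x hx ↦ by simpa using h x hx

end Zones

section PhaseBounds

variable {c V X x j θ β D A B : ℝ}

lemma rpow_eq_of_root_eq (hc : 0 < c) (hV : 0 < V) (hVX : V ^ (1 / c) = 10 ^ 9 * X) :
    V = (10 ^ 9 * X) ^ c := by
  rw [← hVX, ← Real.rpow_mul hV.le, one_div_mul_cancel hc.ne', Real.rpow_one]

lemma rpow_le_half_of_root_eq (hc : 1 ≤ c) (hX : 0 < X) (hV : 0 < V)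
    (hVX : V ^ (1 / c) = 10 ^ 9 * X) (hx : 0 ≤ x) (hx' : x ≤ 2 * X) : x ^ c ≤ V / 2 := by
  have h1 : V = (10 ^ 9 * X) ^ c := rpow_eq_of_root_eq (by linarith) hV hVX
  have h2 : (2 : ℝ) ≤ 2 ^ c := by
    calc (2 : ℝ) = 2 ^ (1 : ℝ) := (Real.rpow_one 2).symm
      _ ≤ 2 ^ c := Real.rpow_le_rpow_of_exponent_le (by norm_num) hc
  have h3 : 2 ^ c * x ^ c ≤ V := by
    rw [h1, ← Real.mul_rpow (by norm_num) hx]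
    exact Real.rpow_le_rpow (by positivity) (by linarith) (by linarith)
  have := Real.rpow_nonneg hx c
  nlinarith

lemma root_sub_one_le (hc : 1 ≤ c) (hX : 0 < X) (hV : 0 < V)
    (hVX : V ^ (1 / c) = 10 ^ 9 * X) : V ^ (1 / c - 1) ≤ X ^ (1 - c) := by
  have h0 : 1 / c - 1 = 1 / c * (1 - c) := by
    have : c ≠ 0 := by linarith
    field_simp
  rw [h0, Real.rpow_mul hV.le, hVX]
  exact Real.rpow_le_rpow_of_nonpos hX (by linarith) (by linarith)

lemma half_rpow_le (hV : 0 < V) {a w : ℝ} (ha : a ≤ 0) (n : ℕ) (hn : -a ≤ n) (hw : V / 2 ≤ w) :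
    w ^ a ≤ 2 ^ n * V ^ a := by
  have h1 : w ^ a ≤ (V / 2) ^ a := Real.rpow_le_rpow_of_nonpos (by positivity) hw ha
  have h2 : (V / 2) ^ a = 2 ^ (-a) * V ^ a := by
    rw [Real.div_rpow hV.le (by norm_num), Real.rpow_neg (by norm_num)]
    ring
  have h3 : (2 : ℝ) ^ (-a) ≤ 2 ^ n := by
    rw [← Real.rpow_natCast]
    exact Real.rpow_le_rpow_of_exponent_le (by norm_num) hn
  rw [h2] at h1
  exact h1.trans (mul_le_mul_of_nonneg_right h3 (Real.rpow_nonneg hV.le _))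

lemma factor₂_bounds (hc : 1 ≤ c) (hX : 0 < X) (hV : 0 < V)
    (hVX : V ^ (1 / c) = 10 ^ 9 * X) (hx : 0 ≤ x) (hx' : x ≤ 2 * X) :
    0 ≤ factor₂ c V x ∧ factor₂ c V x ≤ 16 * X ^ (1 - c) := by
  have h1 := rpow_le_half_of_root_eq hc hX hV hVX hx hx'
  have h2 : V / 2 ≤ V - x ^ c := by linarith
  have hc0 : 0 < 1 / c := by positivity
  have hc1 : 1 / c ≤ 1 := by rw [div_le_one (by linarith)]; exact hc
  refine ⟨mul_nonneg hV.le (Real.rpow_nonneg (by linarith) _), ?_⟩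
  have h3 := half_rpow_le hV (a := 1 / c - 2) (by linarith) 2 (by norm_num; linarith) h2
  have h4 : V ^ (1 / c - 1) = V * V ^ (1 / c - 2) := by
    rw [mul_comm, ← Real.rpow_add_one hV.ne']; congr 1; ring
  have h5 := root_sub_one_le hc hX hV hVX
  have h6 := Real.rpow_nonneg hV.le (1 / c - 1)
  calc factor₂ c V x ≤ V * (2 ^ 2 * V ^ (1 / c - 2)) := mul_le_mul_of_nonneg_left h3 hV.le
    _ = 4 * V ^ (1 / c - 1) := by rw [h4]; ring
    _ ≤ _ := by linarith

lemma factor₃_bounds (hc : 1 ≤ c) (hX : 0 < X) (hV : 0 < V)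
    (hVX : V ^ (1 / c) = 10 ^ 9 * X) (hx : 0 ≤ x) (hx' : x ≤ 2 * X) :
    0 ≤ factor₃ c V x ∧ factor₃ c V x ≤ 16 * X ^ (1 - c) := by
  have h1 := rpow_le_half_of_root_eq hc hX hV hVX hx hx'
  have h2 : V / 2 ≤ V - x ^ c := by linarith
  have hc0 : 0 < 1 / c := by positivity
  have hc1 : 1 / c ≤ 1 := by rw [div_le_one (by linarith)]; exact hc
  have hxc := Real.rpow_nonneg hx c
  have h7 : 0 ≤ V + (1 - 1 / c) * x ^ c :=
    add_nonneg hV.le (mul_nonneg (by linarith) hxc)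
  have h8 : V + (1 - 1 / c) * x ^ c ≤ 2 * V := by nlinarith
  refine ⟨mul_nonneg hV.le (mul_nonneg (Real.rpow_nonneg (by linarith) _) h7), ?_⟩
  have h3 := half_rpow_le hV (a := 1 / c - 3) (by linarith) 3 (by norm_num; linarith) h2
  have h4 : V ^ (1 / c - 1) = V * (V ^ (1 / c - 3) * V) := by
    rw [← Real.rpow_add_one hV.ne', mul_comm, ← Real.rpow_add_one hV.ne']; congr 1; ring
  have h5 := root_sub_one_le hc hX hV hVX
  calc factor₃ c V x ≤ V * (2 ^ 3 * V ^ (1 / c - 3) * (2 * V)) :=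
        mul_le_mul_of_nonneg_left (mul_le_mul h3 h8 h7 (by positivity)) hV.le
    _ = 16 * V ^ (1 / c - 1) := by rw [h4]; ring
    _ ≤ _ := by linarith

lemma abs_sub_mul_le {F T : ℝ} (hc : 0 < c) (hD : |j| * c + |θ| * T ≤ D)
    (hF : 0 ≤ F) (hF' : F ≤ T) : |j * c - θ * F| ≤ D := by
  refine (abs_sub _ _).trans (le_trans ?_ hD)
  rw [abs_mul, abs_mul, abs_of_pos hc, abs_of_nonneg hF]
  gcongr

lemma phase_powPhase (hc : 1 < c) (hc2 : c ≤ 2) (hX : 0 < X) (hV : 0 < V)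
    (hVX : V ^ (1 / c) = 10 ^ 9 * X) (hA : X ≤ A) (hB : B ≤ 2 * X) (hβ : 0 < β) (hβD : β ≤ D)
    (hD : |j| * c + |θ| * (16 * X ^ (1 - c)) ≤ D)
    (h₂ : AwayFromZero (fun x ↦ j * c - θ * factor₂ c V x) β (Set.Icc A B))
    (h₃ : AwayFromZero (fun x ↦ j * c - θ * factor₃ c V x) β (Set.Icc A B)) :
    Phase (powPhase c V j θ) (powPhase₁ c V j θ) (powPhase₂ c V j θ) (powPhase₃ c V j θ) A B
      ((c - 1) / 2 * X ^ (c - 2) * β) ((c - 1) * X ^ (c - 2) * D)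
      ((c - 1) * X ^ (c - 1) * β) (4 * (c - 1) * X ^ (c - 1) * D) := by
  have hc0 : 0 < c := by linarith
  have hc1 : 0 < c - 1 := by linarith
  have hxpos : ∀ x ∈ Set.Icc A B, 0 < x := fun x hx ↦ by linarith [hx.1]
  have hw : ∀ x ∈ Set.Icc A B, 0 < V - x ^ c := fun x hx ↦ by
    have := rpow_le_half_of_root_eq hc.le hX hV hVX (hxpos x hx).le (hx.2.trans hB)
    linarith
  have hX2 : 0 < X ^ (c - 2) := Real.rpow_pos_of_pos hX _
  have hX1 : 0 < X ^ (c - 1) := Real.rpow_pos_of_pos hX _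
  have hx2 : ∀ x ∈ Set.Icc A B, X ^ (c - 2) / 2 ≤ x ^ (c - 2) ∧ x ^ (c - 2) ≤ X ^ (c - 2) := by
    intro x hx
    refine ⟨?_, Real.rpow_le_rpow_of_nonpos hX (by linarith [hx.1]) (by linarith)⟩
    have h1 : (2 * X) ^ (c - 2) ≤ x ^ (c - 2) :=
      Real.rpow_le_rpow_of_nonpos (hxpos x hx) (by linarith [hx.2]) (by linarith)
    have h2 : (2 : ℝ) ^ (-1 : ℝ) ≤ 2 ^ (c - 2) :=
      Real.rpow_le_rpow_of_exponent_le (by norm_num) (by linarith)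
    rw [Real.mul_rpow (by norm_num) hX.le] at h1
    rw [Real.rpow_neg_one] at h2
    nlinarith
  have hx1 : ∀ x ∈ Set.Icc A B, X ^ (c - 1) ≤ x ^ (c - 1) ∧ x ^ (c - 1) ≤ 2 * X ^ (c - 1) := by
    intro x hx
    refine ⟨Real.rpow_le_rpow hX.le (by linarith [hx.1]) hc1.le, ?_⟩
    have h1 : x ^ (c - 1) ≤ (2 * X) ^ (c - 1) :=
      Real.rpow_le_rpow (hxpos x hx).le (by linarith [hx.2]) hc1.le
    have h2 : (2 : ℝ) ^ (c - 1) ≤ 2 ^ (1 : ℝ) :=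
      Real.rpow_le_rpow_of_exponent_le (by norm_num) (by linarith)
    rw [Real.mul_rpow (by norm_num) hX.le] at h1
    rw [Real.rpow_one] at h2
    nlinarith
  have hup2 : ∀ x ∈ Set.Icc A B, |j * c - θ * factor₂ c V x| ≤ D := fun x hx ↦ by
    obtain ⟨h1, h2⟩ := factor₂_bounds hc.le hX hV hVX (hxpos x hx).le (hx.2.trans hB)
    exact abs_sub_mul_le hc0 hD h1 h2
  have hup3 : ∀ x ∈ Set.Icc A B, |j * c - θ * factor₃ c V x| ≤ D := fun x hx ↦ by
    obtain ⟨h1, h2⟩ := factor₃_bounds hc.le hX hV hVX (hxpos x hx).le (hx.2.trans hB)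
    exact abs_sub_mul_le hc0 hD h1 h2
  have hmul2 : ∀ x ∈ Set.Icc A B, ∀ y, β ≤ y → y ≤ D →
      (c - 1) / 2 * X ^ (c - 2) * β ≤ (c - 1) * x ^ (c - 2) * y ∧
      (c - 1) * x ^ (c - 2) * y ≤ (c - 1) * X ^ (c - 2) * D := by
    intro x hx y h1 h2
    obtain ⟨h3, h4⟩ := hx2 x hx
    have hx0 := Real.rpow_pos_of_pos (hxpos x hx) (c - 2)
    constructor
    · calc (c - 1) / 2 * X ^ (c - 2) * β = (c - 1) * (X ^ (c - 2) / 2) * β := by ring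
        _ ≤ _ := by gcongr
    · have : 0 ≤ y := hβ.le.trans h1
      gcongr
  have hmul3 : ∀ x ∈ Set.Icc A B, ∀ y, β ≤ y → y ≤ D →
      (c - 1) * X ^ (c - 1) * β ≤ c * (c - 1) * x ^ (c - 1) * y ∧
      c * (c - 1) * x ^ (c - 1) * y ≤ 4 * (c - 1) * X ^ (c - 1) * D := by
    intro x hx y h1 h2
    obtain ⟨h3, h4⟩ := hx1 x hx
    have hx0 := Real.rpow_pos_of_pos (hxpos x hx) (c - 1)
    have : 0 ≤ y := hβ.le.trans h1
    constructor
    · calc (c - 1) * X ^ (c - 1) * β = 1 * (c - 1) * X ^ (c - 1) * β := by ring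
        _ ≤ _ := by gcongr
    · calc c * (c - 1) * x ^ (c - 1) * y ≤ 2 * (c - 1) * (2 * X ^ (c - 1)) * D := by gcongr
        _ = _ := by ring
  refine ⟨fun x hx ↦ hasDerivAt_powPhase hc0 (hxpos x hx) (hw x hx),
    fun x hx ↦ hasDerivAt_powPhase₁ hc0 (hxpos x hx) (hw x hx),
    fun x hx ↦ hasDerivAt_sq_mul_powPhase₂ hc0 (hxpos x hx) (hw x hx), ?_, ?_,
    by positivity, ?_, by positivity, ?_⟩
  · refine h₂.imp (fun h x hx ↦ hmul2 x hx _ (h x hx) ((le_abs_self _).trans (hup2 x hx)))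
      fun h x hx ↦ ?_
    have := hmul2 x hx _ (h x hx) ((neg_le_abs _).trans (hup2 x hx))
    rwa [mul_neg] at this
  · refine h₃.imp (fun h x hx ↦ hmul3 x hx _ (h x hx) ((le_abs_self _).trans (hup3 x hx)))
      fun h x hx ↦ ?_
    have := hmul3 x hx _ (h x hx) ((neg_le_abs _).trans (hup3 x hx))
    rwa [mul_neg] at this
  · have : 0 < D := hβ.trans_le hβD
    gcongr
    linarith
  · have : 0 < D := hβ.trans_le hβD
    gcongr
    linarith

end PhaseBounds

section

open Filter

section Exponents

lemma eventually_mul_rpow_le (C : ℝ) {a b : ℝ} (hab : a < b) :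
    ∀ᶠ X : ℝ in atTop, C * X ^ a ≤ X ^ b := by
  filter_upwards [(tendsto_rpow_atTop (sub_pos.2 hab)).eventually_ge_atTop C,
    eventually_gt_atTop 0] with X h1 h2
  calc C * X ^ a ≤ X ^ (b - a) * X ^ a :=
        mul_le_mul_of_nonneg_right h1 (Real.rpow_nonneg h2.le _)
    _ = X ^ b := by rw [← Real.rpow_add h2]; congr 1; ring

lemma eventually_log_two_mul_le {ε : ℝ} (hε : 0 < ε) :
    ∀ᶠ X : ℝ in atTop, Real.log (2 * X) ≤ X ^ ε := by
  filter_upwards [eventually_mul_rpow_le (2 ^ (ε / 2) / (ε / 2)) (half_lt_self hε),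
    eventually_gt_atTop 0] with X h1 h2
  refine (Real.log_le_rpow_div (by positivity) (half_pos hε)).trans (le_trans (le_of_eq ?_) h1)
  rw [Real.mul_rpow (by norm_num) h2.le]
  ring

variable {s X : ℝ}

lemma sqrt_rpow (hX : 0 ≤ X) (a : ℝ) : √(X ^ a) = X ^ (a / 2) := by
  rw [Real.sqrt_eq_rpow, ← Real.rpow_mul hX]; congr 1; ring

/-- The block condition holds for the parameters coming from `powPhase`. -/
lemma eventually_blockCondition (hs : 0 < s) (hs2 : s < 3 / 79) :
    ∀ᶠ X : ℝ in atTop, ∀ Q : ℕ, (Q : ℝ) ≤ X ^ (2 * s + 1 / 100) →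
      BlockCondition (s * X ^ s * X ^ (-2 * s - 4 / 1000))
        (4 * s * X ^ s * (32 * X ^ (s + 2 / 1000))) Q √(X / 2) := by
  filter_upwards [eventually_ge_atTop 1,
    eventually_mul_rpow_le (5 * 514 * 2 * √(4 / s))
      (a := 3 / 2 * (2 * s + 1 / 100) + (2 * s + 2 / 1000) + (s + 4 / 1000 - 1 / 2) / 2)
      (b := 0) (by linarith),
    eventually_mul_rpow_le (5 * 514 * 2 * 2)
      (a := 2 * (2 * s + 1 / 100) + (2 * s + 2 / 1000) - 1 / 2) (b := 0) (by linarith)]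
    with X hX h1 h2 Q hQ
  have hX0 : 0 < X := by linarith
  rw [Real.rpow_zero] at h1 h2
  set q := 2 * s + 1 / 100 with hq
  have hG : 4 * s * X ^ s * (32 * X ^ (s + 2 / 1000)) ≤ 128 * X ^ (2 * s + 2 / 1000) := by
    have : X ^ s * X ^ (s + 2 / 1000) = X ^ (2 * s + 2 / 1000) := by
      rw [← Real.rpow_add hX0]; congr 1; ring
    calc _ = 128 * s * (X ^ s * X ^ (s + 2 / 1000)) := by ring
      _ ≤ 128 * 1 * (X ^ s * X ^ (s + 2 / 1000)) := by gcongr; linarith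
      _ = _ := by rw [this, mul_one]
  set G := 4 * s * X ^ s * (32 * X ^ (s + 2 / 1000))
  have hG0 : 0 ≤ G := by positivity
  have hg : s * X ^ s * X ^ (-2 * s - 4 / 1000) = s * X ^ (-s - 4 / 1000) := by
    rw [mul_assoc, ← Real.rpow_add hX0]; congr 2; ring
  rw [hg]
  have hM : X ^ (1 / 2 : ℝ) / 2 ≤ √(X / 2) := by
    rw [← Real.sqrt_eq_rpow]
    refine Real.le_sqrt_of_sq_le ?_
    rw [div_pow, Real.sq_sqrt hX0.le]
    linarith
  have hM0 : 0 < X ^ (1 / 2 : ℝ) / 2 := by positivity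
  set M := √(X / 2)
  have hsq : √(2 / (s * X ^ (-s - 4 / 1000) * M)) ≤
      √(4 / s) * X ^ ((s + 4 / 1000 - 1 / 2) / 2) := by
    rw [← sqrt_rpow hX0.le, ← Real.sqrt_mul (by positivity)]
    refine Real.sqrt_le_sqrt ?_
    calc 2 / (s * X ^ (-s - 4 / 1000) * M) ≤
          2 / (s * X ^ (-s - 4 / 1000) * (X ^ (1 / 2 : ℝ) / 2)) := by gcongr
      _ = 4 / s * X ^ (s + 4 / 1000 - 1 / 2) := by
          have e1 : X ^ (s + 4 / 1000 - 1 / 2) = (X ^ (-s - 4 / 1000))⁻¹ * (X ^ (1 / 2 : ℝ))⁻¹ := by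
            rw [← Real.rpow_neg hX0.le, ← Real.rpow_neg hX0.le, ← Real.rpow_add hX0]
            congr 1; ring
          rw [e1]
          field_simp
          norm_num
  have hone : ∀ a : ℝ, 0 ≤ a → 1 ≤ X ^ a := fun a ha ↦ Real.one_le_rpow hX ha
  have hQs : √(Q : ℝ) ≤ X ^ (q / 2) := by
    rw [← sqrt_rpow hX0.le]; exact Real.sqrt_le_sqrt hQ
  have hA1 : 4 * √(Q : ℝ) * G + 2 ≤ 514 * X ^ (q / 2 + (2 * s + 2 / 1000)) := by
    have h3 := hone (q / 2 + (2 * s + 2 / 1000)) (by rw [hq]; positivity)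
    rw [Real.rpow_add hX0] at h3 ⊢
    have : 4 * √(Q : ℝ) * G ≤ 4 * X ^ (q / 2) * (128 * X ^ (2 * s + 2 / 1000)) := by gcongr
    linarith
  have hA2 : 4 * (Q : ℝ) * G + 2 ≤ 514 * X ^ (q + (2 * s + 2 / 1000)) := by
    have h3 := hone (q + (2 * s + 2 / 1000)) (by rw [hq]; positivity)
    rw [Real.rpow_add hX0] at h3 ⊢
    have : 4 * (Q : ℝ) * G ≤ 4 * X ^ q * (128 * X ^ (2 * s + 2 / 1000)) := by gcongr
    linarith
  unfold BlockCondition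
  calc (Q : ℝ) * (5 * ((4 * √(Q : ℝ) * G + 2) * √(2 / (s * X ^ (-s - 4 / 1000) * M)) +
        (4 * Q * G + 2) / M)) ≤ X ^ q * (5 * ((514 * X ^ (q / 2 + (2 * s + 2 / 1000))) *
        (√(4 / s) * X ^ ((s + 4 / 1000 - 1 / 2) / 2)) +
        (514 * X ^ (q + (2 * s + 2 / 1000))) / (X ^ (1 / 2 : ℝ) / 2))) := by gcongr
    _ = 5 * 514 * √(4 / s) * (X ^ q * X ^ (q / 2 + (2 * s + 2 / 1000)) *
          X ^ ((s + 4 / 1000 - 1 / 2) / 2)) +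
        5 * 514 * 2 * (X ^ q * X ^ (q + (2 * s + 2 / 1000)) * (X ^ (1 / 2 : ℝ))⁻¹) := by
        field_simp
    _ = 5 * 514 * √(4 / s) * X ^ (3 / 2 * q + (2 * s + 2 / 1000) + (s + 4 / 1000 - 1 / 2) / 2) +
        5 * 514 * 2 * X ^ (2 * q + (2 * s + 2 / 1000) - 1 / 2) := by
        rw [← Real.rpow_neg hX0.le, ← Real.rpow_add hX0, ← Real.rpow_add hX0,
          ← Real.rpow_add hX0, ← Real.rpow_add hX0]
        congr 3 <;> ring
    _ ≤ 1 := by linarith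

/-- The type I contribution is negligible. -/
lemma eventually_typeI_le (hs : 0 < s) (hs2 : s < 3 / 79) :
    ∀ᶠ X : ℝ in atTop, ∀ U : ℕ, (U : ℝ) ≤ X ^ (1 / 10 : ℝ) →
      10 * Real.log (2 * X) * U ^ 2 *
        (2 * X * (s * X ^ (s - 1) * (32 * X ^ (s + 2 / 1000))) /
            √(s / 2 * X ^ (s - 1) * X ^ (-2 * s - 4 / 1000)) +
          2 * X * U ^ 2 * (s * X ^ (s - 1) * (32 * X ^ (s + 2 / 1000))) +
          2 / √(s / 2 * X ^ (s - 1) * X ^ (-2 * s - 4 / 1000)) + 2) ≤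
      X ^ (1 - s - 3 / 1000) := by
  filter_upwards [eventually_ge_atTop 1, eventually_log_two_mul_le (ε := 1 / 100) (by norm_num),
    eventually_mul_rpow_le (10 * (64 * √(2 / s) + 64 + 2 * √(2 / s) + 2))
      (a := 1 / 100 + 1 / 5 + (504 / 1000 + 5 / 2 * s)) (b := 1 - s - 3 / 1000) (by linarith)]
    with X hX hlog h1 U hU
  have hX0 : 0 < X := by linarith
  have hlog0 : 0 ≤ Real.log (2 * X) := Real.log_nonneg (by linarith)
  set L := s * X ^ (s - 1) * (32 * X ^ (s + 2 / 1000))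
  have hL0 : 0 ≤ L := by positivity
  have hXL : X * L ≤ 32 * X ^ (2 * s + 2 / 1000) := by
    have e1 : X ^ (2 * s + 2 / 1000) = X * (X ^ (s - 1) * X ^ (s + 2 / 1000)) := by
      rw [← Real.rpow_add hX0, mul_comm X, ← Real.rpow_add_one hX0.ne']; congr 1; ring
    calc X * L = 32 * s * (X * (X ^ (s - 1) * X ^ (s + 2 / 1000))) := by ring
      _ ≤ 32 * 1 * (X * (X ^ (s - 1) * X ^ (s + 2 / 1000))) := by gcongr; linarith
      _ = _ := by rw [e1, mul_one]
  have hl : 1 / √(s / 2 * X ^ (s - 1) * X ^ (-2 * s - 4 / 1000)) =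
      √(2 / s) * X ^ (502 / 1000 + s / 2) := by
    rw [show (502 / 1000 + s / 2 : ℝ) = (1 + s + 4 / 1000) / 2 by ring, ← sqrt_rpow hX0.le,
      ← Real.sqrt_mul (by positivity), one_div, ← Real.sqrt_inv]
    congr 1
    rw [mul_assoc, ← Real.rpow_add hX0, mul_inv, ← Real.rpow_neg hX0.le]
    congr 1
    · field_simp
    · congr 1; ring
  have hU2 : (U : ℝ) ^ 2 ≤ X ^ (1 / 5 : ℝ) := by
    calc (U : ℝ) ^ 2 ≤ (X ^ (1 / 10 : ℝ)) ^ 2 := by gcongr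
      _ = X ^ (1 / 5 : ℝ) := by rw [← Real.rpow_mul_natCast hX0.le]; norm_num
  have hle : ∀ {a b : ℝ}, a ≤ b → X ^ a ≤ X ^ b := fun h ↦ Real.rpow_le_rpow_of_exponent_le hX h
  set Z := X ^ (504 / 1000 + 5 / 2 * s) with hZ
  have t1 : 2 * X * L / √(s / 2 * X ^ (s - 1) * X ^ (-2 * s - 4 / 1000)) ≤
      64 * √(2 / s) * Z := by
    calc 2 * X * L / √(s / 2 * X ^ (s - 1) * X ^ (-2 * s - 4 / 1000)) =
          2 * (X * L) * (1 / √(s / 2 * X ^ (s - 1) * X ^ (-2 * s - 4 / 1000))) := by ring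
      _ ≤ 2 * (32 * X ^ (2 * s + 2 / 1000)) * (√(2 / s) * X ^ (502 / 1000 + s / 2)) := by
          rw [hl]; gcongr
      _ = 64 * √(2 / s) * (X ^ (2 * s + 2 / 1000) * X ^ (502 / 1000 + s / 2)) := by ring
      _ = _ := by rw [← Real.rpow_add hX0, hZ]; congr 2; ring
  have t2 : 2 * X * U ^ 2 * L ≤ 64 * Z := by
    calc 2 * X * U ^ 2 * L = 2 * (X * L) * U ^ 2 := by ring
      _ ≤ 2 * (32 * X ^ (2 * s + 2 / 1000)) * X ^ (1 / 5 : ℝ) := by gcongr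
      _ = 64 * X ^ (2 * s + 2 / 1000 + 1 / 5) := by
          rw [Real.rpow_add hX0 (2 * s + 2 / 1000)]; ring
      _ ≤ _ := by rw [hZ]; gcongr 64 * ?_; exact hle (by linarith)
  have t3 : 2 / √(s / 2 * X ^ (s - 1) * X ^ (-2 * s - 4 / 1000)) ≤ 2 * √(2 / s) * Z := by
    rw [div_eq_mul_one_div, hl, mul_assoc, hZ]
    gcongr 2 * (√(2 / s) * ?_)
    exact hle (by linarith)
  have t4 : 2 ≤ 2 * Z := by
    have : 1 ≤ Z := Real.one_le_rpow hX (by linarith)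
    linarith
  calc _ ≤ 10 * X ^ (1 / 100 : ℝ) * X ^ (1 / 5 : ℝ) *
        (64 * √(2 / s) * Z + 64 * Z + 2 * √(2 / s) * Z + 2 * Z) := by gcongr
    _ = 10 * (64 * √(2 / s) + 64 + 2 * √(2 / s) + 2) *
        X ^ (1 / 100 + 1 / 5 + (504 / 1000 + 5 / 2 * s)) := by
        rw [Real.rpow_add hX0, Real.rpow_add hX0]; ring
    _ ≤ _ := h1

/-- The type II contribution saves a power over the main term. -/
lemma eventually_typeII_le (C : ℝ) (hC : 0 ≤ C) :
    ∀ᶠ X : ℝ in atTop, ∀ Q : ℕ, X ^ (2 * s + 1 / 100) / 2 ≤ Q →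
      6 * Real.log (2 * X) * (C * X ^ (5 / 10000 : ℝ)) * (X / √Q) * (1 + Real.log (2 * X)) ≤
      X ^ (1 - s - 3 / 1000) := by
  filter_upwards [eventually_ge_atTop 1,
    eventually_log_two_mul_le (ε := 2 / 10000) (by norm_num),
    eventually_mul_rpow_le (6 * C * √2 * 2) (a := 1 - s - 41 / 10000) (b := 1 - s - 3 / 1000)
      (by linarith)] with X hX hlog h1 Q hQ
  have hX0 : 0 < X := by linarith
  have hlog0 : 0 ≤ Real.log (2 * X) := Real.log_nonneg (by linarith)
  have hone : 1 ≤ X ^ (2 / 10000 : ℝ) := Real.one_le_rpow hX (by norm_num)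
  have hQ' : X / √Q ≤ √2 * X ^ (1 - s - 5 / 1000) := by
    have h2 : 0 < X ^ (2 * s + 1 / 100) / 2 := by positivity
    have h3 : X ^ (s + 5 / 1000) / √2 ≤ √Q := by
      refine le_trans (le_of_eq ?_) (Real.sqrt_le_sqrt hQ)
      rw [Real.sqrt_div (by positivity), sqrt_rpow hX0.le]
      congr 2; ring
    calc X / √Q ≤ X / (X ^ (s + 5 / 1000) / √2) := by gcongr
      _ = √2 * (X * (X ^ (s + 5 / 1000))⁻¹) := by field_simp
      _ = √2 * X ^ (1 - s - 5 / 1000) := by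
          rw [← Real.rpow_neg hX0.le, mul_comm X, ← Real.rpow_add_one hX0.ne']
          congr 2; ring
  calc _ ≤ 6 * X ^ (2 / 10000 : ℝ) * (C * X ^ (5 / 10000 : ℝ)) * (√2 * X ^ (1 - s - 5 / 1000)) *
        (X ^ (2 / 10000 : ℝ) + X ^ (2 / 10000 : ℝ)) := by gcongr
    _ = 6 * C * √2 * 2 * (X ^ (2 / 10000 : ℝ) * X ^ (5 / 10000 : ℝ) * X ^ (1 - s - 5 / 1000) *
        X ^ (2 / 10000 : ℝ)) := by ring
    _ = 6 * C * √2 * 2 * X ^ (1 - s - 41 / 10000) := by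
        rw [← Real.rpow_add hX0, ← Real.rpow_add hX0, ← Real.rpow_add hX0]
        congr 2; ring
    _ ≤ _ := h1

end Exponents

end

section

open Filter ArithmeticFunction

section ExponentialSum

lemma exists_floor_rpow {X a : ℝ} (hX : 1 ≤ X) (ha : 0 ≤ a) :
    0 < ⌊X ^ a⌋₊ ∧ X ^ a / 2 ≤ ⌊X ^ a⌋₊ ∧ (⌊X ^ a⌋₊ : ℝ) ≤ X ^ a := by
  have h1 : 1 ≤ X ^ a := Real.one_le_rpow hX ha
  have h2 : 0 < ⌊X ^ a⌋₊ := Nat.floor_pos.2 h1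
  have h3 : (1 : ℝ) ≤ ⌊X ^ a⌋₊ := by exact_mod_cast h2
  refine ⟨h2, ?_, Nat.floor_le (by linarith)⟩
  have := Nat.lt_floor_add_one (X ^ a)
  linarith

variable {c : ℝ}

lemma eventually_norm_sum_le_of_awayFromZero (hc : 1 < c) (hc2 : c < 82 / 79) :
    ∀ᶠ X : ℝ in atTop, ∀ V : ℝ, 0 < V → V ^ (1 / c) = 10 ^ 9 * X → ∀ j θ : ℝ,
      |j| ≤ X ^ (c - 1 + 2 / 1000) → |θ| ≤ X ^ (2 * (c - 1) + 2 / 1000) →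
      ∀ A B : ℕ, X ≤ A → B ≤ 2 * X →
      AwayFromZero (fun x ↦ j * c - θ * factor₂ c V x) (X ^ (-2 * (c - 1) - 4 / 1000))
        (Set.Icc A B) →
      AwayFromZero (fun x ↦ j * c - θ * factor₃ c V x) (X ^ (-2 * (c - 1) - 4 / 1000))
        (Set.Icc A B) →
      ‖∑ n ∈ Ioc A B, (vonMangoldt n : ℂ) * e (powPhase c V j θ n)‖ ≤
        X ^ (1 - (c - 1) - 3 / 1000) + X ^ (1 - (c - 1) - 3 / 1000) := by
  have hs : 0 < c - 1 := by linarith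
  have hs2 : c - 1 < 3 / 79 := by linarith
  obtain ⟨C, hC1, hC⟩ := exists_card_divisors_le (ε := 5 / 10000) (by norm_num)
  filter_upwards [eventually_ge_atTop 1, eventually_blockCondition hs hs2,
    eventually_typeI_le hs hs2,
    eventually_typeII_le (s := c - 1) (C * 2 ^ (5 / 10000 : ℝ)) (by positivity)]
    with X hX hblock hI hII V hV hVX j θ hj hθ A B hA hB h₂ h₃
  have hX0 : 0 < X := by linarith
  have hle : ∀ {a b : ℝ}, a ≤ b → X ^ a ≤ X ^ b := fun h ↦ Real.rpow_le_rpow_of_exponent_le hX h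
  obtain ⟨hQ1, hQ2, hQ3⟩ := exists_floor_rpow hX
    (a := 2 * (c - 1) + 1 / 100) (by positivity)
  obtain ⟨hU1, hU2, hU3⟩ := exists_floor_rpow hX (a := 1 / 10) (by positivity)
  set Q := ⌊X ^ (2 * (c - 1) + 1 / 100)⌋₊
  set U := ⌊X ^ (1 / 10 : ℝ)⌋₊
  have hD : |j| * c + |θ| * (16 * X ^ (1 - c)) ≤ 32 * X ^ (c - 1 + 2 / 1000) := by
    have e1 : X ^ (c - 1 + 2 / 1000) = X ^ (2 * (c - 1) + 2 / 1000) * X ^ (1 - c) := by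
      rw [← Real.rpow_add hX0]; congr 1; ring
    have h1 : |j| * c ≤ X ^ (c - 1 + 2 / 1000) * 2 := by gcongr; linarith
    have h2 : |θ| * (16 * X ^ (1 - c)) ≤ X ^ (2 * (c - 1) + 2 / 1000) * (16 * X ^ (1 - c)) := by
      gcongr
    have h3 : 0 < X ^ (c - 1 + 2 / 1000) := by positivity
    linarith
  have hβD : X ^ (-2 * (c - 1) - 4 / 1000) ≤ 32 * X ^ (c - 1 + 2 / 1000) := by
    have h1 : X ^ (-2 * (c - 1) - 4 / 1000) ≤ X ^ (c - 1 + 2 / 1000) := hle (by linarith)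
    have h3 : 0 < X ^ (c - 1 + 2 / 1000) := by positivity
    linarith
  have hphase := phase_powPhase hc (by linarith) hX0 hV hVX hA hB (by positivity) hβD hD h₂ h₃
  have e2 : c - 2 = c - 1 - 1 := by ring
  rw [e2] at hphase
  have hT : ∀ n ≤ B, (n.divisors.card : ℝ) ≤ C * 2 ^ (5 / 10000 : ℝ) * X ^ (5 / 10000 : ℝ) := by
    intro n hn
    rcases Nat.eq_zero_or_pos n with rfl | hn0
    · simp; positivity
    · refine (hC n hn0).trans ?_
      rw [mul_assoc, ← Real.mul_rpow (by norm_num) hX0.le]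
      have : (n : ℝ) ≤ 2 * X := le_trans (by exact_mod_cast hn) hB
      gcongr
  have hb := hblock Q hQ3
  have hQU : Q ≤ U := Nat.floor_mono (hle (by linarith))
  have hUX : (U : ℝ) ≤ X := hU3.trans (by
    nth_rw 2 [← Real.rpow_one X]; exact hle (by norm_num))
  have key := hphase.norm_sum_vonMangoldt_le hX hA hB hQ1 hQU hUX (by positivity) hT
    (g := (c - 1) * X ^ (c - 1) * X ^ (-2 * (c - 1) - 4 / 1000)) hb
  refine key.trans (add_le_add ?_ (hII Q hQ2))
  refine le_trans (le_of_eq ?_) (hI U hU3)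
  ring

/-- The exponential sum estimate over prime powers in a dyadic range. -/
lemma eventually_norm_sum_vonMangoldt_le (hc : 1 < c) (hc2 : c < 82 / 79) :
    ∀ᶠ X : ℝ in atTop, ∀ V : ℝ, 0 < V → V ^ (1 / c) = 10 ^ 9 * X → ∀ j θ : ℝ,
      |j| ≤ X ^ (c - 1 + 2 / 1000) → |θ| ≤ X ^ (2 * (c - 1) + 2 / 1000) →
      (θ = 0 ∧ 1 ≤ |j| ∨ X ^ (-1 / 10000 : ℝ) ≤ |θ|) →
      ∀ A B : ℕ, X ≤ A → B ≤ 2 * X →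
      ‖∑ n ∈ Ioc A B, (vonMangoldt n : ℂ) * e (powPhase c V j θ n)‖ ≤
        X ^ (1 - (c - 1) - 25 / 10000) := by
  have hs : 0 < c - 1 := by linarith
  filter_upwards [eventually_ge_atTop 1, eventually_norm_sum_le_of_awayFromZero hc hc2,
    eventually_log_two_mul_le (ε := 1 / 10000) (by norm_num),
    eventually_mul_rpow_le 32 (a := 1 - (c - 1) - 3 / 1000) (b := 1 - (c - 1) - 25 / 10000)
      (by linarith),
    eventually_mul_rpow_le (16 * (10 ^ 9) ^ (2 * c - 1)) (a := 1 - (c - 1) - 38 / 10000)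
      (b := 1 - (c - 1) - 25 / 10000) (by linarith),
    eventually_mul_rpow_le 16 (a := 1 / 10000) (b := 1 - (c - 1) - 25 / 10000) (by linarith)]
    with X hX hgood hlog h1 h2 h3 V hV hVX j θ hj hθ hjθ A B hA hB
  have hX0 : 0 < X := by linarith
  have hle : ∀ {a b : ℝ}, a ≤ b → X ^ a ≤ X ^ b := fun h ↦ Real.rpow_le_rpow_of_exponent_le hX h
  rcases le_or_gt B A with hBA | hAB
  · rw [Ioc_eq_empty_of_le hBA, sum_empty, norm_zero]
    positivity
  set R := X ^ (1 - (c - 1) - 3 / 1000) + X ^ (1 - (c - 1) - 3 / 1000) with hR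
  have hR0 : 0 ≤ R := by positivity
  set β := X ^ (-2 * (c - 1) - 4 / 1000) with hβ
  have hβ0 : 0 < β := by positivity
  have hlog0 : 0 ≤ Real.log (2 * X) := Real.log_nonneg (by linarith)
  rcases hjθ with ⟨rfl, hj1⟩ | hθ1
  · have haway : ∀ F : ℝ → ℝ, AwayFromZero (fun x ↦ j * c - 0 * F x) β (Set.Icc (A : ℝ) B) := by
      intro F
      have hβ1 : β ≤ 1 := by
        rw [← Real.rpow_zero X]; exact hle (by linarith)
      rcases abs_cases j with ⟨h4, -⟩ | ⟨h4, -⟩ <;> rw [h4] at hj1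
      · exact Or.inl fun x _ ↦ by nlinarith
      · exact Or.inr fun x _ ↦ by nlinarith
    refine (hgood V hV hVX j 0 hj hθ A B hA hB (haway _) (haway _)).trans ?_
    have : 0 < X ^ (1 - (c - 1) - 3 / 1000) := by positivity
    linarith
  have hθ0 : θ ≠ 0 := by
    rw [← abs_pos]
    exact lt_of_lt_of_le (by positivity) hθ1
  have hBV : ∀ y : ℝ, A ≤ y → y ≤ B → y ^ c < V := fun y hy1 hy2 ↦ by
    have := rpow_le_half_of_root_eq hc.le hX0 hV hVX (by linarith) (hy2.trans hB)
    linarith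
  set ρ := V ^ (1 / c - 2) * X ^ (c - 1) with hρ
  have hρ0 : 0 < ρ := by positivity
  set M := Real.log (2 * X)
  have ha : ∀ n ≤ B, ‖(vonMangoldt n : ℂ) * e (powPhase c V j θ n)‖ ≤ M := by
    intro n hn
    rw [norm_mul, norm_e, mul_one, Complex.norm_real, Real.norm_eq_abs,
      abs_of_nonneg vonMangoldt_nonneg]
    rcases Nat.eq_zero_or_pos n with rfl | hn0
    · simpa using hlog0
    · refine vonMangoldt_le_log.trans (Real.log_le_log (by exact_mod_cast hn0) ?_)
      exact le_trans (by exact_mod_cast hn) hB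
  set bad := M * (2 * β / (|θ| * ρ) + 2) with hbad
  have hbad0 : 0 ≤ bad := by positivity
  have hfin : ‖∑ n ∈ Ioc A B, (vonMangoldt n : ℂ) * e (powPhase c V j θ n)‖ ≤
      2 * (2 * R + bad) + bad := by
    refine norm_sum_le_of_zone (G := factor₂ c V) (a₀ := j * c) hAB.le hθ0 hρ0 hβ0
      (fun x y hx hxy hy ↦ mul_sub_le_factor₂_sub hc.le hX0 (hA.trans hx) hxy
        (hBV y (hx.trans hxy) hy)) hlog0 ha (by positivity) fun A₁ B₁ hA₁ hAB₁ hB₁ haw₂ ↦ ?_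
    have hA₁' : (A : ℝ) ≤ A₁ := by exact_mod_cast hA₁
    have hB₁' : (B₁ : ℝ) ≤ B := by exact_mod_cast hB₁
    refine norm_sum_le_of_zone (G := factor₃ c V) (a₀ := j * c) hAB₁ hθ0 hρ0 hβ0
      (fun x y hx hxy hy ↦ mul_sub_le_factor₃_sub hc.le hX0 (hA.trans (hA₁'.trans hx)) hxy
        (hBV y (hA₁'.trans (hx.trans hxy)) (hy.trans hB₁'))) hlog0
      (fun n hn ↦ ha n (hn.trans hB₁)) hR0 fun A₂ B₂ hA₂ hAB₂ hB₂ haw₃ ↦ ?_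
    have hA₂' : (A₁ : ℝ) ≤ A₂ := by exact_mod_cast hA₂
    have hB₂' : (B₂ : ℝ) ≤ B₁ := by exact_mod_cast hB₂
    exact hgood V hV hVX j θ hj hθ A₂ B₂ (by linarith) (by linarith)
      (haw₂.mono (Set.Icc_subset_Icc hA₂' hB₂')) haw₃
  refine hfin.trans ?_
  have hβρ : β / (|θ| * ρ) ≤ (10 ^ 9) ^ (2 * c - 1) * X ^ (1 - (c - 1) - 39 / 10000) := by
    have hρ' : ρ = (10 ^ 9) ^ (1 - 2 * c) * X ^ (-c) := by
      have h4 : V ^ (1 / c - 2) = (10 ^ 9 * X) ^ (1 - 2 * c) := by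
        rw [← hVX, ← Real.rpow_mul hV.le]
        congr 1
        have : c ≠ 0 := by linarith
        field_simp
      rw [hρ, h4, Real.mul_rpow (by norm_num) hX0.le, mul_assoc, ← Real.rpow_add hX0]
      congr 2; ring
    calc β / (|θ| * ρ) ≤ β / (X ^ (-1 / 10000 : ℝ) * ρ) := by gcongr
      _ = (10 ^ 9) ^ (2 * c - 1) * (β * X ^ (1 / 10000 : ℝ) * X ^ c) := by
          rw [hρ', show (2 * c - 1) = -(1 - 2 * c) by ring, Real.rpow_neg hX0.le c,
            Real.rpow_neg (x := (10 : ℝ) ^ 9) (by norm_num) (1 - 2 * c),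
            show (-1 / 10000 : ℝ) = -(1 / 10000) by norm_num, Real.rpow_neg hX0.le (1 / 10000)]
          field_simp
      _ = _ := by
          rw [hβ, ← Real.rpow_add hX0, ← Real.rpow_add hX0]
          congr 2; ring
  have hbad1 : bad ≤ 2 * (10 ^ 9) ^ (2 * c - 1) * X ^ (1 - (c - 1) - 38 / 10000) +
      2 * X ^ (1 / 10000 : ℝ) := by
    calc bad ≤ X ^ (1 / 10000 : ℝ) * (2 * ((10 ^ 9) ^ (2 * c - 1) *
          X ^ (1 - (c - 1) - 39 / 10000)) + 2) := by
          rw [hbad, mul_div_assoc]; gcongr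
      _ = 2 * (10 ^ 9) ^ (2 * c - 1) * (X ^ (1 / 10000 : ℝ) * X ^ (1 - (c - 1) - 39 / 10000)) +
          2 * X ^ (1 / 10000 : ℝ) := by ring
      _ = _ := by
          rw [← Real.rpow_add hX0]
          congr 3; ring
  linarith

end ExponentialSum

end

section

open Filter ArithmeticFunction

/-- The primes in `(X, 2 * X]`. -/
noncomputable def dyadicPrimes (X : ℝ) : Finset ℕ := {p ∈ Ioc ⌊X⌋₊ ⌊2 * X⌋₊ | p.Prime}

lemma sum_log_dyadicPrimes_le {X : ℝ} (hX : 0 ≤ X) :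
    ∑ p ∈ dyadicPrimes X, Real.log p ≤ 3 * X := by
  have h : ∑ p ∈ dyadicPrimes X, Real.log p ≤ Chebyshev.theta (2 * X) := by
    refine sum_le_sum_of_subset_of_nonneg ?_ fun i _ _ ↦ Real.log_natCast_nonneg i
    exact filter_subset_filter _ (Ioc_subset_Ioc_left (Nat.zero_le _))
  have h4 : Real.log 4 ≤ 3 / 2 := by
    rw [show (4 : ℝ) = 2 ^ 2 by norm_num, Real.log_pow]
    have := Real.log_two_lt_d9
    push_cast
    linarith
  have := Chebyshev.theta_le_log4_mul_x (x := 2 * X) (by linarith)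
  nlinarith

lemma eventually_le_sum_log_dyadicPrimes :
    ∀ᶠ X : ℝ in atTop, X / 4 ≤ ∑ p ∈ dyadicPrimes X, Real.log p := by
  filter_upwards [eventually_ge_atTop 100, eventually_log_two_mul_le (ε := 1 / 4) (by norm_num),
    eventually_mul_rpow_le 100 (a := 1 / 4) (b := 1) (by norm_num),
    eventually_mul_rpow_le 100 (a := 3 / 4) (b := 1) (by norm_num)] with X hX hlog h1 h2
  have hX0 : 0 < X := by linarith
  rw [Real.rpow_one] at h1 h2
  set n := ⌊X⌋₊
  have hn : (n : ℝ) ≤ X := Nat.floor_le hX0.le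
  have hn' : X < n + 1 := Nat.lt_floor_add_one X
  have hn4 : 4 ≤ n := Nat.le_floor (by norm_num; linarith)
  have hn0 : (4 : ℝ) ≤ n := by exact_mod_cast hn4
  have hsub : ∑ p ∈ Ioc n (2 * n) with p.Prime, Real.log p ≤
      ∑ p ∈ dyadicPrimes X, Real.log p := by
    refine sum_le_sum_of_subset_of_nonneg ?_ fun i _ _ ↦ Real.log_natCast_nonneg i
    refine filter_subset_filter _ (Ioc_subset_Ioc_right (Nat.le_floor ?_))
    push_cast
    linarith
  refine le_trans ?_ ((le_sum_log_primes_Ioc hn4).trans hsub)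
  have h4 : 4 / 3 ≤ Real.log 4 := by
    rw [show (4 : ℝ) = 2 ^ 2 by norm_num, Real.log_pow]
    have := Real.log_two_gt_d9
    push_cast
    linarith
  have hl1 : Real.log n ≤ X ^ (1 / 4 : ℝ) :=
    (Real.log_le_log (by linarith) (by linarith)).trans hlog
  have hl2 : Real.log (2 * n) ≤ X ^ (1 / 4 : ℝ) :=
    (Real.log_le_log (by linarith) (by linarith)).trans hlog
  have hsq : √(2 * n) ≤ 2 * X ^ (1 / 2 : ℝ) := by
    rw [← Real.sqrt_eq_rpow]
    refine Real.sqrt_le_iff.2 ⟨by positivity, ?_⟩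
    rw [mul_pow, Real.sq_sqrt hX0.le]
    linarith
  have hprod : √(2 * n) * Real.log (2 * n) ≤ 2 * X ^ (3 / 4 : ℝ) := by
    calc √(2 * n) * Real.log (2 * n) ≤ 2 * X ^ (1 / 2 : ℝ) * X ^ (1 / 4 : ℝ) := by
          gcongr
          exact Real.log_nonneg (by linarith)
      _ = _ := by
        rw [mul_assoc, ← Real.rpow_add hX0]
        norm_num
  nlinarith

/-- The exponential sum estimate over primes in a dyadic range. -/
lemma eventually_norm_sum_log_dyadicPrimes_le {c : ℝ} (hc : 1 < c) (hc2 : c < 82 / 79) :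
    ∀ᶠ X : ℝ in atTop, ∀ V : ℝ, 0 < V → V ^ (1 / c) = 10 ^ 9 * X → ∀ j θ : ℝ,
      |j| ≤ X ^ (c - 1 + 2 / 1000) → |θ| ≤ X ^ (2 * (c - 1) + 2 / 1000) →
      (θ = 0 ∧ 1 ≤ |j| ∨ X ^ (-1 / 10000 : ℝ) ≤ |θ|) →
      ‖∑ p ∈ dyadicPrimes X, (Real.log p : ℂ) * e (powPhase c V j θ p)‖ ≤
        X ^ (1 - (c - 1) - 2 / 1000) := by
  filter_upwards [eventually_ge_atTop 2, eventually_norm_sum_vonMangoldt_le hc hc2,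
    eventually_log_two_mul_le (ε := 1 / 100) (by norm_num),
    eventually_mul_rpow_le 16 (a := 51 / 100) (b := 1 - (c - 1) - 2 / 1000) (by linarith),
    eventually_mul_rpow_le 4 (a := 1 / 100) (b := 1 - (c - 1) - 2 / 1000) (by linarith),
    eventually_mul_rpow_le 4 (a := 1 - (c - 1) - 25 / 10000) (b := 1 - (c - 1) - 2 / 1000)
      (by linarith)]
    with X hX hgood hlog h1 h2 h3 V hV hVX j θ hj hθ hjθ
  have hX0 : 0 < X := by linarith
  set A := ⌊X⌋₊ + 1 with hA
  set B := ⌊2 * X⌋₊ with hB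
  have hAX : X < A := by rw [hA]; exact_mod_cast Nat.lt_floor_add_one X
  have hBX : (B : ℝ) ≤ 2 * X := Nat.floor_le (by linarith)
  have hAB : A ≤ B := by
    refine Nat.le_floor ?_
    have : (⌊X⌋₊ : ℝ) ≤ X := Nat.floor_le hX0.le
    rw [hA]
    push_cast
    linarith
  set f : ℕ → ℂ := fun n ↦ (Real.log n : ℂ) * e (powPhase c V j θ n)
  set a : ℕ → ℂ := fun n ↦ (vonMangoldt n : ℂ) * e (powPhase c V j θ n)
  have hsplit : ∑ p ∈ dyadicPrimes X, f p = (if A.Prime then f A else 0) +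
      (∑ n ∈ Ioc A B, a n - ∑ n ∈ Ioc A B with ¬ n.Prime, a n) := by
    have hins : Ioc ⌊X⌋₊ B = insert A (Ioc A B) := by
      ext n
      simp only [mem_Ioc, mem_insert]
      omega
    have hfa : ∑ n ∈ Ioc A B with n.Prime, a n = ∑ n ∈ Ioc A B with n.Prime, f n :=
      sum_congr rfl fun n hn ↦ by
        simp only [a, f]
        rw [vonMangoldt_apply_prime (mem_filter.1 hn).2]
    rw [← sum_filter_add_sum_filter_not (Ioc A B) Nat.Prime a, add_sub_cancel_right, hfa,
      dyadicPrimes, ← hB, hins, sum_filter, sum_insert (by simp), sum_filter]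
  have hnotprime : ‖∑ n ∈ Ioc A B with ¬ n.Prime, a n‖ ≤ 4 * X ^ (51 / 100 : ℝ) := by
    calc ‖∑ n ∈ Ioc A B with ¬ n.Prime, a n‖ ≤ ∑ n ∈ Ioc A B with ¬ n.Prime, ‖a n‖ :=
          norm_sum_le _ _
      _ = ∑ n ∈ Ioc A B with ¬ n.Prime, vonMangoldt n := sum_congr rfl fun n _ ↦ by
          rw [norm_mul, norm_e, mul_one, Complex.norm_real, Real.norm_eq_abs,
            abs_of_nonneg vonMangoldt_nonneg]
      _ ≤ ∑ n ∈ Ioc 0 B with ¬ n.Prime, vonMangoldt n :=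
          sum_le_sum_of_subset_of_nonneg
            (filter_subset_filter _ (Ioc_subset_Ioc_left (Nat.zero_le _)))
            fun _ _ _ ↦ vonMangoldt_nonneg
      _ = Chebyshev.psi (2 * X) - Chebyshev.theta (2 * X) :=
          (Chebyshev.psi_sub_theta_eq_sum_not_prime _).symm
      _ ≤ 2 * √(2 * X) * Real.log (2 * X) := Chebyshev.psi_sub_theta_le (by linarith)
      _ ≤ 2 * (2 * X ^ (1 / 2 : ℝ)) * X ^ (1 / 100 : ℝ) := by
          gcongr
          · exact Real.log_nonneg (by linarith)
          rw [← Real.sqrt_eq_rpow]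
          refine Real.sqrt_le_iff.2 ⟨by positivity, ?_⟩
          rw [mul_pow, Real.sq_sqrt hX0.le]
          linarith
      _ = 4 * X ^ (51 / 100 : ℝ) := by
          rw [← mul_assoc, mul_assoc, ← Real.rpow_add hX0]
          norm_num
  have hfirst : ‖if A.Prime then f A else 0‖ ≤ X ^ (1 / 100 : ℝ) := by
    split_ifs
    · rw [norm_mul, norm_e, mul_one, Complex.norm_real, Real.norm_eq_abs,
        abs_of_nonneg (Real.log_natCast_nonneg _)]
      refine (Real.log_le_log (by linarith) ?_).trans hlog
      exact le_trans (by exact_mod_cast hAB) hBX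
    · rw [norm_zero]; positivity
  have hmain := hgood V hV hVX j θ hj hθ hjθ A B hAX.le hBX
  rw [hsplit]
  refine (norm_add_le _ _).trans ((add_le_add hfirst ((norm_sub_le _ _).trans
    (add_le_add hmain hnotprime))).trans ?_)
  have : 0 ≤ X ^ (1 - (c - 1) - 2 / 1000) := by positivity
  linarith

end

lemma one_sub_le_hat {w : ℝ} (hw : 0 < w) (x : ℝ) (n : ℤ) : 1 - |x - n| / w ≤ hat w x := by
  refine le_trans ?_ (le_max_right _ _)
  have := round_le x n
  gcongr

lemma abs_sub_round_lt_of_hat_pos {w x : ℝ} (hw : 0 < w) (h : 0 < hat w x) :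
    |x - round x| < w := by
  rw [hat, lt_max_iff] at h
  rcases h with h | h
  · exact absurd h (lt_irrefl _)
  · rwa [sub_pos, div_lt_one hw] at h

lemma one_le_sum_hat {w : ℝ} (hw : 0 < w) {x : ℝ} {s : Finset ℤ} {n : ℤ}
    (h0 : ⌊(n - x) / w⌋ ∈ s) (h1 : ⌊(n - x) / w⌋ + 1 ∈ s) :
    1 ≤ ∑ r ∈ s, hat w (x + r * w) := by
  set t := (n - x) / w with ht
  have hterm : ∀ r : ℤ, 1 - |r - t| ≤ hat w (x + r * w) := fun r ↦ by
    convert one_sub_le_hat hw (x + r * w) n using 2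
    rw [← abs_of_pos hw, ← abs_div, abs_of_pos hw, ht]
    congr 1
    field_simp
    ring
  have hsub : ({⌊t⌋, ⌊t⌋ + 1} : Finset ℤ) ⊆ s := by
    intro r hr
    rcases mem_insert.1 hr with rfl | hr
    · exact h0
    · rw [mem_singleton.1 hr]; exact h1
  refine le_trans ?_ (sum_le_sum_of_subset_of_nonneg hsub fun _ _ _ ↦ hat_nonneg _ _)
  rw [sum_pair (by omega)]
  have h2 := hterm ⌊t⌋
  have h3 := hterm (⌊t⌋ + 1)
  have h4 := Int.floor_le t
  have h5 := Int.lt_floor_add_one t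
  rw [abs_of_nonpos (by linarith)] at h2
  push_cast at h3
  rw [abs_of_nonneg (by linarith)] at h3
  push_cast
  linarith

lemma sum_hat_le_one {w : ℝ} (hw : 0 < w) {a b : ℤ} (hab : (b - a + 2) * w ≤ 1) (x : ℝ) :
    ∑ r ∈ Icc a b, hat w (x + r * w) ≤ 1 := by
  by_cases hex : ∃ r ∈ Icc a b, 0 < hat w (x + r * w)
  swap
  · push Not at hex
    exact (sum_nonpos hex).trans zero_le_one
  obtain ⟨r₀, hr₀, hpos⟩ := hex
  set n := round (x + r₀ * w) with hn
  have hn1 := abs_lt.1 (abs_sub_round_lt_of_hat_pos hw hpos)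
  rw [← hn] at hn1
  obtain ⟨ha₀, hb₀⟩ := mem_Icc.1 hr₀
  have ha₀' : (a : ℝ) ≤ r₀ := by exact_mod_cast ha₀
  have hb₀' : (r₀ : ℝ) ≤ b := by exact_mod_cast hb₀
  set t := (n - x) / w with ht
  have hterm : ∀ r ∈ Icc a b, hat w (x + r * w) ≤ max 0 (1 - |r - t|) := by
    intro r hr
    obtain ⟨ha, hb⟩ := mem_Icc.1 hr
    have ha' : (a : ℝ) ≤ r := by exact_mod_cast ha
    have hb' : (r : ℝ) ≤ b := by exact_mod_cast hb
    rcases (hat_nonneg w (x + r * w)).eq_or_lt with h | h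
    · rw [← h]; exact le_max_left _ _
    have hn2 := abs_lt.1 (abs_sub_round_lt_of_hat_pos hw h)
    set k := round (x + r * w) with hk
    have hkn : k = n := by
      have h1 : (k : ℝ) - n < 1 := by nlinarith
      have h2 : (n : ℝ) - k < 1 := by nlinarith
      have h1' : k - n < 1 := by exact_mod_cast h1
      have h2' : n - k < 1 := by exact_mod_cast h2
      omega
    rw [hat, ← hk, hkn]
    refine le_of_eq ?_
    congr 2
    rw [← abs_of_pos hw, ← abs_div, abs_of_pos hw, ht]
    congr 1
    field_simp
    ring
  refine (sum_le_sum hterm).trans ?_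
  have hzero : ∀ r ∈ Icc a b, r ∉ ({⌊t⌋, ⌊t⌋ + 1} : Finset ℤ) → max 0 (1 - |(r : ℝ) - t|) = 0 := by
    intro r _ hr
    rw [mem_insert, mem_singleton, not_or] at hr
    refine max_eq_left ?_
    rw [sub_nonpos]
    rcases lt_or_gt_of_ne hr.1 with h | h
    · have : (r : ℝ) ≤ ⌊t⌋ - 1 := by exact_mod_cast (by omega : r ≤ ⌊t⌋ - 1)
      rw [le_abs]; right
      linarith [Int.floor_le t]
    · have : (⌊t⌋ : ℝ) + 2 ≤ r := by exact_mod_cast (by omega : ⌊t⌋ + 2 ≤ r)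
      rw [le_abs]; left
      linarith [Int.lt_floor_add_one t]
  calc ∑ r ∈ Icc a b, max 0 (1 - |(r : ℝ) - t|)
      ≤ ∑ r ∈ Icc a b ∩ {⌊t⌋, ⌊t⌋ + 1}, max 0 (1 - |(r : ℝ) - t|) := by
        refine le_of_eq (sum_subset inter_subset_left fun r hr hr' ↦ hzero r hr fun h ↦ ?_).symm
        exact hr' (mem_inter.2 ⟨hr, h⟩)
    _ ≤ ∑ r ∈ ({⌊t⌋, ⌊t⌋ + 1} : Finset ℤ), max 0 (1 - |(r : ℝ) - t|) :=
        sum_le_sum_of_subset_of_nonneg inter_subset_right fun _ _ _ ↦ le_max_left _ _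
    _ = 1 := by
        have h4 := Int.floor_le t
        have h5 := Int.lt_floor_add_one t
        rw [sum_pair (by omega)]
        push_cast
        rw [abs_of_nonpos (by linarith : (⌊t⌋ : ℝ) - t ≤ 0),
          abs_of_nonneg (by linarith : (0 : ℝ) ≤ ⌊t⌋ + 1 - t),
          max_eq_right (by linarith), max_eq_right (by linarith)]
        ring

lemma rpow_le_add_mul_sub {γ : ℝ} (hγ0 : 0 ≤ γ) (hγ1 : γ ≤ 1) {x y : ℝ} (hx : 0 ≤ x)
    (hy : 0 < y) : x ^ γ ≤ y ^ γ + γ * y ^ (γ - 1) * (x - y) := by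
  have h := rpow_one_add_le_one_add_mul_self (s := x / y - 1) (p := γ)
    (by linarith [div_nonneg hx hy.le]) hγ0 hγ1
  rw [add_sub_cancel, Real.div_rpow hx hy.le, div_le_iff₀ (by positivity)] at h
  refine h.trans (le_of_eq ?_)
  rw [Real.rpow_sub_one hy.ne']
  field_simp

lemma floor_rpow_eq_iff {c : ℝ} (hc : 0 < c) {x : ℝ} (hx : 0 ≤ x) {W : ℤ} (hW : 0 ≤ W) :
    ⌊x ^ c⌋ = W ↔ (W : ℝ) ^ (1 / c) ≤ x ∧ x < ((W : ℝ) + 1) ^ (1 / c) := by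
  have hW' : (0 : ℝ) ≤ W := by exact_mod_cast hW
  rw [Int.floor_eq_iff, one_div, Real.rpow_inv_le_iff_of_pos hW' hx hc,
    Real.lt_rpow_inv_iff_of_pos hx (by linarith) hc]

lemma strictMono_floor_rpow {c : ℝ} (hc : 1 ≤ c) : StrictMono fun m : ℕ ↦ ⌊(m : ℝ) ^ c⌋ :=
  strictMono_nat_of_lt_succ fun m ↦ by
    have h := Real.add_rpow_le_rpow_add (Nat.cast_nonneg m) zero_le_one hc
    rw [Real.one_rpow] at h
    have h1 : ⌊(m : ℝ) ^ c + 1⌋ ≤ ⌊((m : ℝ) + 1) ^ c⌋ := Int.floor_mono h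
    rw [Int.floor_add_one] at h1
    push_cast
    omega

lemma subsingleton_setOf_solution {c : ℝ} (hc : 1 ≤ c) (N d p : ℕ) :
    {m : ℕ | 0 < m ∧ d ^ 2 ∣ m ∧ ⌊(p : ℝ) ^ c⌋ + ⌊(m : ℝ) ^ c⌋ = (N : ℤ)}.Subsingleton := by
  intro m hm m' hm'
  refine (strictMono_floor_rpow hc).injective ?_
  have h1 := hm.2.2
  have h2 := hm'.2.2
  omega

lemma cnt_le_one {c : ℝ} (hc : 1 ≤ c) (N d p : ℕ) : cnt c N d p ≤ 1 :=
  have h := subsingleton_setOf_solution hc N d p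
  (Set.ncard_le_one h.finite).2 fun _ ha _ hb ↦ h ha hb

/-- The increments of `x ^ γ` from `N - u` to the endpoints of the interval of solutions. -/
lemma rpow_increment_bounds {γ : ℝ} (hγ0 : 0 < γ) (hγ1 : γ ≤ 1) {N u s : ℝ}
    (hN : 0 < N) (huN : u ≤ N / 500) (hs : 0 ≤ s) (hsu : s ≤ u) :
    (N - u) ^ γ + γ * N ^ (γ - 1) * s ≤ (N - u + s) ^ γ ∧
      (N - u + s) ^ γ ≤ (N - u) ^ γ + 401 / 400 * (γ * N ^ (γ - 1)) * s := by
  have hy : 0 < N - u := by linarith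
  have h1 := rpow_le_add_mul_sub hγ0.le hγ1 hy.le (by linarith : 0 < N - u + s)
  have h2 := rpow_le_add_mul_sub hγ0.le hγ1 (by linarith : 0 ≤ N - u + s) hy
  have h3 : N ^ (γ - 1) ≤ (N - u + s) ^ (γ - 1) :=
    Real.rpow_le_rpow_of_nonpos (by linarith) (by linarith) (by linarith)
  have h4 : (N - u) ^ (γ - 1) ≤ 401 / 400 * N ^ (γ - 1) := by
    calc (N - u) ^ (γ - 1) ≤ (499 / 500 * N) ^ (γ - 1) :=
          Real.rpow_le_rpow_of_nonpos (by linarith) (by linarith) (by linarith)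
      _ = (499 / 500) ^ (γ - 1) * N ^ (γ - 1) := Real.mul_rpow (by norm_num) hN.le
      _ ≤ (499 / 500) ^ (-1 : ℝ) * N ^ (γ - 1) := by
          refine mul_le_mul_of_nonneg_right ?_ (by positivity)
          exact Real.rpow_le_rpow_of_exponent_ge (by norm_num) (by norm_num) (by linarith)
      _ ≤ _ := by
          refine mul_le_mul_of_nonneg_right ?_ (by positivity)
          rw [Real.rpow_neg_one]; norm_num
  constructor
  · have : γ * N ^ (γ - 1) * s ≤ γ * (N - u + s) ^ (γ - 1) * s := by gcongr
    linarith
  · have : γ * (N - u) ^ (γ - 1) * s ≤ γ * (401 / 400 * N ^ (γ - 1)) * s := by gcongr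
    linarith

section Counting

variable {c : ℝ} {N d p : ℕ}

/-- The increment of `W ^ (1 / c)` per unit length near `W = N`. -/
noncomputable def spacing (c : ℝ) (N : ℕ) : ℝ := 1 / c * (N : ℝ) ^ (1 / c - 1)

lemma spacing_pos (hc : 0 < c) (hN : 0 < N) : 0 < spacing c N := by
  unfold spacing; positivity

lemma exists_of_cnt_pos (hc : 1 ≤ c) (hd : 0 < d) (hp : 0 < p)
    (hpN : (p : ℝ) ^ c ≤ N / 500) (h : 0 < cnt c N d p) :
    ∃ k : ℤ, ∃ t : ℝ, k = ((N : ℝ) - (p : ℝ) ^ c) ^ (1 / c) / d ^ 2 +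
        t * (spacing c N / 100 / d ^ 2) ∧
      100 * Int.fract ((p : ℝ) ^ c) ≤ t ∧ t < 100 * Int.fract ((p : ℝ) ^ c) + 100 + 1 / 2 := by
  obtain ⟨m, hm0, ⟨k, rfl⟩, hm⟩ := Set.nonempty_of_ncard_ne_zero h.ne'
  set u := (p : ℝ) ^ c
  set α := Int.fract u with hα
  have hα0 : 0 ≤ α := Int.fract_nonneg u
  have hα1 : α < 1 := Int.fract_lt_one u
  have hα' : (⌊u⌋ : ℝ) = u - α := by rw [hα, Int.fract]; ring
  have hu1 : 1 ≤ u := Real.one_le_rpow (by exact_mod_cast hp) (by linarith)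
  have hc0 : 0 < c := by linarith
  have hN : (0 : ℝ) < N := by linarith
  have hfl : (1 : ℤ) ≤ ⌊u⌋ := Int.le_floor.2 (by exact_mod_cast hu1)
  have hfl' : (1 : ℝ) ≤ ⌊u⌋ := by exact_mod_cast hfl
  have hg := spacing_pos hc0 (N := N) (by exact_mod_cast hN)
  have hd' : (0 : ℝ) < d := by exact_mod_cast hd
  have hW : ⌊((d ^ 2 * k : ℕ) : ℝ) ^ c⌋ = N - ⌊u⌋ := by linarith
  have hW0 : 0 ≤ (N : ℤ) - ⌊u⌋ := by
    rw [← hW]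
    exact Int.floor_nonneg.2 (by positivity)
  rw [floor_rpow_eq_iff hc0 (by positivity) hW0] at hW
  obtain ⟨h1, h2⟩ := hW
  push_cast at h1 h2
  rw [hα', show (N : ℝ) - (u - α) = N - u + α by ring] at h1
  rw [hα', show (N : ℝ) - (u - α) + 1 = N - u + (α + 1) by ring] at h2
  have hγ1 : 1 / c ≤ 1 := (div_le_one hc0).2 hc
  have hb1 := (rpow_increment_bounds (γ := 1 / c) (by positivity) hγ1 hN hpN
    hα0 (by linarith)).1
  have hb2 := (rpow_increment_bounds (γ := 1 / c) (by positivity) hγ1 hN hpN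
    (by linarith : 0 ≤ α + 1) (by linarith)).2
  change _ + spacing c N * _ ≤ _ at hb1
  change _ ≤ _ + _ * spacing c N * _ at hb2
  refine ⟨k, ((d : ℝ) ^ 2 * k - (N - u) ^ (1 / c)) / (spacing c N / 100), ?_, ?_, ?_⟩
  · field_simp
    push_cast
    ring
  · rw [le_div_iff₀ (by positivity)]
    linarith
  · rw [div_lt_iff₀ (by positivity)]
    nlinarith

lemma cnt_pos_of_exists (hc : 1 ≤ c) (hp : 2 ≤ p) (hpN : (p : ℝ) ^ c ≤ N / 500)
    {k : ℤ} {t : ℝ} (hk : k = ((N : ℝ) - (p : ℝ) ^ c) ^ (1 / c) + t * (spacing c N / 100))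
    (ht : 100 * Int.fract ((p : ℝ) ^ c) + 1 / 2 ≤ t)
    (ht' : t < 100 * Int.fract ((p : ℝ) ^ c) + 100) : 0 < cnt c N 1 p := by
  set u := (p : ℝ) ^ c
  set α := Int.fract u with hα
  have hα0 : 0 ≤ α := Int.fract_nonneg u
  have hα1 : α < 1 := Int.fract_lt_one u
  have hα' : (⌊u⌋ : ℝ) = u - α := by rw [hα, Int.fract]; ring
  have hu2 : 2 ≤ u := by
    have hp' : (2 : ℝ) ≤ p := by exact_mod_cast hp
    exact hp'.trans (Real.self_le_rpow_of_one_le (by linarith) hc)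
  have hc0 : 0 < c := by linarith
  have hN : (0 : ℝ) < N := by linarith
  have hg := spacing_pos hc0 (N := N) (by exact_mod_cast hN)
  have hγ1 : 1 / c ≤ 1 := (div_le_one hc0).2 hc
  have hb1 := (rpow_increment_bounds (γ := 1 / c) (by positivity) hγ1 hN hpN
    hα0 (by linarith)).2
  have hb2 := (rpow_increment_bounds (γ := 1 / c) (by positivity) hγ1 hN hpN
    (by linarith : 0 ≤ α + 1) (by linarith)).1
  change _ ≤ _ + _ * spacing c N * _ at hb1
  change _ + spacing c N * _ ≤ _ at hb2
  have hy : 0 < ((N : ℝ) - u) ^ (1 / c) := Real.rpow_pos_of_pos (by linarith) _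
  have hk0 : (0 : ℝ) < k := by
    rw [hk]
    have : 0 < t := by linarith
    positivity
  have hk0' : 0 < k := by exact_mod_cast hk0
  lift k to ℕ using hk0'.le
  refine (Set.ncard_pos (subsingleton_setOf_solution hc N 1 p).finite).2
    ⟨k, by exact_mod_cast hk0', by simp, ?_⟩
  have hW0 : 0 ≤ (N : ℤ) - ⌊u⌋ := by
    have h1 : (0 : ℝ) ≤ N - ⌊u⌋ := by rw [hα']; linarith
    exact_mod_cast h1
  have : ⌊(k : ℝ) ^ c⌋ = N - ⌊u⌋ := by
    rw [floor_rpow_eq_iff hc0 (Nat.cast_nonneg k) hW0]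
    push_cast at hk ⊢
    rw [hα', show (N : ℝ) - (u - α) = N - u + α by ring,
      show (N : ℝ) - u + α + 1 = N - u + (α + 1) by ring, hk]
    constructor <;> nlinarith
  rw [this]
  ring

lemma cnt_le_sum_hat (hc : 1 ≤ c) (hd : 0 < d) (hp : 0 < p) (hpN : (p : ℝ) ^ c ≤ N / 500) :
    (cnt c N d p : ℝ) ≤ ∑ i ∈ Icc (-100 : ℤ) 1, ∑ r ∈ Icc (-i - 1) (-i + 102),
      hat (1 / 100) ((p : ℝ) ^ c + i * (1 / 100)) *
        hat (spacing c N / 100 / d ^ 2) (((N : ℝ) - (p : ℝ) ^ c) ^ (1 / c) / d ^ 2 +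
          r * (spacing c N / 100 / d ^ 2)) := by
  rcases Nat.eq_zero_or_pos (cnt c N d p) with h0 | hpos
  · rw [h0, Nat.cast_zero]
    exact sum_nonneg fun _ _ ↦ sum_nonneg fun _ _ ↦ mul_nonneg (hat_nonneg _ _) (hat_nonneg _ _)
  have hcnt : (cnt c N d p : ℝ) ≤ 1 := by exact_mod_cast cnt_le_one hc N d p
  refine hcnt.trans ?_
  obtain ⟨k, t, hk, ht1, ht2⟩ := exists_of_cnt_pos hc hd hp hpN hpos
  set u := (p : ℝ) ^ c with hu
  set v := ((N : ℝ) - u) ^ (1 / c) / d ^ 2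
  set w := spacing c N / 100 / d ^ 2 with hw
  set α := Int.fract u with hα
  have hα0 : 0 ≤ α := Int.fract_nonneg u
  have hα1 : α < 1 := Int.fract_lt_one u
  have hc0 : 0 < c := by linarith
  have hu0 : 0 < u := by positivity
  have hN : (0 : ℝ) < N := by linarith
  have hg := spacing_pos hc0 (N := N) (by exact_mod_cast hN)
  have hw0 : 0 < w := by positivity
  have htk : (k - v) / w = t := by
    rw [hk]
    field_simp
    ring
  have hiu : (⌊u⌋ - u) / (1 / 100) = -(100 * α) := by
    rw [hα, Int.fract]
    ring
  set i₀ := ⌊(⌊u⌋ - u) / (1 / 100)⌋ with hi₀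
  have hi1 : (i₀ : ℝ) ≤ -(100 * α) := by rw [← hiu]; exact Int.floor_le _
  have hi2 : -(100 * α) < i₀ + 1 := by rw [← hiu]; exact Int.lt_floor_add_one _
  have ht3 := Int.floor_le t
  have ht4 := Int.lt_floor_add_one t
  have hinner : ∀ i ∈ ({i₀, i₀ + 1} : Finset ℤ),
      1 ≤ ∑ r ∈ Icc (-i - 1) (-i + 102), hat w (v + r * w) := by
    intro i hi
    have hi' : (i₀ : ℝ) ≤ i ∧ (i : ℝ) ≤ i₀ + 1 := by
      rcases mem_insert.1 hi with rfl | hi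
      · constructor <;> linarith
      · rw [mem_singleton.1 hi]; push_cast; constructor <;> linarith
    have hlo : -i - 2 < ⌊t⌋ := by
      have : (-i - 2 : ℝ) < ⌊t⌋ := by linarith
      exact_mod_cast this
    have hhi : ⌊t⌋ < -i + 102 := by
      have : (⌊t⌋ : ℝ) < -i + 102 := by linarith
      exact_mod_cast this
    refine one_le_sum_hat hw0 (n := k) ?_ ?_ <;> rw [htk, mem_Icc] <;> constructor <;> omega
  have hsub : ({i₀, i₀ + 1} : Finset ℤ) ⊆ Icc (-100) 1 := by
    have h1 : -101 < i₀ := by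
      have : (-101 : ℝ) < i₀ := by linarith
      exact_mod_cast this
    have h2 : i₀ ≤ 0 := by
      have : (i₀ : ℝ) ≤ 0 := by linarith
      exact_mod_cast this
    intro i hi
    rw [mem_insert, mem_singleton] at hi
    rw [mem_Icc]
    omega
  calc (1 : ℝ) ≤ ∑ i ∈ ({i₀, i₀ + 1} : Finset ℤ), hat (1 / 100) (u + i * (1 / 100)) :=
        one_le_sum_hat (by norm_num) (n := ⌊u⌋) (mem_insert_self _ _)
          (mem_insert_of_mem (mem_singleton_self _))
    _ ≤ ∑ i ∈ ({i₀, i₀ + 1} : Finset ℤ), ∑ r ∈ Icc (-i - 1) (-i + 102),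
          hat (1 / 100) (u + i * (1 / 100)) * hat w (v + r * w) := by
        refine sum_le_sum fun i hi ↦ ?_
        rw [← mul_sum]
        exact le_mul_of_one_le_right (hat_nonneg _ _) (hinner i hi)
    _ ≤ _ := sum_le_sum_of_subset_of_nonneg hsub fun _ _ _ ↦
        sum_nonneg fun _ _ ↦ mul_nonneg (hat_nonneg _ _) (hat_nonneg _ _)

lemma sum_hat_le_cnt (hc : 1 ≤ c) (hp : 2 ≤ p) (hpN : (p : ℝ) ^ c ≤ N / 500)
    (hgN : spacing c N ≤ 1) :
    ∑ i ∈ Icc (-99 : ℤ) (-1), ∑ r ∈ Icc (-i + 3) (-i + 98),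
      hat (1 / 100) ((p : ℝ) ^ c + i * (1 / 100)) *
        hat (spacing c N / 100) (((N : ℝ) - (p : ℝ) ^ c) ^ (1 / c) +
          r * (spacing c N / 100)) ≤ cnt c N 1 p := by
  set u := (p : ℝ) ^ c with hu
  set v := ((N : ℝ) - u) ^ (1 / c)
  set w := spacing c N / 100 with hw
  set α := Int.fract u with hα
  have hα0 : 0 ≤ α := Int.fract_nonneg u
  have hα1 : α < 1 := Int.fract_lt_one u
  have hc0 : 0 < c := by linarith
  have hu0 : 0 < u := by positivity
  have hN : (0 : ℝ) < N := by linarith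
  have hg := spacing_pos hc0 (N := N) (by exact_mod_cast hN)
  have hw0 : 0 < w := by positivity
  rcases Nat.eq_zero_or_pos (cnt c N 1 p) with h0 | hpos
  · rw [h0, Nat.cast_zero]
    refine sum_nonpos fun i hi ↦ sum_nonpos fun r hr ↦ ?_
    by_contra! hprod
    have hh1 : 0 < hat (1 / 100) (u + i * (1 / 100)) :=
      (hat_nonneg _ _).lt_of_ne' (left_ne_zero_of_mul hprod.ne')
    have hh2 : 0 < hat w (v + r * w) :=
      (hat_nonneg _ _).lt_of_ne' (right_ne_zero_of_mul hprod.ne')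
    obtain ⟨hi1, hi2⟩ := mem_Icc.1 hi
    obtain ⟨hr1, hr2⟩ := mem_Icc.1 hr
    have hi1' : (-99 : ℝ) ≤ i := by exact_mod_cast hi1
    have hi2' : (i : ℝ) ≤ -1 := by exact_mod_cast hi2
    have hr1' : (-i + 3 : ℝ) ≤ r := by exact_mod_cast hr1
    have hr2' : (r : ℝ) ≤ -i + 98 := by exact_mod_cast hr2
    have hn := abs_lt.1 (abs_sub_round_lt_of_hat_pos (by norm_num) hh1)
    set n := round (u + i * (1 / 100))
    have hfl : (⌊u⌋ : ℝ) = u - α := by rw [hα, Int.fract]; ring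
    have hnu : n = ⌊u⌋ := by
      have h1 : (n : ℝ) < ⌊u⌋ + 1 := by linarith
      have h2 : (⌊u⌋ : ℝ) - 1 < n := by linarith
      have h1' : n < ⌊u⌋ + 1 := by exact_mod_cast h1
      have h2' : ⌊u⌋ - 1 < n := by exact_mod_cast h2
      omega
    rw [hnu, hfl] at hn
    have hk := abs_lt.1 (abs_sub_round_lt_of_hat_pos hw0 hh2)
    set k := round (v + r * w)
    have hkt : (k : ℝ) = v + ((k - v) / w) * w := by field_simp; ring
    have hlow : r - 1 < (k - v) / w := by rw [lt_div_iff₀ hw0]; linarith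
    have hhigh : (k - v) / w < r + 1 := by rw [div_lt_iff₀ hw0]; linarith
    have := cnt_pos_of_exists hc hp hpN hkt (by linarith) (by linarith)
    omega
  · have hcnt : (1 : ℝ) ≤ cnt c N 1 p := by exact_mod_cast hpos
    refine le_trans ?_ hcnt
    calc _ ≤ ∑ i ∈ Icc (-99 : ℤ) (-1), hat (1 / 100) (u + i * (1 / 100)) := by
          refine sum_le_sum fun i _ ↦ ?_
          rw [← mul_sum]
          refine mul_le_of_le_one_right (hat_nonneg _ _) (sum_hat_le_one hw0 ?_ v)
          push_cast
          linarith
      _ ≤ 1 := sum_hat_le_one (by norm_num) (by norm_num) u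

end Counting

section

open Filter

section Equidistribution

variable {c : ℝ}

lemma spacing_le (hc : 1 < c) {X : ℝ} (hX : 0 < X) {N : ℕ} (hN : 0 < N)
    (hNX : (N : ℝ) ^ (1 / c) = 10 ^ 9 * X) : spacing c N ≤ X ^ (-(c - 1)) := by
  have hc0 : 0 < c := by linarith
  have h := root_sub_one_le hc.le hX (Nat.cast_pos.2 hN) hNX
  rw [show -(c - 1) = 1 - c by ring]
  refine le_trans (mul_le_of_le_one_left (by positivity) ?_) h
  exact (div_le_one hc0).2 hc.le

lemma spacing_eq (hc : 1 < c) {X : ℝ} (hX : 0 < X) {N : ℕ}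
    (hNX : (N : ℝ) ^ (1 / c) = 10 ^ 9 * X) :
    spacing c N = 1 / c * (10 ^ 9) ^ (-(c - 1)) * X ^ (-(c - 1)) := by
  have hc0 : 0 < c := by linarith
  rw [spacing, mul_assoc, ← Real.mul_rpow (by norm_num) hX.le, ← hNX,
    ← Real.rpow_mul (Nat.cast_nonneg N)]
  congr 2
  field_simp
  ring

lemma eventually_log_le (hc : 1 < c) (hc2 : c < 2) {ε : ℝ} (hε : 0 < ε) :
    ∀ᶠ X : ℝ in atTop, ∀ N : ℕ, 0 < N → (N : ℝ) ^ (1 / c) = 10 ^ 9 * X →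
      Real.log N ≤ X ^ ε := by
  filter_upwards [eventually_ge_atTop (10 ^ 9), eventually_log_two_mul_le (half_pos hε),
    eventually_mul_rpow_le 4 (half_lt_self hε)] with X hX h1 h2 N hN hNX
  have hX0 : 0 < X := by linarith
  have h3 : 1 / c * Real.log N = Real.log (10 ^ 9 * X) := by
    rw [← hNX, Real.log_rpow (Nat.cast_pos.2 hN)]
  have h4 : Real.log N = c * Real.log (10 ^ 9 * X) := by
    rw [← h3]
    field_simp
  have h5 : Real.log (10 ^ 9 * X) ≤ 2 * Real.log (2 * X) := by
    calc Real.log (10 ^ 9 * X) ≤ Real.log ((2 * X) ^ 2) :=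
          Real.log_le_log (by positivity) (by nlinarith)
      _ = _ := by rw [Real.log_pow]; norm_num
  have h6 : 0 ≤ Real.log (10 ^ 9 * X) := Real.log_nonneg (by linarith)
  rw [h4]
  nlinarith

lemma eventually_abs_sum_hat_sub_le (hc : 1 < c) (hc2 : c < 82 / 79) :
    ∀ᶠ X : ℝ in atTop, ∀ N : ℕ, 0 < N → (N : ℝ) ^ (1 / c) = 10 ^ 9 * X →
      ∀ d : ℕ, 0 < d → d ≤ Real.log N → ∀ a b : ℝ,
      |∑ p ∈ dyadicPrimes X, Real.log p * (hat (1 / 100) ((p : ℝ) ^ c + a) *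
          hat (spacing c N / 100 / d ^ 2) (((N : ℝ) - (p : ℝ) ^ c) ^ (1 / c) / d ^ 2 + b)) -
        1 / 100 * (spacing c N / 100 / d ^ 2) * ∑ p ∈ dyadicPrimes X, Real.log p| ≤
      X ^ (1 - (c - 1) - 1 / 1000) := by
  set κ := 1 / c * (10 ^ 9 : ℝ) ^ (-(c - 1)) with hκ
  have hκ0 : 0 < κ := by positivity
  filter_upwards [eventually_ge_atTop 1, eventually_norm_sum_log_dyadicPrimes_le hc hc2,
    eventually_log_le hc (by linarith) (ε := 1 / 20000) (by norm_num),
    eventually_mul_rpow_le 4 (a := 1 - (c - 1) - 2 / 1000) (b := 1 - (c - 1) - 1 / 1000)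
      (by linarith),
    eventually_mul_rpow_le 4800 (a := 1 - (c - 1) - 2 / 1000) (b := 1 - (c - 1) - 1 / 1000)
      (by linarith),
    eventually_mul_rpow_le (4800 / κ) (a := 1 - (c - 1) - 19 / 10000)
      (b := 1 - (c - 1) - 1 / 1000) (by linarith)]
    with X hX hgood hlog h1 h2 h3 N hN hNX d hd hdN a b
  have hX0 : 0 < X := by linarith
  have hle : ∀ {a b : ℝ}, a ≤ b → X ^ a ≤ X ^ b := fun h ↦ Real.rpow_le_rpow_of_exponent_le hX h
  have hd0 : (1 : ℝ) ≤ d := by exact_mod_cast hd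
  have hd2 : (d : ℝ) ^ 2 ≤ X ^ (1 / 10000 : ℝ) := by
    calc (d : ℝ) ^ 2 ≤ (X ^ (1 / 20000 : ℝ)) ^ 2 := by
          have := hdN.trans (hlog N hN hNX)
          gcongr
      _ = _ := by rw [← Real.rpow_natCast, ← Real.rpow_mul hX0.le]; norm_num
  have hg0 : 0 < spacing c N := spacing_pos (by linarith) hN
  have hg1 : spacing c N ≤ 1 := (spacing_le hc hX0 hN hNX).trans (by
    exact Real.rpow_le_one_of_one_le_of_nonpos hX (by linarith))
  have hd2' : (1 : ℝ) ≤ d ^ 2 := one_le_pow₀ hd0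
  set w := spacing c N / 100 / d ^ 2 with hw
  have hw0 : 0 < w := by positivity
  have hw1 : w ≤ 1 / 2 := by
    calc w ≤ spacing c N / 100 := div_le_self (by positivity) hd2'
      _ ≤ 1 / 2 := by linarith
  have hw2 : κ / 100 * X ^ (-(c - 1) - 1 / 10000) ≤ w := by
    rw [hw, spacing_eq hc hX0 hNX, ← hκ, le_div_iff₀ (by positivity)]
    calc κ / 100 * X ^ (-(c - 1) - 1 / 10000) * d ^ 2
        ≤ κ / 100 * X ^ (-(c - 1) - 1 / 10000) * X ^ (1 / 10000 : ℝ) := by gcongr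
      _ = κ / 100 * X ^ (-(c - 1)) := by
          rw [mul_assoc, ← Real.rpow_add hX0]; congr 2; ring
      _ = _ := by ring
  obtain ⟨H₁, hH₁, hH₁l, hH₁u⟩ : ∃ H : ℕ, 0 < H ∧ X ^ (c - 1 + 2 / 1000) / 2 ≤ H ∧
      (H : ℝ) ≤ X ^ (c - 1 + 2 / 1000) :=
    ⟨_, exists_floor_rpow hX (by linarith)⟩
  obtain ⟨H₂, hH₂, hH₂l, hH₂u⟩ : ∃ H : ℕ, 0 < H ∧ X ^ (2 * (c - 1) + 2 / 1000) / 2 ≤ H ∧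
      (H : ℝ) ≤ X ^ (2 * (c - 1) + 2 / 1000) :=
    ⟨_, exists_floor_rpow hX (by linarith)⟩
  have habs : ∀ {j : ℤ} {H : ℕ}, j ∈ Icc (-(H : ℤ)) H → |(j : ℝ)| ≤ H := fun {j H} hj ↦ by
    obtain ⟨h4, h5⟩ := mem_Icc.1 hj
    exact_mod_cast abs_le.2 ⟨h4, h5⟩
  refine (abs_sum_hat_mul_hat_sub_le (dyadicPrimes X) (fun p ↦ Real.log p) (fun p ↦ (p : ℝ) ^ c)
    (fun p ↦ ((N : ℝ) - (p : ℝ) ^ c) ^ (1 / c) / d ^ 2) (fun i _ ↦ Real.log_natCast_nonneg i)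
    (by norm_num) (by norm_num) hw0 hw1 hH₁ hH₂ a b
    (E := X ^ (1 - (c - 1) - 2 / 1000)) (by positivity) fun j hj h hh hjh ↦ ?_).trans ?_
  · have hphase := hgood N (Nat.cast_pos.2 hN) hNX j (h / d ^ 2) ((habs hj).trans hH₁u)
      (by
        rw [abs_div, abs_of_nonneg (by positivity : (0 : ℝ) ≤ d ^ 2)]
        exact (div_le_self (abs_nonneg _) hd2').trans ((habs hh).trans hH₂u))
      (by
        rcases eq_or_ne h 0 with rfl | hh0
        · left
          refine ⟨by simp, ?_⟩
          have : j ≠ 0 := by simpa using hjh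
          exact_mod_cast Int.one_le_abs this
        · right
          have h4 : (1 : ℝ) ≤ |(h : ℝ)| := by exact_mod_cast Int.one_le_abs hh0
          rw [abs_div, abs_of_nonneg (by positivity : (0 : ℝ) ≤ d ^ 2),
            show (-1 / 10000 : ℝ) = -(1 / 10000) by norm_num, Real.rpow_neg hX0.le,
            ← one_div]
          gcongr)
    refine le_trans (le_of_eq ?_) hphase
    congr 1
    refine sum_congr rfl fun p _ ↦ ?_
    congr 2
    rw [powPhase]
    ring
  · have hΘ := sum_log_dyadicPrimes_le hX0.le
    have hΘ0 : 0 ≤ ∑ p ∈ dyadicPrimes X, Real.log p :=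
      sum_nonneg fun i _ ↦ Real.log_natCast_nonneg i
    have ht1 : 2 / (1 / 100 * (H₁ : ℝ)) * (3 * X) ≤ 1200 * X ^ (1 - (c - 1) - 2 / 1000) := by
      calc 2 / (1 / 100 * (H₁ : ℝ)) * (3 * X)
          ≤ 2 / (1 / 100 * (X ^ (c - 1 + 2 / 1000) / 2)) * (3 * X) := by gcongr
        _ = 1200 * (X ^ (1 : ℝ) / X ^ (c - 1 + 2 / 1000)) := by
            rw [Real.rpow_one]; field_simp; norm_num
        _ = _ := by rw [← Real.rpow_sub hX0]; congr 2; ring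
    have ht2 : 2 / (w * (H₂ : ℝ)) * (3 * X) ≤ 1200 / κ * X ^ (1 - (c - 1) - 19 / 10000) := by
      calc 2 / (w * (H₂ : ℝ)) * (3 * X)
          ≤ 2 / (κ / 100 * X ^ (-(c - 1) - 1 / 10000) *
              (X ^ (2 * (c - 1) + 2 / 1000) / 2)) * (3 * X) := by gcongr
        _ = 1200 / κ * (X ^ (1 : ℝ) / (X ^ (-(c - 1) - 1 / 10000) *
              X ^ (2 * (c - 1) + 2 / 1000))) := by
            rw [Real.rpow_one]; field_simp; norm_num
        _ = _ := by
            rw [← Real.rpow_add hX0, ← Real.rpow_sub hX0]; congr 2; ring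
    have ht3 : (2 / (1 / 100 * (H₁ : ℝ)) + 2 / (w * (H₂ : ℝ))) * ∑ p ∈ dyadicPrimes X, Real.log p ≤
        (2 / (1 / 100 * (H₁ : ℝ)) + 2 / (w * (H₂ : ℝ))) * (3 * X) := by gcongr
    have h3' : 4 * (1200 / κ * X ^ (1 - (c - 1) - 19 / 10000)) ≤ X ^ (1 - (c - 1) - 1 / 1000) :=
      le_trans (le_of_eq (by ring)) h3
    linarith

end Equidistribution

end

section

open Filter

lemma tendsto_PP {c : ℝ} (hc : 0 < c) : Tendsto (PP c) atTop atTop :=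
  ((tendsto_rpow_atTop (by positivity : 0 < 1 / c)).comp
    tendsto_natCast_atTop_atTop).const_mul_atTop (by positivity)

lemma root_eq_mul_PP (c : ℝ) (N : ℕ) : (N : ℝ) ^ (1 / c) = 10 ^ 9 * PP c N := by
  rw [PP]; field_simp

lemma primesIn_eq_dyadicPrimes {c : ℝ} (hc : 1 ≤ c) {N : ℕ} (hN : 0 < N) :
    primesIn c N = dyadicPrimes (PP c N) := by
  have hN1 : (1 : ℝ) ≤ N := by exact_mod_cast hN
  have h0 : 0 ≤ PP c N := by unfold PP; positivity
  have hle : 2 * PP c N ≤ N := by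
    have : (N : ℝ) ^ (1 / c) ≤ N ^ (1 : ℝ) :=
      Real.rpow_le_rpow_of_exponent_le hN1 ((div_le_one (by linarith)).2 hc)
    rw [root_eq_mul_PP, Real.rpow_one] at this
    linarith
  ext p
  rw [primesIn, dyadicPrimes, mem_filter, mem_filter, mem_Ioc, Nat.floor_lt h0,
    Nat.le_floor_iff (by linarith), mem_range]
  constructor
  · rintro ⟨-, h1, h2, h3⟩
    exact ⟨⟨h2, h3⟩, h1⟩
  · rintro ⟨⟨h1, h2⟩, h3⟩
    have : (p : ℝ) ≤ N := by linarith
    exact ⟨Nat.lt_succ_of_le (by exact_mod_cast this), h3, h1, h2⟩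

lemma rpow_le_of_mem_dyadicPrimes {c : ℝ} (hc : 1 ≤ c) {X : ℝ} (hX : 0 < X) {N p : ℕ}
    (hN : 0 < N) (hNX : (N : ℝ) ^ (1 / c) = 10 ^ 9 * X) (hp : p ∈ dyadicPrimes X) :
    (p : ℝ) ^ c ≤ N / 500 := by
  have hpX : (p : ℝ) ≤ 2 * X :=
    (Nat.le_floor_iff (by linarith)).1 (mem_Ioc.1 (mem_filter.1 hp).1).2
  have hN' := rpow_eq_of_root_eq (by linarith) (Nat.cast_pos.2 hN) hNX
  calc (p : ℝ) ^ c ≤ (1 / 500 * (10 ^ 9 * X)) ^ c := by gcongr; linarith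
    _ = (1 / 500) ^ c * N := by rw [hN', Real.mul_rpow (by norm_num) (by positivity)]
    _ ≤ 1 / 500 * N := by
        gcongr
        exact Real.rpow_le_self_of_le_one (by norm_num) (by norm_num) hc
    _ = _ := by ring

lemma sum_one_div_sq_le (n : ℕ) : ∑ d ∈ Icc 2 n, 1 / (d : ℝ) ^ 2 ≤ 3 / 4 := by
  rcases lt_or_ge n 2 with h | h
  · rw [Icc_eq_empty_of_lt h, sum_empty]; norm_num
  suffices H : ∑ d ∈ Icc 2 n, 1 / (d : ℝ) ^ 2 ≤ 3 / 4 - 1 / (n : ℝ) from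
    H.trans (sub_le_self _ (by positivity))
  induction n, h using Nat.le_induction with
  | base => norm_num
  | succ n hn ih =>
    rw [sum_Icc_succ_top (by omega)]
    have hn0 : (0 : ℝ) < n := by positivity
    have : 1 / ((n + 1 : ℕ) : ℝ) ^ 2 ≤ 1 / n - 1 / ((n + 1 : ℕ) : ℝ) := by
      push_cast
      rw [div_sub_div _ _ (by positivity) (by positivity), div_le_div_iff₀ (by positivity)
        (by positivity)]
      nlinarith
    linarith

section Assembly

variable {c X E : ℝ} {N d : ℕ}

lemma sum_log_mul_cnt_le (hc : 1 ≤ c) (hX : 0 < X) (hN : 0 < N)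
    (hNX : (N : ℝ) ^ (1 / c) = 10 ^ 9 * X) (hd : 0 < d)
    (hE : ∀ a b : ℝ, |∑ p ∈ dyadicPrimes X, Real.log p * (hat (1 / 100) ((p : ℝ) ^ c + a) *
          hat (spacing c N / 100 / d ^ 2) (((N : ℝ) - (p : ℝ) ^ c) ^ (1 / c) / d ^ 2 + b)) -
        1 / 100 * (spacing c N / 100 / d ^ 2) * ∑ p ∈ dyadicPrimes X, Real.log p| ≤ E) :
    ∑ p ∈ dyadicPrimes X, Real.log p * (cnt c N d p : ℝ) ≤
      10608 * (1 / 100 * (spacing c N / 100 / d ^ 2) * ∑ p ∈ dyadicPrimes X, Real.log p + E) := by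
  calc ∑ p ∈ dyadicPrimes X, Real.log p * (cnt c N d p : ℝ)
      ≤ ∑ p ∈ dyadicPrimes X, Real.log p * ∑ i ∈ Icc (-100 : ℤ) 1, ∑ r ∈ Icc (-i - 1) (-i + 102),
          hat (1 / 100) ((p : ℝ) ^ c + i * (1 / 100)) *
            hat (spacing c N / 100 / d ^ 2) (((N : ℝ) - (p : ℝ) ^ c) ^ (1 / c) / d ^ 2 +
              r * (spacing c N / 100 / d ^ 2)) := by
        refine sum_le_sum fun p hp ↦ mul_le_mul_of_nonneg_left ?_ (Real.log_natCast_nonneg p)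
        exact cnt_le_sum_hat hc hd (mem_filter.1 hp).2.pos
          (rpow_le_of_mem_dyadicPrimes hc hX hN hNX hp)
    _ = ∑ i ∈ Icc (-100 : ℤ) 1, ∑ r ∈ Icc (-i - 1) (-i + 102), ∑ p ∈ dyadicPrimes X,
          Real.log p * (hat (1 / 100) ((p : ℝ) ^ c + i * (1 / 100)) *
            hat (spacing c N / 100 / d ^ 2) (((N : ℝ) - (p : ℝ) ^ c) ^ (1 / c) / d ^ 2 +
              r * (spacing c N / 100 / d ^ 2))) := by
        simp_rw [mul_sum]
        rw [sum_comm]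
        exact sum_congr rfl fun i _ ↦ sum_comm
    _ ≤ ∑ i ∈ Icc (-100 : ℤ) 1, ∑ r ∈ Icc (-i - 1) (-i + 102),
          (1 / 100 * (spacing c N / 100 / d ^ 2) * ∑ p ∈ dyadicPrimes X, Real.log p + E) :=
        sum_le_sum fun i _ ↦ sum_le_sum fun r _ ↦ by
          linarith [(abs_le.1 (hE (i * (1 / 100)) (r * (spacing c N / 100 / d ^ 2)))).2]
    _ = _ := by
        have hcard : ∀ i : ℤ, #(Icc (-i - 1) (-i + 102)) = 104 := fun i ↦ by
          rw [Int.card_Icc]; omega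
        rw [sum_congr rfl fun i _ ↦ by rw [sum_const, hcard i], sum_const,
          show #(Icc (-100 : ℤ) 1) = 102 from rfl]
        ring

lemma le_sum_log_mul_cnt (hc : 1 ≤ c) (hX : 0 < X) (hN : 0 < N)
    (hNX : (N : ℝ) ^ (1 / c) = 10 ^ 9 * X) (hg : spacing c N ≤ 1)
    (hE : ∀ a b : ℝ, |∑ p ∈ dyadicPrimes X, Real.log p * (hat (1 / 100) ((p : ℝ) ^ c + a) *
          hat (spacing c N / 100) (((N : ℝ) - (p : ℝ) ^ c) ^ (1 / c) + b)) -
        1 / 100 * (spacing c N / 100) * ∑ p ∈ dyadicPrimes X, Real.log p| ≤ E) :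
    9504 * (1 / 100 * (spacing c N / 100) * ∑ p ∈ dyadicPrimes X, Real.log p - E) ≤
      ∑ p ∈ dyadicPrimes X, Real.log p * (cnt c N 1 p : ℝ) := by
  refine ge_iff_le.1 ?_
  calc ∑ p ∈ dyadicPrimes X, Real.log p * (cnt c N 1 p : ℝ)
      ≥ ∑ p ∈ dyadicPrimes X, Real.log p * ∑ i ∈ Icc (-99 : ℤ) (-1), ∑ r ∈ Icc (-i + 3) (-i + 98),
          hat (1 / 100) ((p : ℝ) ^ c + i * (1 / 100)) *
            hat (spacing c N / 100) (((N : ℝ) - (p : ℝ) ^ c) ^ (1 / c) +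
              r * (spacing c N / 100)) := by
        refine sum_le_sum fun p hp ↦ mul_le_mul_of_nonneg_left ?_ (Real.log_natCast_nonneg p)
        exact sum_hat_le_cnt hc (mem_filter.1 hp).2.two_le
          (rpow_le_of_mem_dyadicPrimes hc hX hN hNX hp) hg
    _ = ∑ i ∈ Icc (-99 : ℤ) (-1), ∑ r ∈ Icc (-i + 3) (-i + 98), ∑ p ∈ dyadicPrimes X,
          Real.log p * (hat (1 / 100) ((p : ℝ) ^ c + i * (1 / 100)) *
            hat (spacing c N / 100) (((N : ℝ) - (p : ℝ) ^ c) ^ (1 / c) +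
              r * (spacing c N / 100))) := by
        simp_rw [mul_sum]
        rw [sum_comm]
        exact sum_congr rfl fun i _ ↦ sum_comm
    _ ≥ ∑ i ∈ Icc (-99 : ℤ) (-1), ∑ r ∈ Icc (-i + 3) (-i + 98),
          (1 / 100 * (spacing c N / 100) * ∑ p ∈ dyadicPrimes X, Real.log p - E) :=
        sum_le_sum fun i _ ↦ sum_le_sum fun r _ ↦ by
          linarith [(abs_le.1 (hE (i * (1 / 100)) (r * (spacing c N / 100)))).1]
    _ = _ := by
        have hcard : ∀ i : ℤ, #(Icc (-i + 3) (-i + 98)) = 96 := fun i ↦ by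
          rw [Int.card_Icc]; omega
        rw [sum_congr rfl fun i _ ↦ by rw [sum_const, hcard i], sum_const,
          show #(Icc (-99 : ℤ) (-1)) = 99 from rfl]
        ring

lemma le_Γ₁ (hc : 1 ≤ c) (hX : 0 < X) (hN : 3 ≤ N) (hXN : X = PP c N) (hg : spacing c N ≤ 1)
    (hE0 : 0 ≤ E)
    (hE : ∀ d : ℕ, 0 < d → d ≤ Real.log N → ∀ a b : ℝ,
      |∑ p ∈ dyadicPrimes X, Real.log p * (hat (1 / 100) ((p : ℝ) ^ c + a) *
          hat (spacing c N / 100 / d ^ 2) (((N : ℝ) - (p : ℝ) ^ c) ^ (1 / c) / d ^ 2 + b)) -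
        1 / 100 * (spacing c N / 100 / d ^ 2) * ∑ p ∈ dyadicPrimes X, Real.log p| ≤ E) :
    1 / 10 * spacing c N * ∑ p ∈ dyadicPrimes X, Real.log p - 20112 * Real.log N * E ≤ Γ₁ c N := by
  have hN0 : 0 < N := by omega
  have hNX : (N : ℝ) ^ (1 / c) = 10 ^ 9 * X := by rw [hXN]; exact root_eq_mul_PP c N
  have hlog : 1 ≤ Real.log N := by
    rw [Real.le_log_iff_exp_le (by positivity)]
    have : (3 : ℝ) ≤ N := by exact_mod_cast hN
    linarith [Real.exp_one_lt_d9]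
  set D := ⌊Real.log N⌋₊
  have hD1 : 1 ≤ D := Nat.le_floor (by simpa using hlog)
  have hDlog : (D : ℝ) ≤ Real.log N := Nat.floor_le (by linarith)
  set Θ := ∑ p ∈ dyadicPrimes X, Real.log p with hΘ
  have hΘ0 : 0 ≤ Θ := sum_nonneg fun i _ ↦ Real.log_natCast_nonneg i
  have hg0 : 0 < spacing c N := spacing_pos (by linarith) hN0
  set A : ℕ → ℝ := fun d ↦ ∑ p ∈ dyadicPrimes X, Real.log p * (cnt c N d p : ℝ)
  have hA0 : ∀ d, 0 ≤ A d := fun d ↦ sum_nonneg fun p _ ↦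
    mul_nonneg (Real.log_natCast_nonneg p) (Nat.cast_nonneg _)
  have hA1 : 9504 * (1 / 100 * (spacing c N / 100) * Θ - E) ≤ A 1 :=
    le_sum_log_mul_cnt hc hX hN0 hNX hg fun a b ↦ by
      simpa using hE 1 one_pos (by simpa using hlog) a b
  have hA : ∀ d ∈ Icc 2 D, A d ≤ 10608 / 10000 * (spacing c N * Θ) * (1 / (d : ℝ) ^ 2) +
      10608 * E := fun d hd ↦ by
    obtain ⟨h1, h2⟩ := mem_Icc.1 hd
    have hdlog : (d : ℝ) ≤ Real.log N := le_trans (by exact_mod_cast h2) hDlog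
    refine (sum_log_mul_cnt_le hc hX hN0 hNX (by omega) (hE d (by omega) hdlog)).trans
      (le_of_eq ?_)
    rw [← hΘ]
    ring
  have hsum : ∑ d ∈ Icc 2 D, A d ≤ 10608 / 10000 * (spacing c N * Θ) * (3 / 4) +
      10608 * (D - 1) * E := by
    calc ∑ d ∈ Icc 2 D, A d ≤ ∑ d ∈ Icc 2 D,
          (10608 / 10000 * (spacing c N * Θ) * (1 / (d : ℝ) ^ 2) + 10608 * E) := sum_le_sum hA
      _ = 10608 / 10000 * (spacing c N * Θ) * ∑ d ∈ Icc 2 D, 1 / (d : ℝ) ^ 2 +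
          10608 * (D - 1) * E := by
          rw [sum_add_distrib, ← mul_sum, sum_const, Nat.card_Icc, nsmul_eq_mul,
            show D + 1 - 2 = D - 1 by omega, Nat.cast_sub hD1]
          push_cast
          ring
      _ ≤ _ := by
          gcongr
          exact sum_one_div_sq_le D
  have hΓ : A 1 - ∑ d ∈ Icc 2 D, A d ≤ Γ₁ c N := by
    rw [Γ₁, primesIn_eq_dyadicPrimes hc hN0, ← hXN, ← add_sum_Ioc_eq_sum_Icc hD1,
      ← Icc_add_one_left_eq_Ioc, sub_eq_add_neg, ← sum_neg_distrib]
    refine add_le_add (by simp [A]) (sum_le_sum fun d _ ↦ ?_)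
    have h1 : |((ArithmeticFunction.moebius d : ℤ) : ℝ)| ≤ 1 := by
      exact_mod_cast ArithmeticFunction.abs_moebius_le_one
    have h2 := (abs_le.1 h1).1
    have h3 := mul_le_mul_of_nonneg_right h2 (hA0 d)
    linarith
  have hgΘ : 0 ≤ spacing c N * Θ := by positivity
  have h4 : (D : ℝ) * E ≤ Real.log N * E := by gcongr
  have h5 : 1 * E ≤ Real.log N * E := by gcongr
  linarith

end Assembly

/-- Lower bound for `Γ₁`, in terms of `PP c N`. -/
lemma eventually_le_Γ₁ {c : ℝ} (hc : 1 < c) (hc2 : c < 82 / 79) :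
    ∃ κ : ℝ, 0 < κ ∧ ∀ᶠ N : ℕ in atTop, κ * PP c N ^ (2 - c) ≤ Γ₁ c N := by
  set κ := 1 / c * (10 ^ 9 : ℝ) ^ (-(c - 1)) with hκ
  have hκ0 : 0 < κ := by positivity
  refine ⟨κ / 80, by positivity, ?_⟩
  have hX : ∀ᶠ X : ℝ in atTop, ∀ N : ℕ, 3 ≤ N → X = PP c N → κ / 80 * X ^ (2 - c) ≤ Γ₁ c N := by
    filter_upwards [eventually_ge_atTop 1, eventually_abs_sum_hat_sub_le hc hc2,
      eventually_log_le hc (by linarith) (ε := 1 / 20000) (by norm_num),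
      eventually_le_sum_log_dyadicPrimes,
      eventually_mul_rpow_le (80 / κ * 20112) (a := 1 - (c - 1) - 9 / 10000) (b := 2 - c)
        (by linarith)] with X hX hgood hlog hΘ h1 N hN hXN
    have hX0 : 0 < X := by linarith
    have hN0 : 0 < N := by omega
    have hNX : (N : ℝ) ^ (1 / c) = 10 ^ 9 * X := by rw [hXN]; exact root_eq_mul_PP c N
    have hg : spacing c N ≤ 1 := (spacing_le hc hX0 hN0 hNX).trans
      (Real.rpow_le_one_of_one_le_of_nonpos hX (by linarith))
    refine le_trans ?_ (le_Γ₁ hc.le hX0 hN hXN hg (by positivity) (hgood N hN0 hNX))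
    have h2 : κ / 40 * X ^ (2 - c) ≤
        1 / 10 * spacing c N * ∑ p ∈ dyadicPrimes X, Real.log p := by
      rw [spacing_eq hc hX0 hNX, ← hκ]
      calc κ / 40 * X ^ (2 - c) = 1 / 10 * (κ * X ^ (-(c - 1))) * (X ^ (1 : ℝ) / 4) := by
            rw [show 2 - c = -(c - 1) + 1 by ring, Real.rpow_add hX0]; ring
        _ ≤ _ := by rw [Real.rpow_one]; gcongr
    have h3 : 20112 * Real.log N * X ^ (1 - (c - 1) - 1 / 1000) ≤ κ / 80 * X ^ (2 - c) := by
      calc 20112 * Real.log N * X ^ (1 - (c - 1) - 1 / 1000)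
          ≤ 20112 * X ^ (1 / 20000 : ℝ) * X ^ (1 - (c - 1) - 1 / 1000) := by
            gcongr; exact hlog N hN0 hNX
        _ = 20112 * X ^ (1 / 20000 + (1 - (c - 1) - 1 / 1000)) := by
            rw [mul_assoc, ← Real.rpow_add hX0]
        _ ≤ 20112 * X ^ (1 - (c - 1) - 9 / 10000) := by
            gcongr
            linarith
        _ = κ / 80 * (80 / κ * 20112 * X ^ (1 - (c - 1) - 9 / 10000)) := by field_simp
        _ ≤ _ := by gcongr
    linarith
  filter_upwards [(tendsto_PP (zero_lt_one.trans hc)).eventually hX, eventually_ge_atTop 3]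
    with N hN hN3 using hN N hN3 rfl

end

end SquarefreeSum

/-- Suppose that `1 < c < 82/79` and `γ = 1/c`.  Then there exist a constant `C > 0`
and `N₀` such that `Γ₁ ≥ C · N^(2γ-1)` for all integers `N ≥ N₀`. -/
theorem Gamma1_lower_bound (c : ℝ) (hc1 : 1 < c) (hc2 : c < 82 / 79) :
    ∃ C : ℝ, 0 < C ∧ ∃ N₀ : ℕ, ∀ N : ℕ, N₀ ≤ N →
      C * (N : ℝ) ^ (2 * (1 / c) - 1) ≤ Γ₁ c N := by
  obtain ⟨κ, hκ, h⟩ := SquarefreeSum.eventually_le_Γ₁ hc1 hc2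
  obtain ⟨N₀, hN₀⟩ := Filter.eventually_atTop.1 h
  refine ⟨κ * ((10 : ℝ) ^ 9)⁻¹ ^ (2 - c), by positivity, N₀, fun N hN ↦ ?_⟩
  refine le_trans (le_of_eq ?_) (hN₀ N hN)
  rw [PP, Real.mul_rpow (by positivity) (by positivity), ← Real.rpow_mul (Nat.cast_nonneg N),
    mul_assoc]
  congr 3
  field_simp
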